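/- arXiv:1410.7306 — 3 statements merged into one kernel-verified Lean document; each statement's English description precedes it below -/
import Mathlib

section
/- Let C ⊊ l∞^n be a convex polyhedral cone with nonempty interior. Then C is injective if and only if both of the following hold: (i) the tangent cone T_pC is injective for every p ∈ ∂C ∖ apex(C); and (ii) there exists a facet F of the cube [−1,1]^n with relint(F) ∩ C ≠ ∅ such that relint(−F) ∩ C = ∅. -/
open Set Metric

/-- A metric space `X` is *injective* if for all metric spaces `A`, `B`, every isometric
embedding `i : A → B` and every `1`-Lipschitz map `f : A → X`, there is a `1`-Lipschitz
map `g : B → X` with `g ∘ i = f`. -/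
def IsInjectiveMetricSpace (X : Type) [MetricSpace X] : Prop :=
  ∀ (A B : Type) [MetricSpace A] [MetricSpace B], ∀ (i : A → B) (f : A → X),
    Isometry i → LipschitzWith 1 f →
      ∃ g : B → X, LipschitzWith 1 g ∧ ∀ a, g (i a) = f a

/-- A subset of `l∞ⁿ = (Fin n → ℝ)` (whose product metric is the sup-metric) is injective
if it is an injective metric space with the induced metric. -/
def IsInjectiveSubset {n : ℕ} (S : Set (Fin n → ℝ)) : Prop :=
  IsInjectiveMetricSpace S

/-- A convex polyhedron in `ℝⁿ` is a finite intersection of closed half-spaces. -/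
def IsConvexPolyhedron {n : ℕ} (P : Set (Fin n → ℝ)) : Prop :=
  ∃ (m : ℕ) (ν : Fin m → (Fin n → ℝ)) (c : Fin m → ℝ),
    (∀ i, ν i ≠ 0) ∧ P = ⋂ i, {x | c i ≤ ∑ j, ν i j * x j}

/-- `C` is a cone: it is stable under multiplication by nonnegative scalars. -/
def IsCone {n : ℕ} (C : Set (Fin n → ℝ)) : Prop :=
  ∀ x ∈ C, ∀ t : ℝ, 0 ≤ t → t • x ∈ C

/-- The tangent cone `T_p P = ⋃_{m ∈ ℕ} (p + m (P - p))`. -/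
def tangentCone {n : ℕ} (P : Set (Fin n → ℝ)) (p : Fin n → ℝ) : Set (Fin n → ℝ) :=
  ⋃ m : ℕ, (fun x => p + (m : ℝ) • (x - p)) '' P

/-- The apex of a convex cone `C`, i.e. the largest linear subspace contained in `C`;
for a convex cone it is given by `C ∩ (-C)`. -/
def apexSet {n : ℕ} (C : Set (Fin n → ℝ)) : Set (Fin n → ℝ) :=
  {x | x ∈ C ∧ -x ∈ C}

/-- The facet `{x ∈ [-1,1]ⁿ : x j = τ}` (for `τ = ±1`) of the cube `[-1,1]ⁿ`; every facet
of the cube is of this form. -/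
def cubeFacet {n : ℕ} (j : Fin n) (τ : ℝ) : Set (Fin n → ℝ) :=
  {x | x j = τ ∧ ∀ i, -1 ≤ x i ∧ x i ≤ 1}

open Filter Topology

/-- `S` is the image of a `1`-Lipschitz retraction of `l∞ⁿ`. -/
def IsLipschitzRetract {n : ℕ} (S : Set (Fin n → ℝ)) : Prop :=
  ∃ r : (Fin n → ℝ) → (Fin n → ℝ), LipschitzWith 1 r ∧ (∀ x, r x ∈ S) ∧ ∀ x ∈ S, r x = x

theorem isInjectiveSubset_iff_isLipschitzRetract {n : ℕ} (S : Set (Fin n → ℝ)) :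
    IsInjectiveSubset S ↔ IsLipschitzRetract S := by
  constructor
  · intro h
    obtain ⟨g, hg, hgi⟩ := h S (Fin n → ℝ) Subtype.val id isometry_subtype_coe LipschitzWith.id
    refine ⟨fun x => g x, ?_, fun x => (g x).2, fun x hx => ?_⟩
    · exact fun x y => hg x y
    · have := hgi ⟨x, hx⟩
      simp only [id] at this
      simp [this]
  · rintro ⟨r, hr, hrS, hrfix⟩ A B _ _ i f hi hf
    rcases isEmpty_or_nonempty A with hA | hA
    · exact ⟨fun _ => ⟨r 0, hrS 0⟩, LipschitzWith.const' _, fun a => hA.elim a⟩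
    · have hinv : ∀ a, Function.invFun i (i a) = a := Function.leftInverse_invFun hi.injective
      have hL : LipschitzOnWith 1 (fun b => (f (Function.invFun i b) : Fin n → ℝ)) (range i) := by
        rintro _ ⟨a, rfl⟩ _ ⟨b, rfl⟩
        simp only [hinv]
        rw [hi.edist_eq]
        exact hf a b
      obtain ⟨g, hg, hgf⟩ := hL.extend_pi
      refine ⟨fun b => ⟨r (g b), hrS _⟩, ?_, fun a => ?_⟩
      · intro x y
        simpa using (hr.comp hg) x y
      · have h1 := hgf (mem_range_self a)
        simp only [hinv] at h1
        apply Subtype.ext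
        simp only [← h1]
        exact hrfix _ (f a).2

/-- A pointwise limit along an ultrafilter of approximate retractions is a retraction. -/
theorem IsLipschitzRetract.of_eventually {n : ℕ} {S : Set (Fin n → ℝ)} (hS : IsClosed S)
    (hne : S.Nonempty) {ι : Type*} {l : Filter ι} [l.NeBot]
    (g : ι → (Fin n → ℝ) → (Fin n → ℝ))
    (hlip : ∀ x y, ∀ᶠ i in l, dist (g i x) (g i y) ≤ dist x y)
    (hmem : ∀ x, ∀ᶠ i in l, g i x ∈ S)
    (hfix : ∀ x ∈ S, ∀ᶠ i in l, g i x = x) : IsLipschitzRetract S := by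
  obtain ⟨p, hp⟩ := hne
  set u : Ultrafilter ι := Ultrafilter.of l
  have hu : (u : Filter ι) ≤ l := Ultrafilter.of_le l
  have hlim : ∀ x, ∃ y, Tendsto (fun i => g i x) u (𝓝 y) := by
    intro x
    have hc : IsCompact (closedBall p (dist x p)) := isCompact_closedBall _ _
    have hev : ∀ᶠ i in (u : Filter ι), g i x ∈ closedBall p (dist x p) := by
      filter_upwards [hu (hlip x p), hu (hfix p hp)] with i h1 h2
      rw [h2] at h1
      exact h1
    obtain ⟨y, -, hy⟩ := hc.ultrafilter_le_nhds (u.map fun i => g i x)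
      (by rw [le_principal_iff]; exact hev)
    exact ⟨y, hy⟩
  choose r hr using hlim
  refine ⟨r, LipschitzWith.of_dist_le_mul fun x y => ?_, fun x => ?_, fun x hx => ?_⟩
  · simpa using le_of_tendsto ((hr x).dist (hr y)) (hu (hlip x y))
  · exact hS.mem_of_tendsto (hr x) (hu (hmem x))
  · exact tendsto_nhds_unique (hr x)
      (tendsto_const_nhds.congr' (by filter_upwards [hu (hfix x hx)] with i hi using hi.symm))

/-- A retract of `l∞ⁿ` is hyperconvex. -/
theorem IsLipschitzRetract.exists_mem_forall_dist_le {n : ℕ} {S : Set (Fin n → ℝ)}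
    (hS : IsLipschitzRetract S) {ι : Type*} [Nonempty ι] (x : ι → (Fin n → ℝ)) (ρ : ι → ℝ)
    (hx : ∀ k, x k ∈ S) (h : ∀ k l, dist (x k) (x l) ≤ ρ k + ρ l) :
    ∃ q ∈ S, ∀ k, dist q (x k) ≤ ρ k := by
  obtain ⟨r, hr, hrS, hrfix⟩ := hS
  have hρ : ∀ k, 0 ≤ ρ k := fun k => by
    have := h k k
    rw [dist_self] at this
    linarith
  have hcoord : ∀ k l i, x k i - ρ k ≤ x l i + ρ l := fun k l i => by
    have h1 := (dist_le_pi_dist (x k) (x l) i).trans (h k l)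
    rw [Real.dist_eq] at h1
    linarith [le_abs_self (x k i - x l i)]
  refine ⟨r fun i => ⨆ k, (x k i - ρ k), hrS _, fun k => ?_⟩
  rw [← hrfix _ (hx k)]
  refine (hr.dist_le_mul _ _).trans ?_
  simp only [NNReal.coe_one, one_mul]
  refine (dist_pi_le_iff (hρ k)).2 fun i => ?_
  have h1 : (⨆ k, (x k i - ρ k)) ≤ x k i + ρ k := ciSup_le fun l => hcoord l k i
  have h2 : x k i - ρ k ≤ ⨆ k, (x k i - ρ k) :=
    le_ciSup (f := fun k => x k i - ρ k)
      ⟨x k i + ρ k, by rintro _ ⟨l, rfl⟩; exact hcoord l k i⟩ k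
  rw [Real.dist_eq, abs_le]
  constructor <;> linarith

/-- A closed subset of `l∞ⁿ` that is hyperconvex for finite families is a retract. -/
theorem IsLipschitzRetract.of_finite_hyperconvex {n : ℕ} {S : Set (Fin n → ℝ)} (hS : IsClosed S)
    (hne : S.Nonempty)
    (H : ∀ (F : Finset (Fin n → ℝ)) (x : (Fin n → ℝ) → (Fin n → ℝ)) (ρ : (Fin n → ℝ) → ℝ),
      (∀ k ∈ F, x k ∈ S) → (∀ k ∈ F, ∀ l ∈ F, dist (x k) (x l) ≤ ρ k + ρ l) →
        ∃ q ∈ S, ∀ k ∈ F, dist q (x k) ≤ ρ k) : IsLipschitzRetract S := by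
  classical
  have key : ∀ F₁ : Finset (Fin n → ℝ), (∀ x ∈ F₁, x ∈ S) → ∀ F₂ : Finset (Fin n → ℝ),
      ∃ g : (Fin n → ℝ) → (Fin n → ℝ), (∀ x ∈ F₁ ∪ F₂, g x ∈ S) ∧ (∀ x ∈ F₁, g x = x) ∧
        ∀ x ∈ F₁ ∪ F₂, ∀ y ∈ F₁ ∪ F₂, dist (g x) (g y) ≤ dist x y := by
    intro F₁ hF₁ F₂
    induction F₂ using Finset.induction_on with
    | empty =>
      refine ⟨id, ?_, fun _ _ => rfl, fun _ _ _ _ => le_rfl⟩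
      simpa using hF₁
    | insert e F₂ _ ih =>
      obtain ⟨g, hgS, hgfix, hglip⟩ := ih
      by_cases he : e ∈ F₁ ∪ F₂
      · have : F₁ ∪ insert e F₂ = F₁ ∪ F₂ := by
          rw [Finset.union_insert, Finset.insert_eq_self.2 he]
        rw [this]
        exact ⟨g, hgS, hgfix, hglip⟩
      · obtain ⟨q, hqS, hq⟩ := H (F₁ ∪ F₂) g (fun u => dist e u) hgS fun k hk l hl =>
          (hglip k hk l hl).trans (dist_triangle_left k l e)
        have hne : ∀ x ∈ F₁ ∪ F₂, x ≠ e := fun x hx h => he (h ▸ hx)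
        refine ⟨Function.update g e q, ?_, ?_, ?_⟩
        · intro x hx
          rw [Finset.union_insert, Finset.mem_insert] at hx
          rcases hx with rfl | hx
          · simpa using hqS
          · rw [Function.update_of_ne (hne x hx)]
            exact hgS x hx
        · intro x hx
          rw [Function.update_of_ne (hne x (Finset.mem_union_left _ hx))]
          exact hgfix x hx
        · intro x hx y hy
          rw [Finset.union_insert, Finset.mem_insert] at hx hy
          rcases hx with rfl | hx <;> rcases hy with rfl | hy
          · simp
          · rw [Function.update_self, Function.update_of_ne (hne y hy)]
            exact hq y hy
          · rw [Function.update_self, Function.update_of_ne (hne x hx), dist_comm, dist_comm x]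
            exact hq x hx
          · rw [Function.update_of_ne (hne x hx), Function.update_of_ne (hne y hy)]
            exact hglip x hx y hy
  have key' : ∀ F : Finset (Fin n → ℝ), ∃ g : (Fin n → ℝ) → (Fin n → ℝ), (∀ x ∈ F, g x ∈ S) ∧
      (∀ x ∈ F, x ∈ S → g x = x) ∧ ∀ x ∈ F, ∀ y ∈ F, dist (g x) (g y) ≤ dist x y := by
    intro F
    obtain ⟨g, h1, h2, h3⟩ := key (F.filter (· ∈ S)) (fun x hx => (Finset.mem_filter.1 hx).2) F
    exact ⟨g, fun x hx => h1 x (Finset.mem_union_right _ hx),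
      fun x hx hxS => h2 x (Finset.mem_filter.2 ⟨hx, hxS⟩),
      fun x hx y hy => h3 x (Finset.mem_union_right _ hx) y (Finset.mem_union_right _ hy)⟩
  choose g hgS hgfix hglip using key'
  have hev : ∀ x, ∀ᶠ F : Finset (Fin n → ℝ) in atTop, x ∈ F := fun x => by
    filter_upwards [eventually_ge_atTop {x}] with F hF
    exact hF (Finset.mem_singleton_self x)
  refine .of_eventually (l := atTop) hS hne g (fun x y => ?_) (fun x => ?_) fun x hx => ?_
  · filter_upwards [hev x, hev y] with F h1 h2 using hglip F x h1 y h2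
  · filter_upwards [hev x] with F h1 using hgS F x h1
  · filter_upwards [hev x] with F h1 using hgfix F x h1 hx

section Cone

variable {n : ℕ} {C : Set (Fin n → ℝ)}

theorem IsConvexPolyhedron.isClosed (hC : IsConvexPolyhedron C) : IsClosed C := by
  obtain ⟨m, ν, c, -, rfl⟩ := hC
  exact isClosed_iInter fun i => isClosed_le continuous_const (by fun_prop)

/-- A polyhedral cone is cut out by homogeneous linear inequalities. -/
theorem IsConvexPolyhedron.exists_eq_of_isCone (hC : IsConvexPolyhedron C) (hcone : IsCone C)
    (hne : C.Nonempty) :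
    ∃ (m : ℕ) (f : Fin m → (Fin n → ℝ) →ₗ[ℝ] ℝ), C = {x | ∀ i, 0 ≤ f i x} := by
  obtain ⟨m, ν, c, -, h⟩ := hC
  have hmem : ∀ x, x ∈ C ↔ ∀ i, c i ≤ ∑ j, ν i j * x j := fun x => by rw [h]; simp
  let f : Fin m → (Fin n → ℝ) →ₗ[ℝ] ℝ := fun i => ∑ j, ν i j • LinearMap.proj j
  have hf : ∀ i x, f i x = ∑ j, ν i j * x j := fun i x => by simp [f]
  refine ⟨m, f, ?_⟩
  simp only [← hf] at hmem
  obtain ⟨y, hy⟩ := hne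
  have h0 : (0 : Fin n → ℝ) ∈ C := by simpa using hcone y hy 0 le_rfl
  have hc : ∀ i, c i ≤ 0 := fun i => by simpa using (hmem 0).1 h0 i
  ext x
  refine ⟨fun hx i => ?_, fun hx => (hmem x).2 fun i => (hc i).trans (hx i)⟩
  by_contra hneg
  push Not at hneg
  obtain ⟨t, ht⟩ := exists_nat_gt (c i / f i x)
  have h1 := (hmem _).1 (hcone x hx t t.cast_nonneg) i
  rw [map_smul, smul_eq_mul] at h1
  rw [div_lt_iff_of_neg hneg] at ht
  linarith

theorem IsCone.zero_mem (hcone : IsCone C) (hne : C.Nonempty) : (0 : Fin n → ℝ) ∈ C := by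
  obtain ⟨y, hy⟩ := hne
  simpa using hcone y hy 0 le_rfl

theorem IsConvexPolyhedron.add_mem (hC : IsConvexPolyhedron C) (hcone : IsCone C) :
    ∀ x ∈ C, ∀ y ∈ C, x + y ∈ C := by
  intro x hx y hy
  obtain ⟨m, f, rfl⟩ := hC.exists_eq_of_isCone hcone ⟨x, hx⟩
  intro i
  rw [map_add]
  exact add_nonneg (hx i) (hy i)

theorem mem_tangentCone {P : Set (Fin n → ℝ)} {p x : Fin n → ℝ} :
    x ∈ tangentCone P p ↔ ∃ m : ℕ, ∃ y ∈ P, p + (m : ℝ) • (y - p) = x := by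
  simp [tangentCone]

theorem subset_tangentCone (P : Set (Fin n → ℝ)) (p : Fin n → ℝ) : P ⊆ tangentCone P p :=
  fun x hx => mem_tangentCone.2 ⟨1, x, hx, by simp⟩

/-- Points of the tangent cone at `p` are seen, from `p`, in the direction of the cone. -/
theorem eventually_add_smul_mem_of_mem_tangentCone (hcone : IsCone C)
    (hadd : ∀ x ∈ C, ∀ y ∈ C, x + y ∈ C) {p x : Fin n → ℝ} (hp : p ∈ C)
    (hx : x ∈ tangentCone C p) :
    ∀ᶠ m : ℕ in atTop, p + (m : ℝ)⁻¹ • (x - p) ∈ C := by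
  obtain ⟨m, y, hy, rfl⟩ := mem_tangentCone.1 hx
  filter_upwards [eventually_ge_atTop m, eventually_gt_atTop 0] with k hk hk0
  have hk0' : (0 : ℝ) < k := by exact_mod_cast hk0
  have hle : (m : ℝ) / k ≤ 1 := by
    rw [div_le_one hk0']
    exact_mod_cast hk
  have : p + (k : ℝ)⁻¹ • (p + (m : ℝ) • (y - p) - p)
      = (1 - (m : ℝ) / k) • p + ((m : ℝ) / k) • y := by
    ext i
    simp only [Pi.add_apply, Pi.smul_apply, Pi.sub_apply, smul_eq_mul]
    ring
  rw [this]
  exact hadd _ (hcone p hp _ (by linarith)) _ (hcone y hy _ (by positivity))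

theorem isClosed_tangentCone (hC : IsConvexPolyhedron C) (hcone : IsCone C) {p : Fin n → ℝ}
    (hp : p ∈ C) : IsClosed (tangentCone C p) := by
  obtain ⟨m, f, rfl⟩ := hC.exists_eq_of_isCone hcone ⟨p, hp⟩
  have hcont : ∀ i, Continuous (f i) := fun i => (f i).continuous_of_finiteDimensional
  have heq : tangentCone {x | ∀ i, 0 ≤ f i x} p = ⋂ i, ⋂ (_ : f i p = 0), {x | 0 ≤ f i x} := by
    ext x
    simp only [mem_iInter, mem_ofPred_eq]
    constructor
    · intro hx i hi
      obtain ⟨k, y, hy, rfl⟩ := mem_tangentCone.1 hx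
      simp only [map_add, map_smul, map_sub, hi, smul_eq_mul, zero_add, sub_zero]
      exact mul_nonneg k.cast_nonneg (hy i)
    · intro hx
      have hev : ∀ i, ∀ᶠ k : ℕ in atTop, 0 ≤ f i (p + (k : ℝ)⁻¹ • (x - p)) := by
        intro i
        rcases (hp i).eq_or_lt with h0 | h0
        · filter_upwards with k
          simp only [map_add, map_smul, map_sub, ← h0, smul_eq_mul, zero_add, sub_zero]
          exact mul_nonneg (by positivity) (hx i h0.symm)
        · have hlim : Tendsto (fun k : ℕ => f i (p + (k : ℝ)⁻¹ • (x - p))) atTop (𝓝 (f i p)) := by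
            have := (tendsto_inv_atTop_nhds_zero_nat (𝕜 := ℝ)).mul_const (f i (x - p))
            simpa using this.const_add (f i p)
          filter_upwards [hlim.eventually (lt_mem_nhds h0)] with k hk using hk.le
      obtain ⟨k, hk, hk0⟩ := ((eventually_all.2 hev).and (eventually_gt_atTop 0)).exists
      refine mem_tangentCone.2 ⟨k, _, hk, ?_⟩
      have : (k : ℝ) ≠ 0 := by exact_mod_cast hk0.ne'
      simp [smul_smul, this]
  rw [heq]
  exact isClosed_iInter fun i => isClosed_iInter fun _ =>
    isClosed_le continuous_const (hcont i)

theorem IsLipschitzRetract.isLipschitzRetract_tangentCone (hC : IsConvexPolyhedron C) (hcone : IsCone C)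
    (h : IsLipschitzRetract C) {p : Fin n → ℝ} (hp : p ∈ C) :
    IsLipschitzRetract (tangentCone C p) := by
  obtain ⟨r, hr, hrC, hrfix⟩ := h
  refine .of_eventually (l := atTop) (isClosed_tangentCone hC hcone hp)
    ⟨p, subset_tangentCone C p hp⟩
    (fun (m : ℕ) x => p + (m : ℝ) • (r (p + (m : ℝ)⁻¹ • (x - p)) - p)) ?_ ?_ ?_
  · intro x y
    filter_upwards [eventually_gt_atTop 0] with m hm
    have hm' : (0 : ℝ) < m := by exact_mod_cast hm
    have h1 := hr.dist_le_mul (p + (m : ℝ)⁻¹ • (x - p)) (p + (m : ℝ)⁻¹ • (y - p))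
    simp only [NNReal.coe_one, one_mul, dist_add_left, dist_smul₀, dist_sub_right, norm_inv,
      Real.norm_of_nonneg hm'.le] at h1 ⊢
    calc (m : ℝ) * _ ≤ m * ((m : ℝ)⁻¹ * dist x y) := by gcongr
      _ = dist x y := by field_simp
  · intro x
    filter_upwards with m
    exact mem_tangentCone.2 ⟨m, _, hrC _, rfl⟩
  · intro x hx
    filter_upwards [eventually_add_smul_mem_of_mem_tangentCone hcone (hC.add_mem hcone) hp hx,
      eventually_gt_atTop 0] with m hm hm0
    have : (m : ℝ) ≠ 0 := by exact_mod_cast hm0.ne'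
    rw [hrfix _ hm]
    simp [smul_smul, this]

theorem tangentCone_eq_univ_of_mem_interior {p : Fin n → ℝ} (hp : p ∈ interior C) :
    tangentCone C p = univ := by
  refine eq_univ_of_forall fun x => ?_
  have hlim : Tendsto (fun k : ℕ => p + (k : ℝ)⁻¹ • (x - p)) atTop (𝓝 p) := by
    have := (tendsto_inv_atTop_nhds_zero_nat (𝕜 := ℝ)).smul_const (x - p)
    simpa using this.const_add p
  obtain ⟨k, hk, hk0⟩ := ((hlim.eventually (mem_interior_iff_mem_nhds.1 hp)).and
    (eventually_gt_atTop 0)).exists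
  have : (k : ℝ) ≠ 0 := by exact_mod_cast hk0.ne'
  exact mem_tangentCone.2 ⟨k, _, hk, by simp [smul_smul, this]⟩

theorem isLipschitzRetract_univ : IsLipschitzRetract (univ : Set (Fin n → ℝ)) :=
  ⟨id, LipschitzWith.id, fun _ => mem_univ _, fun _ _ => rfl⟩

/-- The cone over the relative interior of a facet of the cube. -/
def openFacetCone (j : Fin n) (τ : ℝ) : Set (Fin n → ℝ) :=
  {x | 0 < τ * x j ∧ ∀ i, i ≠ j → |x i| < τ * x j}

theorem intrinsicInterior_cubeFacet {j : Fin n} {τ : ℝ} (hτ : τ = 1 ∨ τ = -1) :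
    intrinsicInterior ℝ (cubeFacet j τ) = {x | x j = τ ∧ ∀ i, i ≠ j → |x i| < 1} := by
  have hτ1 : -1 ≤ τ ∧ τ ≤ 1 := by rcases hτ with rfl | rfl <;> norm_num
  have hmem : ∀ x : Fin n → ℝ, (x j = τ ∧ ∀ i, i ≠ j → |x i| < 1) → x ∈ cubeFacet j τ := by
    rintro x ⟨hx, hx'⟩
    refine ⟨hx, fun i => ?_⟩
    by_cases hi : i = j
    · subst hi
      rwa [hx]
    · exact abs_le.1 (hx' i hi).le
  have hspan : ∀ x ∈ affineSpan ℝ (cubeFacet j τ), x j = τ := by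
    intro x hx
    refine affineSpan_induction hx (fun y hy => hy.1) fun c u v w hu hv hw => ?_
    simp [hu, hv, hw]
  ext x
  rw [mem_intrinsicInterior]
  constructor
  · rintro ⟨y, hy, rfl⟩
    refine ⟨hspan y y.2, fun i hi => ?_⟩
    have hyF : y ∈ Subtype.val ⁻¹' cubeFacet j τ := interior_subset hy
    set o : Fin n → ℝ := Pi.single j τ with ho
    have hoF : o ∈ cubeFacet j τ := hmem o ⟨by simp [ho], fun k hk => by simp [ho, hk]⟩
    have hspan' : ∀ t : ℝ, AffineMap.lineMap o (y : Fin n → ℝ) t ∈ affineSpan ℝ (cubeFacet j τ) :=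
      fun t => AffineMap.lineMap_mem t (subset_affineSpan ℝ _ hoF) y.2
    let γ : ℝ → affineSpan ℝ (cubeFacet j τ) := fun t => ⟨_, hspan' t⟩
    have hγ : Continuous γ := Continuous.subtype_mk AffineMap.lineMap_continuous _
    have hγ1 : γ 1 = y := by simp [γ]
    have hev : ∀ᶠ t in 𝓝 (1 : ℝ), (γ t : Fin n → ℝ) ∈ cubeFacet j τ := by
      have h1 := hγ.tendsto 1
      rw [hγ1] at h1
      exact h1.eventually (mem_interior_iff_mem_nhds.1 hy)
    obtain ⟨t, ht, ht1⟩ := ((hev.filter_mono nhdsWithin_le_nhds).and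
      (self_mem_nhdsWithin : Ioi (1 : ℝ) ∈ 𝓝[>] 1)).exists
    have hval : (γ t : Fin n → ℝ) i = t * (y : Fin n → ℝ) i := by
      simp [γ, AffineMap.lineMap_apply, ho, hi]
    have h1 := abs_le.2 (ht.2 i)
    rw [hval, abs_mul, abs_of_pos (zero_lt_one.trans ht1)] at h1
    have ht1' : 1 < t := ht1
    by_contra hcon
    push Not at hcon
    nlinarith
  · intro hx
    refine ⟨⟨x, subset_affineSpan ℝ _ (hmem x hx)⟩, ?_, rfl⟩
    rw [mem_interior_iff_mem_nhds]
    have hopen : ∀ᶠ z in 𝓝 x, ∀ i, i ≠ j → |z i| < 1 := by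
      refine eventually_all.2 fun i => ?_
      by_cases hi : i = j
      · simp [hi]
      · have : ContinuousAt (fun z : Fin n → ℝ => |z i|) x :=
          (continuous_apply i).abs.continuousAt
        filter_upwards [this.eventually (gt_mem_nhds (hx.2 i hi))] with z hz _ using hz
    have : ∀ᶠ z : affineSpan ℝ (cubeFacet j τ) in
        𝓝 ⟨x, subset_affineSpan ℝ _ (hmem x hx)⟩, ∀ i, i ≠ j → |(z : Fin n → ℝ) i| < 1 :=
      (continuous_subtype_val.tendsto (⟨x, subset_affineSpan ℝ _ (hmem x hx)⟩ :
        affineSpan ℝ (cubeFacet j τ))).eventually hopen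
    filter_upwards [this] with z hz
    exact hmem z ⟨hspan z z.2, hz⟩

theorem intrinsicInterior_cubeFacet_inter_nonempty_iff (hcone : IsCone C) {j : Fin n} {τ : ℝ}
    (hτ : τ = 1 ∨ τ = -1) :
    (intrinsicInterior ℝ (cubeFacet j τ) ∩ C).Nonempty ↔ (openFacetCone j τ ∩ C).Nonempty := by
  have hττ : τ * τ = 1 := by rcases hτ with rfl | rfl <;> norm_num
  rw [intrinsicInterior_cubeFacet hτ]
  constructor
  · rintro ⟨x, ⟨hx, hx'⟩, hxC⟩
    refine ⟨x, ⟨?_, fun i hi => ?_⟩, hxC⟩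
    · rw [hx, hττ]
      exact one_pos
    · rw [hx, hττ]
      exact hx' i hi
  · rintro ⟨x, ⟨hx, hx'⟩, hxC⟩
    refine ⟨(τ * x j)⁻¹ • x, ⟨?_, fun i hi => ?_⟩, hcone x hxC _ (by positivity)⟩
    · have hxj : x j ≠ 0 := fun h => by simp [h] at hx
      rcases hτ with rfl | rfl <;> simp [hxj]
    · rw [Pi.smul_apply, smul_eq_mul, abs_mul, abs_of_pos (inv_pos.2 hx), inv_mul_lt_one₀ hx]
      exact hx' i hi

/-- A retraction onto a set containing a cone over a facet direction is monotone in it. -/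
theorem mul_apply_le_of_mem_openFacetCone (hcone : IsCone C) {r : (Fin n → ℝ) → (Fin n → ℝ)}
    (hr : LipschitzWith 1 r) (hfix : ∀ x ∈ C, r x = x) {j : Fin n} {τ : ℝ}
    (hτ : τ = 1 ∨ τ = -1) {a : Fin n → ℝ} (haC : a ∈ C) (ha : a ∈ openFacetCone j τ)
    (z : Fin n → ℝ) : τ * z j ≤ τ * r z j := by
  have hτ1 : |τ| = 1 := by rcases hτ with rfl | rfl <;> simp
  have habs : ∀ x y : ℝ, |x - y| = |τ * x - τ * y| := fun x y => by
    rw [← mul_sub, abs_mul, hτ1, one_mul]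
  have hev : ∀ i, ∀ᶠ t : ℝ in atTop, |z i - t * a i| ≤ t * (τ * a j) - τ * z j := by
    intro i
    by_cases hi : i = j
    · subst hi
      filter_upwards [eventually_ge_atTop ((τ * z i) / (τ * a i))] with t ht
      rw [div_le_iff₀ ha.1] at ht
      rw [habs, abs_le]
      constructor <;> nlinarith
    · have hpos : 0 < τ * a j - |a i| := sub_pos.2 (ha.2 i hi)
      filter_upwards [eventually_ge_atTop ((|z i| + τ * z j) / (τ * a j - |a i|)),
        eventually_ge_atTop 0] with t ht ht0
      rw [div_le_iff₀ hpos] at ht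
      have h1 := abs_sub (z i) (t * a i)
      rw [abs_mul, abs_of_nonneg ht0] at h1
      nlinarith
  obtain ⟨t, ht, ht0⟩ := ((eventually_all.2 hev).and (eventually_ge_atTop 0)).exists
  have hd : dist z (t • a) ≤ t * (τ * a j) - τ * z j :=
    (dist_pi_le_iff ((abs_nonneg _).trans (ht j))).2 fun i => by
      simpa [Real.dist_eq] using ht i
  have h2 := hr.dist_le_mul z (t • a)
  rw [hfix _ (hcone a haC t ht0), NNReal.coe_one, one_mul] at h2
  have h3 := ((dist_le_pi_dist (r z) (t • a) j).trans h2).trans hd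
  rw [Real.dist_eq, habs, Pi.smul_apply, smul_eq_mul] at h3
  have := (abs_le.1 h3).1
  nlinarith

theorem IsLipschitzRetract.exists_openFacetCone (hcone : IsCone C)
    (hadd : ∀ x ∈ C, ∀ y ∈ C, x + y ∈ C) (hne : C ≠ univ) (hint : (interior C).Nonempty)
    (h : IsLipschitzRetract C) :
    ∃ (j : Fin n) (τ : ℝ), (τ = 1 ∨ τ = -1) ∧ (openFacetCone j τ ∩ C).Nonempty ∧
      ¬ (openFacetCone j (-τ) ∩ C).Nonempty := by
  by_contra! H
  obtain ⟨r, hr, hrC, hfix⟩ := h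
  obtain ⟨c, hc⟩ := hint
  have hpres : ∀ (j : Fin n) (τ : ℝ), (τ = 1 ∨ τ = -1) → (openFacetCone j τ ∩ C).Nonempty →
      ∀ z, r z j = z j := by
    intro j τ hτ hj z
    obtain ⟨b, hb, hbC⟩ := H j τ hτ hj
    obtain ⟨a, ha, haC⟩ := hj
    have h1 := mul_apply_le_of_mem_openFacetCone hcone hr hfix hτ haC ha z
    have h2 := mul_apply_le_of_mem_openFacetCone hcone hr hfix
      (by rcases hτ with rfl | rfl <;> simp) hbC hb z
    rcases hτ with rfl | rfl <;> linarith
  have hzero : ∀ x ∈ C, (∀ (j : Fin n) (τ : ℝ), (τ = 1 ∨ τ = -1) →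
      (openFacetCone j τ ∩ C).Nonempty → x j = 0) → x = 0 := by
    intro x hx hxz
    by_contra hx0
    have hxpos : 0 < ‖x‖ := norm_pos_iff.2 hx0
    obtain ⟨ρ, hρ, hball⟩ := Metric.nhds_basis_closedBall.mem_iff.1
      (mem_interior_iff_mem_nhds.1 hc)
    obtain ⟨ε, hε, hεc⟩ : ∃ ε : ℝ, 0 < ε ∧ ε * ‖c‖ < ‖x‖ / 2 := by
      refine ⟨‖x‖ / 2 / (‖c‖ + 1), by positivity, ?_⟩
      rw [div_mul_eq_mul_div, div_lt_iff₀ (by positivity)]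
      nlinarith [norm_nonneg c]
    set y := x + ε • c with hy
    have hnε : ‖ε • c‖ < ‖x‖ / 2 := by rwa [norm_smul, Real.norm_of_nonneg hε.le]
    have hynorm : ‖x‖ / 2 < ‖y‖ := by
      have := norm_sub_le y (ε • c)
      rw [hy, add_sub_cancel_right] at this
      linarith
    have hnn : Nonempty (Fin n) := by
      by_contra hemp
      rw [not_nonempty_iff] at hemp
      exact hx0 (Subsingleton.elim _ _)
    obtain ⟨i, hi⟩ := Finite.exists_max fun i => |y i|
    have hyi : ‖y‖ = |y i| := le_antisymm
      ((pi_norm_le_iff_of_nonneg (abs_nonneg _)).2 hi) (norm_le_pi_norm y i)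
    obtain ⟨σ, hσ, hσi⟩ : ∃ σ : ℝ, (σ = 1 ∨ σ = -1) ∧ σ * y i = |y i| := by
      rcases abs_cases (y i) with h | h
      · exact ⟨1, .inl rfl, by rw [h.1, one_mul]⟩
      · exact ⟨-1, .inr rfl, by rw [h.1, neg_one_mul]⟩
    have hσσ : σ * σ = 1 := by rcases hσ with rfl | rfl <;> norm_num
    have hσ1 : |σ| = 1 := by rcases hσ with rfl | rfl <;> simp
    have hmem : x + ε • (c + Pi.single i (ρ * σ)) ∈ C := by
      refine hadd _ hx _ (hcone _ (hball ?_) _ hε.le)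
      rw [mem_closedBall, dist_self_add_left, Pi.norm_single, norm_mul, Real.norm_eq_abs,
        Real.norm_eq_abs, hσ1, mul_one, abs_of_pos hρ]
    have heq : x + ε • (c + Pi.single i (ρ * σ)) = y + ε • Pi.single i (ρ * σ) := by
      rw [hy, smul_add, add_assoc]
    have hvi : σ * (x + ε • (c + Pi.single i (ρ * σ)) : Fin n → ℝ) i = |y i| + ε * ρ := by
      rw [heq, Pi.add_apply, Pi.smul_apply, Pi.single_eq_same, smul_eq_mul, mul_add, hσi]
      linear_combination (ε * ρ) * hσσ
    have hxi := hxz i σ hσ ⟨_, ⟨?_, fun k hk => ?_⟩, hmem⟩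
    · have h1 : |y i| ≤ ‖ε • c‖ := by
        rw [hy, Pi.add_apply, hxi, zero_add]
        exact norm_le_pi_norm (ε • c) i
      linarith
    · rw [hvi]
      positivity
    · rw [hvi, heq, Pi.add_apply, Pi.smul_apply, Pi.single_eq_of_ne hk, smul_zero, add_zero]
      have := mul_pos hε hρ
      linarith [hi k]
  have hneg : ∀ x ∈ C, -x ∈ C := by
    intro x hx
    have h1 : x + r (-x) = 0 := by
      refine hzero _ (hadd _ hx _ (hrC _)) fun j τ hτ hj => ?_
      rw [Pi.add_apply, hpres j τ hτ hj, Pi.neg_apply, add_neg_cancel]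
    rw [← eq_neg_of_add_eq_zero_right h1]
    exact hrC _
  refine hne (eq_univ_of_forall fun x => ?_)
  have hx : c + x ∈ tangentCone C c := by
    rw [tangentCone_eq_univ_of_mem_interior hc]
    trivial
  obtain ⟨m, y, hy, hyx⟩ := mem_tangentCone.1 hx
  rw [← add_left_cancel hyx, sub_eq_add_neg]
  exact hcone _ (hadd _ hy _ (hneg c (interior_subset hc))) _ m.cast_nonneg

/-- Two functionals nonnegative on a closed convex cone can be combined into a nonnegative one
vanishing somewhere off the apex. -/
theorem exists_nonneg_combination_eq_zero (hclosed : IsClosed C) (hcone : IsCone C)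
    (hadd : ∀ x ∈ C, ∀ y ∈ C, x + y ∈ C) (f μ : (Fin n → ℝ) →L[ℝ] ℝ)
    (hf : ∀ x ∈ C, 0 ≤ f x) (hμ : ∀ x ∈ C, 0 ≤ μ x) {a : Fin n → ℝ} (ha : a ∈ C)
    (hμa : 0 < μ a) :
    ∃ t : ℝ, 0 ≤ t ∧ (∀ x ∈ C, 0 ≤ (f - t • μ) x) ∧
      ∃ p ∈ C, p ∉ apexSet C ∧ (f - t • μ) p = 0 := by
  have h0 : (0 : Fin n → ℝ) ∈ C := hcone.zero_mem ⟨a, ha⟩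
  let L : Submodule ℝ (Fin n → ℝ) :=
    { carrier := apexSet C
      zero_mem' := ⟨h0, by simpa using h0⟩
      add_mem' := fun {x y} hx hy =>
        ⟨hadd _ hx.1 _ hy.1, by rw [neg_add]; exact hadd _ hx.2 _ hy.2⟩
      smul_mem' := fun c x hx => by
        rcases le_total 0 c with hc | hc
        · exact ⟨hcone _ hx.1 c hc, by rw [← smul_neg]; exact hcone _ hx.2 c hc⟩
        · refine ⟨?_, ?_⟩
          · rw [← neg_smul_neg]
            exact hcone _ hx.2 _ (neg_nonneg.2 hc)
          · rw [← neg_smul]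
            exact hcone _ hx.1 _ (neg_nonneg.2 hc) }
  have hL : ∀ x, x ∈ L ↔ x ∈ apexSet C := fun x => Iff.rfl
  have hvanish : ∀ g : (Fin n → ℝ) →L[ℝ] ℝ, (∀ x ∈ C, 0 ≤ g x) → ∀ l ∈ L, g l = 0 := by
    intro g hg l hl
    have h1 := hg l hl.1
    have h2 := hg _ hl.2
    rw [map_neg] at h2
    linarith
  obtain ⟨L', hL'⟩ := L.exists_isCompl
  let K : Set (Fin n → ℝ) := C ∩ L' ∩ sphere 0 1
  have hK : IsCompact K := (isCompact_sphere 0 1).inter_left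
    (hclosed.inter L'.closed_of_finiteDimensional)
  have hKapex : ∀ k ∈ K, k ∉ apexSet C := by
    intro k hk hkL
    have : k = 0 := by
      have := hL'.disjoint.le_bot ⟨(hL k).2 hkL, hk.1.2⟩
      simpa using this
    have h1 := hk.2
    rw [this] at h1
    simp at h1
  have hext : ∀ g : (Fin n → ℝ) →L[ℝ] ℝ, (∀ l ∈ L, g l = 0) → (∀ k ∈ K, 0 ≤ g k) →
      ∀ x ∈ C, 0 ≤ g x := by
    intro g hgL hgK x hx
    obtain ⟨l, hl, u, hu, rfl⟩ := Submodule.mem_sup.1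
      (hL'.sup_eq_top ▸ Submodule.mem_top : x ∈ L ⊔ L')
    rw [map_add, hgL l hl, zero_add]
    rcases eq_or_ne u 0 with rfl | hu0
    · simp
    have huC : u ∈ C := by simpa using hadd _ hx _ hl.2
    have hn : 0 < ‖u‖ := norm_pos_iff.2 hu0
    have h1 := hgK (‖u‖⁻¹ • u) ⟨⟨hcone _ huC _ (by positivity), L'.smul_mem _ hu⟩, by
      simp [norm_smul, hn.ne']⟩
    rw [map_smul, smul_eq_mul] at h1
    exact nonneg_of_mul_nonneg_right h1 (by positivity)
  obtain ⟨k₀, hk₀, hμk₀⟩ : ∃ k ∈ K, 0 < μ k := by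
    by_contra! hcon
    have := hext (-μ) (fun l hl => by simp [hvanish μ hμ l hl])
      (fun k hk => by simpa using hcon k hk) a ha
    simp at this
    linarith
  by_cases hex : ∃ k ∈ K, f k = 0
  · obtain ⟨k, hk, hfk⟩ := hex
    exact ⟨0, le_rfl, by simpa using hf, k, hk.1.1, hKapex k hk, by simpa using hfk⟩
  push Not at hex
  have hfpos : ∀ k ∈ K, 0 < f k := fun k hk => (hf k hk.1.1).lt_of_ne (hex k hk).symm
  obtain ⟨p, hp, hpmax⟩ := hK.exists_isMaxOn ⟨k₀, hk₀⟩
    (f := fun k => μ k / f k) (μ.continuous.continuousOn.div f.continuous.continuousOn hex)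
  have hmax : ∀ k ∈ K, μ k / f k ≤ μ p / f p := fun k hk => hpmax hk
  have hμp : 0 < μ p := by
    have h1 := (div_pos hμk₀ (hfpos k₀ hk₀)).trans_le (hmax k₀ hk₀)
    exact (div_pos_iff_of_pos_right (hfpos p hp)).1 h1
  have hfp := hfpos p hp
  refine ⟨f p / μ p, by positivity, ?_, p, hp.1.1, hKapex p hp, ?_⟩
  · refine hext _ (fun l hl => ?_) fun k hk => ?_
    · simp [hvanish μ hμ l hl, hvanish f hf l hl]
    · have h1 := hmax k hk
      rw [div_le_div_iff₀ (hfpos k hk) hfp] at h1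
      simp only [sub_apply, smul_apply, smul_eq_mul]
      rw [div_mul_eq_mul_div, sub_nonneg, div_le_iff₀ hμp]
      linarith
  · simp only [sub_apply, smul_apply, smul_eq_mul]
    field_simp
    simp

theorem convex_openFacetCone (j : Fin n) (τ : ℝ) : Convex ℝ (openFacetCone j τ) := by
  have key : ∀ x y a b p q : ℝ, 0 ≤ a → 0 ≤ b → a + b = 1 → x < p → y < q →
      a * x + b * y < a * p + b * q := by
    intro x y a b p q ha hb hab hx hy
    rcases ha.eq_or_lt with rfl | ha'
    · have : b = 1 := by linarith
      subst this
      linarith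
    · nlinarith
  intro x hx y hy a b ha hb hab
  have heq : τ * (a • x + b • y) j = a * (τ * x j) + b * (τ * y j) := by
    simp only [Pi.add_apply, Pi.smul_apply, smul_eq_mul]
    ring
  refine ⟨?_, fun i hi => ?_⟩
  · rw [heq]
    simpa using key 0 0 a b _ _ ha hb hab hx.1 hy.1
  · rw [heq]
    refine (abs_add_le _ _).trans_lt ?_
    simp only [Pi.smul_apply, smul_eq_mul, abs_mul, abs_of_nonneg ha, abs_of_nonneg hb]
    exact key _ _ a b _ _ ha hb hab (hx.2 i hi) (hy.2 i hi)

theorem isOpen_openFacetCone (j : Fin n) (τ : ℝ) : IsOpen (openFacetCone j τ) := by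
  have : openFacetCone j τ = {x | 0 < τ * x j} ∩ ⋂ i, ⋂ (_ : i ≠ j), {x | |x i| < τ * x j} := by
    ext x
    simp [openFacetCone]
  rw [this]
  have hc : ∀ i, Continuous fun x : Fin n → ℝ => x i := continuous_apply
  exact (isOpen_lt continuous_const ((hc j).const_mul τ)).inter
    (isOpen_iInter_of_finite fun i => isOpen_iInter_of_finite fun _ =>
      isOpen_lt (hc i).abs ((hc j).const_mul τ))

/-- If a convex cone misses the open cone over the facet `-F`, then it lies in a half-space that
also contains the cone over `F`. -/
theorem exists_nonneg_functional (hcone : IsCone C) (hadd : ∀ x ∈ C, ∀ y ∈ C, x + y ∈ C)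
    {j : Fin n} {τ : ℝ} (hpos : (openFacetCone j τ ∩ C).Nonempty)
    (hneg : ¬ (openFacetCone j (-τ) ∩ C).Nonempty) :
    ∃ μ : (Fin n → ℝ) →L[ℝ] ℝ, (∀ x ∈ C, 0 ≤ μ x) ∧ (∀ x ∈ openFacetCone j τ, 0 < μ x) ∧
      ∀ x, (∀ i, |x i| ≤ τ * x j) → 0 ≤ μ x := by
  obtain ⟨a, ha, haC⟩ := hpos
  have hconv : Convex ℝ C := fun x hx y hy s t hs ht _ =>
    hadd _ (hcone x hx s hs) _ (hcone y hy t ht)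
  obtain ⟨μ, u, hμ1, hμ2⟩ := geometric_hahn_banach_open (convex_openFacetCone j (-τ))
    (isOpen_openFacetCone j (-τ)) hconv
    (disjoint_iff_inter_eq_empty.2 (not_nonempty_iff_eq_empty.1 hneg))
  have hu : u ≤ 0 := by simpa using hμ2 0 (hcone.zero_mem ⟨a, haC⟩)
  have hμpos : ∀ x ∈ openFacetCone j τ, 0 < μ x := by
    intro x hx
    have h1 := hμ1 (-x) ⟨by simpa using hx.1, fun i hi => by simpa using hx.2 i hi⟩
    rw [map_neg] at h1
    linarith
  refine ⟨μ, fun x hx => ?_, hμpos, fun x hx => ?_⟩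
  · by_contra! hcon
    obtain ⟨t, ht⟩ := exists_nat_gt (u / μ x)
    have h1 := hμ2 _ (hcone x hx t t.cast_nonneg)
    rw [map_smul, smul_eq_mul] at h1
    rw [div_lt_iff_of_neg hcon] at ht
    linarith
  · by_contra! hcon
    have hμa := hμpos a ha
    have hε : 0 < -μ x / μ a := div_pos (neg_pos.2 hcon) hμa
    have hxj : 0 ≤ τ * x j := (abs_nonneg _).trans (hx j)
    have heq : τ * (x + (-μ x / μ a) • a) j = τ * x j + (-μ x / μ a) * (τ * a j) := by
      simp only [Pi.add_apply, Pi.smul_apply, smul_eq_mul]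
      ring
    have h1 := hμpos (x + (-μ x / μ a) • a) ⟨?_, fun i hi => ?_⟩
    · rw [map_add, map_smul, smul_eq_mul, div_mul_cancel₀ _ hμa.ne'] at h1
      linarith
    · rw [heq]
      have := mul_pos hε ha.1
      linarith
    · rw [heq]
      refine (abs_add_le _ _).trans_lt ?_
      rw [Pi.smul_apply, smul_eq_mul, abs_mul, abs_of_pos hε]
      have := mul_lt_mul_of_pos_left (ha.2 i hi) hε
      linarith [hx i]

/-- In a ball of radius `δ` at the origin, a point that is as close as possible to some `w` with
extreme `j`-th coordinate pairs nonnegatively with `μ`. -/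
theorem nonneg_of_norm_sub_le {μ : (Fin n → ℝ) →L[ℝ] ℝ} {j : Fin n} {τ : ℝ}
    (hτ : τ = 1 ∨ τ = -1) (hμ : ∀ x, (∀ i, |x i| ≤ τ * x j) → 0 ≤ μ x) {w q : Fin n → ℝ}
    (hw : 0 ≤ μ w) (hwj : τ * w j = ‖w‖ ∨ τ * w j = -‖w‖) {δ : ℝ} (hδw : δ ≤ ‖w‖)
    (hq : ‖q‖ ≤ δ) (hqw : ‖q - w‖ ≤ ‖w‖ - δ) : 0 ≤ μ q := by
  have hqi : ∀ i, |q i| ≤ δ := fun i => (norm_le_pi_norm q i).trans hq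
  have hqwi : ∀ i, |q i - w i| ≤ ‖w‖ - δ := fun i => (norm_le_pi_norm (q - w) i).trans hqw
  have hwi : ∀ i, |w i| ≤ ‖w‖ := fun i => norm_le_pi_norm w i
  have hδ0 : 0 ≤ δ := (norm_nonneg q).trans hq
  have hτ1 : |τ| = 1 := by rcases hτ with rfl | rfl <;> simp
  have hτj : |τ * q j - τ * w j| ≤ ‖w‖ - δ := by
    rw [← mul_sub, abs_mul, hτ1, one_mul]
    exact hqwi j
  rcases hwj with hwj | hwj
  · refine hμ q fun i => (hqi i).trans ?_
    linarith [(abs_le.1 hτj).1]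
  · have hw' : μ w = 0 := by
      have h1 := hμ (-w) fun i => by
        rw [Pi.neg_apply, Pi.neg_apply, abs_neg, mul_neg, hwj, neg_neg]
        exact hwi i
      rw [map_neg] at h1
      linarith
    have hev : ∀ i, ∀ᶠ M : ℝ in atTop, |q i - M * w i| ≤ M * ‖w‖ - δ := by
      intro i
      rcases (hwi i).eq_or_lt with h | h
      · filter_upwards [eventually_ge_atTop 1] with M hM
        have h1 := abs_le.1 (hqi i)
        have h2 := abs_le.1 (hqwi i)
        have h3 : ‖w‖ ≤ M * ‖w‖ := le_mul_of_one_le_left (norm_nonneg _) hM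
        rcases abs_cases (w i) with ⟨h4, -⟩ | ⟨h4, -⟩
        · have h5 : w i = ‖w‖ := by linarith
          rw [h5, abs_le]
          rw [h5] at h2
          constructor <;> linarith
        · have h5 : w i = -‖w‖ := by linarith
          rw [h5, abs_le]
          rw [h5] at h2
          constructor <;> linarith
      · filter_upwards [eventually_ge_atTop ((|q i| + δ) / (‖w‖ - |w i|)),
          eventually_ge_atTop 0] with M hM hM0
        rw [div_le_iff₀ (by linarith)] at hM
        have h1 := abs_sub (q i) (M * w i)
        rw [abs_mul, abs_of_nonneg hM0] at h1
        linarith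
    obtain ⟨M, hM⟩ := (eventually_all.2 hev).exists
    have h1 := hμ (q - M • w) fun i => ?_
    · rw [map_sub, map_smul, hw', smul_zero, sub_zero] at h1
      exact h1
    · have h2 := abs_mul τ (q j)
      rw [hτ1, one_mul] at h2
      have h3 : -δ ≤ τ * q j := (abs_le.1 (h2.trans_le (hqi j))).1
      simp only [Pi.sub_apply, Pi.smul_apply, smul_eq_mul]
      refine (hM i).trans ?_
      have : τ * (q j - M * w j) = τ * q j + M * ‖w‖ := by
        linear_combination (-M) * hwj
      linarith

/-- Finitely many points of the cone that are pairwise not antipodal as seen from the origin can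
be approached simultaneously from the origin within the cone. -/
theorem exists_forall_norm_sub_lt (hclosed : IsClosed C) (hcone : IsCone C)
    (hadd : ∀ x ∈ C, ∀ y ∈ C, x + y ∈ C)
    (hT : ∀ p ∈ C, p ∉ apexSet C → IsLipschitzRetract (tangentCone C p)) {j : Fin n} {τ : ℝ}
    (hτ : τ = 1 ∨ τ = -1) (hpos : (openFacetCone j τ ∩ C).Nonempty)
    (hneg : ¬ (openFacetCone j (-τ) ∩ C).Nonempty) (S : Finset (Fin n → ℝ))
    (hS : ∀ x ∈ S, x ∈ C) (hSS : ∀ x ∈ S, ∀ y ∈ S, ‖x - y‖ < ‖x‖ + ‖y‖) :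
    ∃ q ∈ C, ∀ x ∈ S, ‖q - x‖ < ‖x‖ := by
  classical
  obtain ⟨μ, hμC, hμpos, hμcl⟩ := exists_nonneg_functional hcone hadd hpos hneg
  obtain ⟨a, ha, haC⟩ := hpos
  have hτ1 : |τ| = 1 := by rcases hτ with rfl | rfl <;> simp
  have h0 : (0 : Fin n → ℝ) ∈ C := hcone.zero_mem ⟨a, haC⟩
  have hanorm : τ * a j = ‖a‖ := by
    refine le_antisymm ?_ ((pi_norm_le_iff_of_nonneg ha.1.le).2 fun i => ?_)
    · refine (le_abs_self _).trans ?_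
      rw [abs_mul, hτ1, one_mul]
      exact norm_le_pi_norm a j
    · by_cases hi : i = j
      · rw [hi, Real.norm_eq_abs, ← one_mul |a j|, ← hτ1, ← abs_mul, abs_of_pos ha.1]
      · exact (ha.2 i hi).le
  have hapos : 0 < ‖a‖ := hanorm ▸ ha.1
  obtain ⟨S', hSS', hS'C, hS'S', w, hwS', hwj⟩ : ∃ S' : Finset (Fin n → ℝ), S ⊆ S' ∧
      (∀ x ∈ S', x ∈ C) ∧ (∀ x ∈ S', ∀ y ∈ S', ‖x - y‖ < ‖x‖ + ‖y‖) ∧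
      ∃ w ∈ S', τ * w j = ‖w‖ ∨ τ * w j = -‖w‖ := by
    by_cases hex : ∃ w ∈ S, τ * w j = -‖w‖
    · obtain ⟨w, hw, hwj⟩ := hex
      exact ⟨S, subset_rfl, hS, hSS, w, hw, .inr hwj⟩
    push Not at hex
    have hxa : ∀ x ∈ S, ‖x - a‖ < ‖x‖ + ‖a‖ := by
      intro x hx
      refine (pi_norm_lt_iff (by positivity)).2 fun i => ?_
      rw [Pi.sub_apply, Real.norm_eq_abs]
      by_cases hi : i = j
      · have h1 : |τ * x j| ≤ ‖x‖ := by
          rw [abs_mul, hτ1, one_mul]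
          exact norm_le_pi_norm x j
        have h2 := (abs_le.1 h1).1.lt_of_ne (hex x hx).symm
        rw [hi, ← one_mul |x j - a j|, ← hτ1, ← abs_mul, mul_sub, hanorm, abs_lt]
        constructor <;> linarith [(abs_le.1 h1).2]
      · have h1 := norm_le_pi_norm x i
        rw [Real.norm_eq_abs] at h1
        have h2 := ha.2 i hi
        rw [hanorm] at h2
        linarith [abs_sub (x i) (a i)]
    refine ⟨insert a S, Finset.subset_insert a S, ?_, ?_, a, Finset.mem_insert_self a S,
      .inl hanorm⟩
    · intro x hx
      rcases Finset.mem_insert.1 hx with rfl | hx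
      exacts [haC, hS x hx]
    · intro x hx y hy
      rcases Finset.mem_insert.1 hx with rfl | hx' <;> rcases Finset.mem_insert.1 hy with rfl | hy'
      · rw [sub_self, norm_zero]
        positivity
      · rw [norm_sub_rev, add_comm]
        exact hxa y hy'
      · exact hxa x hx'
      · exact hSS x hx' y hy'
  obtain ⟨δ, hδS, hδ⟩ : ∃ δ : ℝ, (∀ x ∈ S', ∀ y ∈ S', ‖x - y‖ + 2 * δ < ‖x‖ + ‖y‖) ∧ 0 < δ := by
    have hev : ∀ᶠ δ : ℝ in 𝓝 0, ∀ x ∈ S', ∀ y ∈ S', ‖x - y‖ + 2 * δ < ‖x‖ + ‖y‖ := by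
      refine (Finset.eventually_all S').2 fun x hx => (Finset.eventually_all S').2 fun y hy => ?_
      have hc : Continuous fun δ : ℝ => ‖x - y‖ + 2 * δ := by fun_prop
      exact hc.continuousAt.eventually_lt_const (by simpa using hS'S' x hx y hy)
    exact ((hev.filter_mono nhdsWithin_le_nhds).and
      (self_mem_nhdsWithin : Ioi (0 : ℝ) ∈ 𝓝[>] 0)).exists
  have hδx : ∀ x ∈ S', δ < ‖x‖ := fun x hx => by
    have := hδS x hx x hx
    rw [sub_self, norm_zero] at this
    linarith
  let Q : Set (Fin n → ℝ) := closedBall 0 δ ∩ ⋂ x ∈ S', closedBall x (‖x‖ - δ)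
  have hQ : ∀ q, q ∈ Q ↔ ‖q‖ ≤ δ ∧ ∀ x ∈ S', ‖q - x‖ ≤ ‖x‖ - δ := fun q => by
    simp [Q, dist_eq_norm]
  have hQcompact : IsCompact Q := (isCompact_closedBall 0 δ).inter_right
    (isClosed_biInter fun x _ => isClosed_closedBall)
  have hQconvex : Convex ℝ Q := (convex_closedBall 0 δ).inter
    (convex_iInter₂ fun x _ => convex_closedBall x _)
  have hμQ : ∀ q ∈ Q, 0 ≤ μ q := fun q hq => nonneg_of_norm_sub_le hτ hμcl
    (hμC w (hS'C w hwS')) hwj (hδx w hwS').le ((hQ q).1 hq).1 (((hQ q).1 hq).2 w hwS')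
  have hTQ : ∀ p ∈ C, p ∉ apexSet C → ∃ q ∈ tangentCone C p, q ∈ Q := by
    intro p hp hpa
    obtain ⟨q, hqT, hq⟩ := (hT p hp hpa).exists_mem_forall_dist_le
      (fun k : Option S' => k.elim 0 (fun x => (x : Fin n → ℝ)))
      (fun k : Option S' => k.elim δ fun x => ‖(x : Fin n → ℝ)‖ - δ)
      (fun k => subset_tangentCone C p (by
        cases k with
        | none => exact h0
        | some x => exact hS'C x x.2))
      (fun k l => by
        rcases k with _ | x <;> rcases l with _ | y
        · simpa using hδ.le
        · simp
        · simp
        · have := hδS x x.2 y y.2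
          simp only [Option.elim_some, dist_eq_norm]
          linarith)
    refine ⟨q, hqT, (hQ q).2 ⟨?_, fun x hx => ?_⟩⟩
    · simpa using hq none
    · simpa [dist_eq_norm] using hq (some ⟨x, hx⟩)
  have hmeet : (Q ∩ C).Nonempty := by
    by_contra hcon
    have hconv : Convex ℝ C := fun x hx y hy s t hs ht _ =>
      hadd _ (hcone x hx s hs) _ (hcone y hy t ht)
    obtain ⟨f, u, v, hfQ, huv, hfC⟩ := geometric_hahn_banach_compact_closed hQconvex hQcompact
      hconv hclosed (disjoint_iff_inter_eq_empty.2 (not_nonempty_iff_eq_empty.1 hcon))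
    have hv : v < 0 := by simpa using hfC 0 h0
    have hfC' : ∀ x ∈ C, 0 ≤ f x := by
      intro x hx
      by_contra! hneg
      obtain ⟨t, ht⟩ := exists_nat_gt (v / f x)
      have h1 := hfC _ (hcone x hx t t.cast_nonneg)
      rw [map_smul, smul_eq_mul] at h1
      rw [div_lt_iff_of_neg hneg] at ht
      linarith
    obtain ⟨t, ht, hg, p, hp, hpa, hgp⟩ := exists_nonneg_combination_eq_zero hclosed hcone hadd
      f μ hfC' hμC haC (hμpos a ha)
    obtain ⟨q, hqT, hqQ⟩ := hTQ p hp hpa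
    obtain ⟨m, y, hy, rfl⟩ := mem_tangentCone.1 hqT
    have h1 : 0 ≤ (f - t • μ) (p + (m : ℝ) • (y - p)) := by
      rw [map_add, map_smul, map_sub, hgp, zero_add, sub_zero, smul_eq_mul]
      exact mul_nonneg m.cast_nonneg (hg y hy)
    rw [sub_apply, smul_apply, smul_eq_mul] at h1
    have h2 := hfQ _ hqQ
    have h3 := mul_nonneg ht (hμQ _ hqQ)
    linarith
  obtain ⟨q, hqQ, hqC⟩ := hmeet
  refine ⟨q, hqC, fun x hx => ?_⟩
  linarith [((hQ q).1 hqQ).2 x (hSS' hx)]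

theorem isLipschitzRetract_of_tangentCone (hclosed : IsClosed C) (hcone : IsCone C)
    (hadd : ∀ x ∈ C, ∀ y ∈ C, x + y ∈ C)
    (hT : ∀ p ∈ C, p ∉ apexSet C → IsLipschitzRetract (tangentCone C p)) {j : Fin n} {τ : ℝ}
    (hτ : τ = 1 ∨ τ = -1) (hpos : (openFacetCone j τ ∩ C).Nonempty)
    (hneg : ¬ (openFacetCone j (-τ) ∩ C).Nonempty) : IsLipschitzRetract C := by
  classical
  have hne : C.Nonempty := hpos.mono inter_subset_right
  refine .of_finite_hyperconvex hclosed hne fun F x ρ hx hxρ => ?_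
  rcases F.eq_empty_or_nonempty with rfl | hF
  · obtain ⟨a, ha⟩ := hne
    exact ⟨a, ha, by simp⟩
  obtain ⟨k₀, hk₀⟩ := id hF
  -- `h z` is the amount by which the radii must grow for all balls to contain `z`.
  let h : (Fin n → ℝ) → ℝ := fun z => F.sup' hF fun k => dist z (x k) - ρ k
  have hcont : Continuous h :=
    Continuous.finset_sup'_apply hF fun k _ => by fun_prop
  have hle : ∀ z, ∀ k ∈ F, dist z (x k) ≤ ρ k + h z := fun z k hk => by
    have := Finset.le_sup' (fun k => dist z (x k) - ρ k) hk
    simp only [h]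
    linarith
  obtain ⟨z, hzC, hzmin⟩ : ∃ z ∈ C, ∀ y ∈ C, h z ≤ h y := by
    obtain ⟨z, hz, hzmin⟩ := (((isCompact_closedBall (x k₀) (ρ k₀ + h (x k₀))).inter_left
      hclosed).exists_isMinOn ⟨x k₀, hx k₀ hk₀, mem_closedBall.2 (hle _ k₀ hk₀)⟩
      hcont.continuousOn)
    refine ⟨z, hz.1, fun y hy => ?_⟩
    by_cases hyb : y ∈ closedBall (x k₀) (ρ k₀ + h (x k₀))
    · exact hzmin ⟨hy, hyb⟩
    · have h1 : h z ≤ h (x k₀) :=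
        hzmin ⟨hx k₀ hk₀, mem_closedBall.2 (hle _ k₀ hk₀)⟩
      rw [mem_closedBall, not_le] at hyb
      linarith [hle y k₀ hk₀]
  suffices hs : h z ≤ 0 from ⟨z, hzC, fun k hk => by linarith [hle z k hk]⟩
  by_contra! hs
  have hbetter : ∀ y ∈ C, ∃ k ∈ F, ρ k + h z ≤ dist y (x k) := by
    intro y hy
    by_contra! hcon
    refine absurd (hzmin y hy) (not_le.2 ((Finset.sup'_lt_iff hF).2 fun k hk => ?_))
    linarith [hcon k hk]
  by_cases hza : z ∈ apexSet C
  · have hxz : ∀ k ∈ F, x k - z ∈ C := fun k hk => by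
      rw [sub_eq_add_neg]
      exact hadd _ (hx k hk) _ hza.2
    have hnorm : ∀ k ∈ F, ‖x k - z‖ ≤ ρ k + h z := fun k hk => by
      rw [← dist_eq_norm, dist_comm]
      exact hle z k hk
    obtain ⟨q, hqC, hq⟩ := exists_forall_norm_sub_lt hclosed hcone hadd hT hτ hpos hneg
      ((F.filter fun k => ‖x k - z‖ = ρ k + h z).image fun k => x k - z)
      (by
        intro y hy
        obtain ⟨k, hk, rfl⟩ := Finset.mem_image.1 hy
        exact hxz k (Finset.mem_filter.1 hk).1)
      (by
        intro y hy y' hy'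
        obtain ⟨k, hk, rfl⟩ := Finset.mem_image.1 hy
        obtain ⟨l, hl, rfl⟩ := Finset.mem_image.1 hy'
        rw [Finset.mem_filter] at hk hl
        rw [sub_sub_sub_cancel_right, ← dist_eq_norm, hk.2, hl.2]
        linarith [hxρ k hk.1 l hl.1])
    have hev : ∀ᶠ ε : ℝ in 𝓝[>] 0, ∀ k ∈ F, dist (z + ε • q) (x k) < ρ k + h z := by
      refine (Finset.eventually_all F).2 fun k hk => ?_
      rcases (hnorm k hk).eq_or_lt with heq | hlt
      · have h1 := hq (x k - z) (Finset.mem_image_of_mem _ (Finset.mem_filter.2 ⟨hk, heq⟩))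
        filter_upwards [Ioo_mem_nhdsGT (zero_lt_one' ℝ)] with ε hε
        have h2 : z + ε • q - x k = ε • (q - (x k - z)) + (1 - ε) • (-(x k - z)) := by
          module
        rw [dist_eq_norm, h2, ← heq]
        refine (norm_add_le _ _).trans_lt ?_
        rw [norm_smul, norm_smul, norm_neg, Real.norm_of_nonneg hε.1.le,
          Real.norm_of_nonneg (sub_nonneg.2 hε.2.le)]
        nlinarith [mul_lt_mul_of_pos_left h1 hε.1]
      · have hc : Continuous fun ε : ℝ => dist (z + ε • q) (x k) := by fun_prop
        refine (hc.continuousAt.eventually_lt_const ?_).filter_mono nhdsWithin_le_nhds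
        simpa [dist_comm z, dist_eq_norm] using hlt
    obtain ⟨ε, hε, hε0⟩ := (hev.and (self_mem_nhdsWithin : Ioi (0 : ℝ) ∈ 𝓝[>] 0)).exists
    obtain ⟨k, hk, hcon⟩ := hbetter _ (hadd z hzC _ (hcone q hqC ε (le_of_lt hε0)))
    exact absurd (hε k hk) (not_lt.2 hcon)
  · have : Nonempty F := ⟨⟨k₀, hk₀⟩⟩
    obtain ⟨q, hqT, hq⟩ := (hT z hzC hza).exists_mem_forall_dist_le
      (fun k : F => x k) (fun k : F => ρ k)
      (fun k => subset_tangentCone C z (hx k k.2)) fun k l => hxρ k k.2 l l.2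
    obtain ⟨m, hm, hm0⟩ := ((eventually_add_smul_mem_of_mem_tangentCone hcone hadd hzC hqT).and
      (eventually_gt_atTop 0)).exists
    obtain ⟨k, hk, hcon⟩ := hbetter _ hm
    have hm1 : (1 : ℝ) ≤ m := by exact_mod_cast hm0
    have hinv : (0 : ℝ) < (m : ℝ)⁻¹ := by positivity
    have hinv1 : (m : ℝ)⁻¹ ≤ 1 := inv_le_one_of_one_le₀ hm1
    have h2 : z + (m : ℝ)⁻¹ • (q - z) - x k
        = (m : ℝ)⁻¹ • (q - x k) + (1 - (m : ℝ)⁻¹) • (z - x k) := by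
      module
    have h3 := norm_add_le ((m : ℝ)⁻¹ • (q - x k)) ((1 - (m : ℝ)⁻¹) • (z - x k))
    rw [norm_smul, norm_smul, Real.norm_of_nonneg hinv.le,
      Real.norm_of_nonneg (sub_nonneg.2 hinv1), ← h2, ← dist_eq_norm, ← dist_eq_norm,
      ← dist_eq_norm] at h3
    have h4 := mul_le_mul_of_nonneg_left (hq ⟨k, hk⟩) hinv.le
    have h5 := mul_le_mul_of_nonneg_left (hle z k hk) (sub_nonneg.2 hinv1)
    have h6 := mul_pos hinv hs
    simp only at h4
    linarith

end Cone

/-- A convex polyhedral cone `C ⊊ l∞ⁿ` with nonempty interior is injective iff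
(i) all tangent cones at points of `∂C ∖ apex(C)` are injective, and (ii) there is a facet
`F` of `[-1,1]ⁿ` with `relint(F) ∩ C ≠ ∅` and `relint(-F) ∩ C = ∅`. -/
theorem convexPolyhedralCone_injective_iff {n : ℕ} (C : Set (Fin n → ℝ))
    (hC : IsConvexPolyhedron C) (hcone : IsCone C) (hne : C ≠ univ)
    (hint : (interior C).Nonempty) :
    IsInjectiveSubset C ↔
      ((∀ p ∈ frontier C \ apexSet C, IsInjectiveSubset (tangentCone C p)) ∧
        ∃ (j : Fin n) (τ : ℝ), (τ = 1 ∨ τ = -1) ∧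
          (intrinsicInterior ℝ (cubeFacet j τ) ∩ C).Nonempty ∧
          intrinsicInterior ℝ (cubeFacet j (-τ)) ∩ C = ∅) := by
  have hadd := hC.add_mem hcone
  simp only [isInjectiveSubset_iff_isLipschitzRetract, ← not_nonempty_iff_eq_empty]
  have hfacet : ∀ (j : Fin n) (τ : ℝ), (τ = 1 ∨ τ = -1) →
      ((intrinsicInterior ℝ (cubeFacet j τ) ∩ C).Nonempty ↔
        (openFacetCone j τ ∩ C).Nonempty) := fun j τ hτ =>
    intrinsicInterior_cubeFacet_inter_nonempty_iff hcone hτ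
  have hsymm : ∀ τ : ℝ, τ = 1 ∨ τ = -1 → -τ = 1 ∨ -τ = -1 := by
    rintro τ (rfl | rfl) <;> simp
  constructor
  · intro h
    refine ⟨fun p hp => h.isLipschitzRetract_tangentCone hC hcone
      (hC.isClosed.frontier_subset hp.1), ?_⟩
    obtain ⟨j, τ, hτ, hpos, hneg⟩ := h.exists_openFacetCone hcone hadd hne hint
    exact ⟨j, τ, hτ, (hfacet j τ hτ).2 hpos, fun h' => hneg ((hfacet j _ (hsymm τ hτ)).1 h')⟩
  · rintro ⟨hT, j, τ, hτ, hpos, hneg⟩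
    refine isLipschitzRetract_of_tangentCone hC.isClosed hcone hadd (fun p hp hpa => ?_) hτ
      ((hfacet j τ hτ).1 hpos) fun h' => hneg ((hfacet j _ (hsymm τ hτ)).2 h')
    by_cases hpi : p ∈ interior C
    · rw [tangentCone_eq_univ_of_mem_interior hpi]
      exact isLipschitzRetract_univ
    · exact hT p ⟨⟨subset_closure hp, hpi⟩, hpa⟩
end

section
/- A convex polyhedron P ⊊ l∞^n with nonempty interior is injective if and only if for every p ∈ ∂P, the convex polyhedral cone K := T_pP − p admits a facet F of the cube [−1,1]^n with relint(F) ∩ K ≠ ∅ such that relint(−F) ∩ K = ∅. -/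
open Set Metric

/-- A convex cone with apex `0`, containing its apex. -/
structure IsWedge {n : ℕ} (K : Set (Fin n → ℝ)) : Prop where
  zero_mem : 0 ∈ K
  add_mem : ∀ ⦃x⦄, x ∈ K → ∀ ⦃y⦄, y ∈ K → x + y ∈ K
  smul_mem : ∀ ⦃c : ℝ⦄, 0 ≤ c → ∀ ⦃x⦄, x ∈ K → c • x ∈ K

/-- `K` contains a point whose coordinate `j` has sign `τ` and is strictly larger in absolute
value than all the other coordinates. -/
def HasPeak {n : ℕ} (K : Set (Fin n → ℝ)) (j : Fin n) (τ : ℝ) : Prop :=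
  ∃ x ∈ K, 0 < τ * x j ∧ ∀ i, i ≠ j → |x i| < τ * x j

/-- Every nonzero coordinate of `μ` has a sign opposite to that of some peak of `K`. -/
def SignAdmissible {n : ℕ} (K : Set (Fin n → ℝ)) (μ : Fin n → ℝ) : Prop :=
  ∀ i, (0 < μ i → HasPeak K i (-1)) ∧ (μ i < 0 → HasPeak K i 1)

/-- No nonzero sign-admissible functional is nonnegative on `K`. -/
def IsRigid {n : ℕ} (K : Set (Fin n → ℝ)) : Prop :=
  ∀ μ : Fin n → ℝ, (∀ x ∈ K, 0 ≤ μ ⬝ᵥ x) → SignAdmissible K μ → μ = 0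

section Wedge

variable {n : ℕ} {K : Set (Fin n → ℝ)}

lemma HasPeak.mono {K' : Set (Fin n → ℝ)} (h : K ⊆ K') {j : Fin n} {τ : ℝ}
    (hK : HasPeak K j τ) : HasPeak K' j τ := by
  obtain ⟨x, hx, h1, h2⟩ := hK
  exact ⟨x, h hx, h1, h2⟩

lemma SignAdmissible.mono {K' : Set (Fin n → ℝ)} (h : K ⊆ K') {μ : Fin n → ℝ}
    (hμ : SignAdmissible K μ) : SignAdmissible K' μ :=
  fun i => ⟨fun hi => ((hμ i).1 hi).mono h, fun hi => ((hμ i).2 hi).mono h⟩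

lemma SignAdmissible.add {μ ν : Fin n → ℝ} (hμ : SignAdmissible K μ)
    (hν : SignAdmissible K ν) : SignAdmissible K (μ + ν) := by
  intro i
  constructor
  · intro h
    rw [Pi.add_apply] at h
    by_cases h1 : 0 < μ i
    · exact (hμ i).1 h1
    · exact (hν i).1 (by linarith)
  · intro h
    rw [Pi.add_apply] at h
    by_cases h1 : μ i < 0
    · exact (hμ i).2 h1
    · exact (hν i).2 (by linarith)

lemma SignAdmissible.smul {μ : Fin n → ℝ} (hμ : SignAdmissible K μ) {c : ℝ} (hc : 0 ≤ c) :
    SignAdmissible K (c • μ) := by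
  intro i
  simp only [Pi.smul_apply, smul_eq_mul]
  exact ⟨fun h => (hμ i).1 (pos_of_mul_pos_right h hc),
    fun h => (hμ i).2 (by by_contra h'; push Not at h'; nlinarith [mul_nonneg hc h'])⟩

lemma IsWedge.convex (hK : IsWedge K) : Convex ℝ K :=
  fun _ hx _ hy _ _ ha hb _ => hK.add_mem (hK.smul_mem ha hx) (hK.smul_mem hb hy)

lemma IsWedge.eq_univ (hK : IsWedge K) (h : (0 : Fin n → ℝ) ∈ interior K) : K = univ := by
  refine eq_univ_of_forall fun x => ?_
  have hc : Filter.Tendsto (fun t : ℝ => t • x) (nhdsWithin 0 (Ioi 0)) (nhds 0) := by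
    have : Continuous fun t : ℝ => t • x := by fun_prop
    simpa using (this.tendsto 0).mono_left nhdsWithin_le_nhds
  obtain ⟨t, ht, ht0⟩ :=
    ((hc.eventually_mem (mem_interior_iff_mem_nhds.1 h)).and self_mem_nhdsWithin).exists
  have ht0 : 0 < t := ht0
  have := hK.smul_mem (inv_nonneg.2 ht0.le) ht
  rwa [smul_smul, inv_mul_cancel₀ ht0.ne', one_smul] at this

lemma IsWedge.add_smul_mem_interior (hK : IsWedge K) {z w : Fin n → ℝ} (hz : z ∈ K)
    (hw : w ∈ interior K) {ε : ℝ} (hε : 0 < ε) : z + ε • w ∈ interior K := by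
  refine mem_interior.2 ⟨(fun x => ε⁻¹ • (x - z)) ⁻¹' interior K, ?_,
    isOpen_interior.preimage (by fun_prop), ?_⟩
  · intro x hx
    have := hK.add_mem hz (hK.smul_mem hε.le (interior_subset hx))
    rwa [smul_smul, mul_inv_cancel₀ hε.ne', one_smul, add_sub_cancel] at this
  · simpa [smul_smul, inv_mul_cancel₀ hε.ne'] using hw

/-- Separation of an open convex set from a wedge by a linear functional. -/
lemma exists_dotProduct_separating {A B : Set (Fin n → ℝ)} (hA : Convex ℝ A) (hAo : IsOpen A)
    (hB : IsWedge B) (disj : Disjoint A B) :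
    ∃ μ : Fin n → ℝ, (∀ a ∈ A, μ ⬝ᵥ a < 0) ∧ ∀ b ∈ B, 0 ≤ μ ⬝ᵥ b := by
  obtain ⟨f, u, hf, hu⟩ := geometric_hahn_banach_open hA hAo hB.convex disj
  have key : ∀ x, (fun i => f (Pi.single i 1)) ⬝ᵥ x = f x := by
    intro x
    have := LinearMap.pi_apply_eq_sum_univ (f : (Fin n → ℝ) →ₗ[ℝ] ℝ) x
    simp only [ContinuousLinearMap.coe_coe] at this
    rw [this]
    simp only [dotProduct, smul_eq_mul]
    refine Finset.sum_congr rfl fun i _ => ?_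
    rw [mul_comm]
    congr 2
    ext j
    simp [Pi.single_apply, eq_comm]
  have hu0 : u ≤ 0 := by simpa using hu 0 hB.zero_mem
  refine ⟨fun i => f (Pi.single i 1), fun a ha => ?_, fun b hb => ?_⟩
  · rw [key]
    linarith [hf a ha]
  · rw [key]
    by_contra! hneg
    have h1 := hu _ (hB.smul_mem (div_nonneg_of_nonpos (by linarith : u - 1 ≤ 0) hneg.le) hb)
    rw [map_smul, smul_eq_mul, div_mul_cancel₀ _ hneg.ne] at h1
    linarith

lemma hasPeak_of_mem_interior {x : Fin n → ℝ} (hx : x ∈ interior K) {i : Fin n} {τ : ℝ}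
    (hτ : τ = 1 ∨ τ = -1) (hi : ∀ k, |x k| ≤ τ * x i) : HasPeak K i τ := by
  have hc : Filter.Tendsto (fun t : ℝ => x + Pi.single i (t * τ)) (nhdsWithin 0 (Ioi 0))
      (nhds x) := by
    have : Continuous fun t : ℝ => x + Pi.single (M := fun _ => ℝ) i (t * τ) := by
      have := continuous_single (A := fun _ : Fin n => ℝ) i
      fun_prop
    simpa using (this.tendsto 0).mono_left nhdsWithin_le_nhds
  obtain ⟨t, ht, ht0⟩ :=
    ((hc.eventually_mem (mem_interior_iff_mem_nhds.1 hx)).and self_mem_nhdsWithin).exists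
  have ht0 : 0 < t := ht0
  have hττ : τ * τ = 1 := by rcases hτ with rfl | rfl <;> norm_num
  have h0 : τ * (x + Pi.single i (t * τ) : Fin n → ℝ) i = τ * x i + t := by
    simp only [Pi.add_apply, Pi.single_eq_same]
    linear_combination t * hττ
  refine ⟨_, ht, ?_, fun k hk => ?_⟩
  · rw [h0]
    linarith [hi i, abs_nonneg (x i)]
  · rw [h0]
    simp only [Pi.add_apply, Pi.single_eq_of_ne hk, add_zero]
    linarith [hi k]

/-- A nonzero point of a wedge with nonempty interior cannot point weakly away from all peaks. -/
lemma IsWedge.not_forall_hasPeak (hK : IsWedge K) (hKi : (interior K).Nonempty)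
    {z : Fin n → ℝ} (hz : z ∈ K) (hz0 : z ≠ 0)
    (h : ∀ i, (HasPeak K i 1 → z i ≤ 0) ∧ (HasPeak K i (-1) → 0 ≤ z i)) : False := by
  obtain ⟨w, hw⟩ := hKi
  obtain ⟨i0, hi0⟩ := Function.ne_iff.1 hz0
  have : Nonempty (Fin n) := ⟨i0⟩
  obtain ⟨k, hk⟩ := Finite.exists_max fun i => |z i|
  have hM : 0 < |z k| := (abs_pos.2 hi0).trans_le (hk i0)
  set ε := |z k| / (4 * (‖w‖ + 1)) with hε
  have hw0 : 0 < ‖w‖ + 1 := by positivity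
  have hε0 : 0 < ε := by positivity
  have hu := hK.add_smul_mem_interior hz hw hε0
  have hclose : ∀ i, |ε * w i| ≤ |z k| / 4 := by
    intro i
    have h1 : |w i| ≤ ‖w‖ + 1 := (norm_le_pi_norm w i).trans (by linarith)
    rw [abs_mul, abs_of_pos hε0]
    calc ε * |w i| ≤ ε * (‖w‖ + 1) := by gcongr
      _ = |z k| / 4 := by rw [hε]; field_simp
  obtain ⟨j, hj⟩ := Finite.exists_max fun i => |(z + ε • w) i|
  simp only [Pi.add_apply, Pi.smul_apply, smul_eq_mul] at hj
  have h1 := hj k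
  have h2 := abs_le.1 (hclose k)
  have h3 := abs_le.1 (hclose j)
  have h4 : 3 / 4 * |z k| ≤ |z j + ε * w j| := by
    have := abs_sub_abs_le_abs_sub (z k) (-(ε * w k))
    rw [abs_neg, sub_neg_eq_add] at this
    linarith [hclose k]
  rcases le_total 0 (z j + ε * w j) with hs | hs
  · have : HasPeak K j 1 := hasPeak_of_mem_interior hu (Or.inl rfl) fun i => by
      simpa [abs_of_nonneg hs] using hj i
    rw [abs_of_nonneg hs] at h4
    linarith [(h j).1 this]
  · have : HasPeak K j (-1) := hasPeak_of_mem_interior hu (Or.inr rfl) fun i => by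
      have := hj i
      rw [abs_of_nonpos hs] at this
      simpa using this
    rw [abs_of_nonpos hs] at h4
    linarith [(h j).2 this]

end Wedge

section Facet

variable {n : ℕ}

lemma mem_intrinsicInterior_cubeFacet {j : Fin n} {τ : ℝ} (hτ : τ = 1 ∨ τ = -1)
    {x : Fin n → ℝ} :
    x ∈ intrinsicInterior ℝ (cubeFacet j τ) ↔ x j = τ ∧ ∀ i, i ≠ j → |x i| < 1 := by
  rw [mem_intrinsicInterior]
  constructor
  · rintro ⟨y, hy, rfl⟩
    have hyF : (y : Fin n → ℝ) ∈ cubeFacet j τ := (interior_subset hy :)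
    refine ⟨hyF.1, fun i hij => ?_⟩
    by_contra! hge
    have hy' : Function.update (y : Fin n → ℝ) i 0 ∈ cubeFacet j τ := by
      refine ⟨by rw [Function.update_of_ne hij.symm]; exact hyF.1, fun k => ?_⟩
      rcases eq_or_ne k i with rfl | hk
      · simp
      · rw [Function.update_of_ne hk]
        exact hyF.2 k
    let c : ℝ → affineSpan ℝ (cubeFacet j τ) := fun t =>
      ⟨AffineMap.lineMap (y : Fin n → ℝ) (Function.update (y : Fin n → ℝ) i 0) t,
        AffineMap.lineMap_mem t y.2 (subset_affineSpan ℝ _ hy')⟩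
    have hc : Continuous c := Continuous.subtype_mk AffineMap.lineMap_continuous _
    have hc0 : c 0 = y := Subtype.ext (by simp [c])
    have hnear : ∀ᶠ t in nhdsWithin (0 : ℝ) (Iio 0),
        c t ∈ ((↑) ⁻¹' cubeFacet j τ : Set (affineSpan ℝ (cubeFacet j τ))) := by
      have h1 := (hc.tendsto 0).mono_left (nhdsWithin_le_nhds (s := Iio 0))
      rw [hc0] at h1
      exact h1 (mem_interior_iff_mem_nhds.1 hy)
    obtain ⟨t, ht, ht0⟩ := (hnear.and self_mem_nhdsWithin).exists
    have ht0 : t < 0 := ht0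
    have h2 := ht.2 i
    have h3 : (c t : Fin n → ℝ) i = (1 - t) * (y : Fin n → ℝ) i := by
      simp [c, AffineMap.lineMap_apply]
      ring
    have h4 := abs_le.2 h2
    rw [h3, abs_mul, abs_of_pos (by linarith)] at h4
    nlinarith
  · rintro ⟨hj, hx⟩
    have hle : ∀ z : Fin n → ℝ, z j = τ → (∀ i, i ≠ j → |z i| < 1) → z ∈ cubeFacet j τ := by
      refine fun z hzj hz => ⟨hzj, fun i => ?_⟩
      rcases eq_or_ne i j with rfl | hij
      · rw [hzj]
        rcases hτ with rfl | rfl <;> norm_num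
      · exact abs_le.1 (hz i hij).le
    have hspan : ∀ z ∈ affineSpan ℝ (cubeFacet j τ), z j = τ := by
      intro z hz
      refine affineSpan_induction (p := fun z => z j = τ) hz (fun z hz => hz.1) ?_
      intro c u v w hu hv hw
      simp [hu, hv, hw]
    refine ⟨⟨x, subset_affineSpan ℝ _ (hle x hj hx)⟩, ?_, rfl⟩
    refine mem_interior.2
      ⟨Subtype.val ⁻¹' {z : Fin n → ℝ | ∀ i, i ≠ j → |z i| < 1}, ?_, ?_, hx⟩
    · exact fun z hz => hle z (hspan z z.2) hz
    · refine IsOpen.preimage continuous_subtype_val ?_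
      have : {z : Fin n → ℝ | ∀ i, i ≠ j → |z i| < 1} = ⋂ i, {z | i ≠ j → |z i| < 1} := by
        ext; simp
      rw [this]
      refine isOpen_iInter_of_finite fun i => ?_
      by_cases hij : i = j
      · simp [hij]
      · simpa [hij] using isOpen_lt (continuous_apply i).abs continuous_const

lemma IsWedge.facet_inter_nonempty {K : Set (Fin n → ℝ)} (hK : IsWedge K) {j : Fin n} {τ : ℝ}
    (hτ : τ = 1 ∨ τ = -1) :
    (intrinsicInterior ℝ (cubeFacet j τ) ∩ K).Nonempty ↔ HasPeak K j τ := by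
  have hττ : τ * τ = 1 := by rcases hτ with rfl | rfl <;> norm_num
  constructor
  · rintro ⟨x, hx, hxK⟩
    rw [mem_intrinsicInterior_cubeFacet hτ] at hx
    exact ⟨x, hxK, by rw [hx.1, hττ]; norm_num, fun i hi => by rw [hx.1, hττ]; exact hx.2 i hi⟩
  · rintro ⟨x, hxK, hpos, hx⟩
    refine ⟨(τ * x j)⁻¹ • x, ?_, hK.smul_mem (inv_nonneg.2 hpos.le) hxK⟩
    rw [mem_intrinsicInterior_cubeFacet hτ]
    constructor
    · simp only [Pi.smul_apply, smul_eq_mul]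
      rw [inv_mul_eq_iff_eq_mul₀ hpos.ne']
      linear_combination -x j * hττ
    · intro i hi
      simp only [Pi.smul_apply, smul_eq_mul]
      rw [abs_mul, abs_of_pos (inv_pos.2 hpos), inv_mul_lt_one₀ hpos]
      exact hx i hi

end Facet

section Polyhedron

variable {n m : ℕ}

/-- The polyhedral cone cut out by the homogeneous inequalities with index in `I`. -/
def polyCone (α : Fin m → Fin n → ℝ) (I : Finset (Fin m)) : Set (Fin n → ℝ) :=
  {x | ∀ i ∈ I, 0 ≤ α i ⬝ᵥ x}

/-- The polyhedron `{x | ∀ i, c i ≤ α i ⬝ᵥ x}`. -/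
def polyhedron (α : Fin m → Fin n → ℝ) (c : Fin m → ℝ) : Set (Fin n → ℝ) :=
  {x | ∀ i, c i ≤ α i ⬝ᵥ x}

open Classical in
/-- The constraints which are active at `p`. -/
noncomputable def activeSet (α : Fin m → Fin n → ℝ) (c : Fin m → ℝ) (p : Fin n → ℝ) :
    Finset (Fin m) :=
  {i | α i ⬝ᵥ p = c i}

variable {α : Fin m → Fin n → ℝ} {c : Fin m → ℝ}

lemma mem_activeSet {p : Fin n → ℝ} {i : Fin m} : i ∈ activeSet α c p ↔ α i ⬝ᵥ p = c i := by
  simp [activeSet]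

lemma continuous_dotProduct_right (μ : Fin n → ℝ) : Continuous fun x : Fin n → ℝ => μ ⬝ᵥ x := by
  unfold dotProduct
  fun_prop

lemma isWedge_polyCone (α : Fin m → Fin n → ℝ) (I : Finset (Fin m)) : IsWedge (polyCone α I) where
  zero_mem := fun i _ => by simp
  add_mem := fun x hx y hy i hi => by
    rw [dotProduct_add]
    exact add_nonneg (hx i hi) (hy i hi)
  smul_mem := fun a ha x hx i hi => by
    rw [dotProduct_smul]
    exact smul_nonneg ha (hx i hi)

lemma isClosed_polyhedron (α : Fin m → Fin n → ℝ) (c : Fin m → ℝ) :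
    IsClosed (polyhedron α c) := by
  have : polyhedron α c = ⋂ i, {x | c i ≤ α i ⬝ᵥ x} := by
    ext; simp [polyhedron]
  rw [this]
  exact isClosed_iInter fun i => isClosed_le continuous_const (continuous_dotProduct_right _)

lemma convex_polyhedron (α : Fin m → Fin n → ℝ) (c : Fin m → ℝ) :
    Convex ℝ (polyhedron α c) := by
  intro x hx y hy a b ha hb hab i
  rw [dotProduct_add, dotProduct_smul, dotProduct_smul, smul_eq_mul, smul_eq_mul]
  have h : c i = a * c i + b * c i := by rw [← add_mul, hab, one_mul]
  linarith [mul_le_mul_of_nonneg_left (hx i) ha, mul_le_mul_of_nonneg_left (hy i) hb]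

lemma sub_mem_polyCone {p q : Fin n → ℝ} (hq : q ∈ polyhedron α c) :
    q - p ∈ polyCone α (activeSet α c p) := by
  intro i hi
  rw [dotProduct_sub, mem_activeSet.1 hi]
  exact sub_nonneg.2 (hq i)

lemma sub_mem_interior_polyCone {p q : Fin n → ℝ} (hq : q ∈ interior (polyhedron α c)) :
    q - p ∈ interior (polyCone α (activeSet α c p)) := by
  refine mem_interior.2 ⟨(fun x => x + p) ⁻¹' interior (polyhedron α c), fun x hx => ?_,
    isOpen_interior.preimage (by fun_prop), by simpa using hq⟩
  simpa using sub_mem_polyCone (p := p) (interior_subset hx)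

/-- Moving slightly from `p` along a direction of the tangent cone stays in the polyhedron, and
the active constraints are those which vanish on that direction. -/
lemma eventually_add_smul_mem {p k : Fin n → ℝ} (hp : p ∈ polyhedron α c)
    (hk : k ∈ polyCone α (activeSet α c p)) :
    ∀ᶠ ε in nhdsWithin (0 : ℝ) (Ioi 0), p + ε • k ∈ polyhedron α c ∧
      activeSet α c (p + ε • k) = (activeSet α c p).filter fun i => α i ⬝ᵥ k = 0 := by
  have key : ∀ i, ∀ᶠ ε in nhdsWithin (0 : ℝ) (Ioi 0), c i ≤ α i ⬝ᵥ (p + ε • k) ∧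
      (α i ⬝ᵥ (p + ε • k) = c i ↔ α i ⬝ᵥ p = c i ∧ α i ⬝ᵥ k = 0) := by
    intro i
    by_cases hi : α i ⬝ᵥ p = c i
    · filter_upwards [self_mem_nhdsWithin] with ε hε
      have hε : 0 < ε := hε
      have h0 := hk i (mem_activeSet.2 hi)
      rw [dotProduct_add, dotProduct_smul, hi, smul_eq_mul]
      refine ⟨by nlinarith, ?_⟩
      simp [hε.ne']
    · have hlt : c i < α i ⬝ᵥ p := lt_of_le_of_ne (hp i) (Ne.symm hi)
      have hc : Continuous fun ε : ℝ => α i ⬝ᵥ (p + ε • k) :=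
        (continuous_dotProduct_right _).comp (by fun_prop)
      have h0 : ∀ᶠ ε in nhds (0 : ℝ), c i < α i ⬝ᵥ (p + ε • k) :=
        (hc.tendsto 0).eventually_const_lt (by simpa using hlt)
      filter_upwards [nhdsWithin_le_nhds h0] with ε hε
      have hε : c i < α i ⬝ᵥ (p + ε • k) := hε
      exact ⟨hε.le, fun h => absurd h hε.ne', fun h => absurd h.1 hi⟩
  filter_upwards [Filter.eventually_all.2 key] with ε hε
  refine ⟨fun i => (hε i).1, ?_⟩
  ext i
  rw [mem_activeSet, Finset.mem_filter, mem_activeSet, (hε i).2]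

lemma image_sub_tangentCone {p : Fin n → ℝ} (hp : p ∈ polyhedron α c) :
    (fun x => x - p) '' tangentCone (polyhedron α c) p = polyCone α (activeSet α c p) := by
  ext x
  constructor
  · rintro ⟨_, hy, rfl⟩
    obtain ⟨k, q, hq, rfl⟩ := mem_iUnion.1 hy
    simpa using (isWedge_polyCone α _).smul_mem (Nat.cast_nonneg k) (sub_mem_polyCone (p := p) hq)
  · intro hx
    have hlim : Filter.Tendsto (fun k : ℕ => (k : ℝ)⁻¹) Filter.atTop (nhdsWithin 0 (Ioi 0)) :=
      tendsto_inv_atTop_nhdsGT_zero.comp tendsto_natCast_atTop_atTop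
    obtain ⟨k, hk, hk0⟩ := ((hlim.eventually (eventually_add_smul_mem hp hx)).and
      (Filter.eventually_gt_atTop 0)).exists
    refine ⟨p + x, mem_iUnion.2 ⟨k, _, hk.1, ?_⟩, by simp⟩
    have : (k : ℝ) ≠ 0 := by positivity
    simp [smul_smul, this]

/-- A functional annihilating the common kernel of finitely many functionals is a combination
of them. -/
lemma exists_eq_sum_smul {ι : Type*} [Fintype ι] (β : ι → Fin n → ℝ) {y : Fin n → ℝ}
    (hy : ∀ k, (∀ i, β i ⬝ᵥ k = 0) → y ⬝ᵥ k = 0) : ∃ a : ι → ℝ, y = ∑ i, a i • β i := by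
  have h := mem_span_of_iInf_ker_le_ker (𝕜 := ℝ) (L := fun i => dotProductBilin ℝ ℝ (β i))
    (K := dotProductBilin ℝ ℝ y) (by
      intro k hk
      simp only [Submodule.mem_iInf, LinearMap.mem_ker] at hk ⊢
      exact hy k hk)
  obtain ⟨a, ha⟩ := (Submodule.mem_span_range_iff_exists_fun ℝ).1 h
  refine ⟨a, funext fun j => ?_⟩
  have := LinearMap.congr_fun ha (Pi.single j 1)
  simpa [dotProductBilin, dotProduct_single] using this.symm

lemma polyCone_dotProduct_eq_zero {I : Finset (Fin m)} {μ : Fin n → ℝ}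
    (hμ : ∀ x ∈ polyCone α I, 0 ≤ μ ⬝ᵥ x) {k : Fin n → ℝ} (hk : ∀ i ∈ I, α i ⬝ᵥ k = 0) :
    μ ⬝ᵥ k = 0 := by
  have h1 := hμ k fun i hi => (hk i hi).ge
  have h2 := hμ (-k) fun i hi => by rw [dotProduct_neg, hk i hi, neg_zero]
  rw [dotProduct_neg] at h2
  linarith

/-- A functional which is strictly positive on a polyhedral cone away from its lineality space may
be perturbed by any functional vanishing on the lineality space. -/
lemma exists_pos_add_smul_nonneg {I : Finset (Fin m)} {μ y : Fin n → ℝ}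
    (hμ : ∀ x ∈ polyCone α I, 0 ≤ μ ⬝ᵥ x)
    (hker : ∀ k ∈ polyCone α I, μ ⬝ᵥ k = 0 → ∀ i ∈ I, α i ⬝ᵥ k = 0)
    (hy : ∀ k, (∀ i ∈ I, α i ⬝ᵥ k = 0) → y ⬝ᵥ k = 0) :
    ∃ δ : ℝ, 0 < δ ∧ ∀ k ∈ polyCone α I, 0 ≤ (μ + δ • y) ⬝ᵥ k := by
  obtain ⟨a, ha⟩ := exists_eq_sum_smul (fun i : I => α i) (y := μ) fun k hk =>
    polyCone_dotProduct_eq_zero hμ fun i hi => hk ⟨i, hi⟩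
  obtain ⟨b, hb⟩ := exists_eq_sum_smul (fun i : I => α i) (y := y) fun k hk =>
    hy k fun i hi => hk ⟨i, hi⟩
  let A : (Fin n → ℝ) →ₗ[ℝ] (I → ℝ) := LinearMap.pi fun i : I => dotProductBilin ℝ ℝ (α i)
  have hA : ∀ k (i : I), A k i = α i ⬝ᵥ k := fun k i => rfl
  have hμA : ∀ k, μ ⬝ᵥ k = a ⬝ᵥ A k := fun k => by
    rw [ha, sum_dotProduct]
    simp only [smul_dotProduct, smul_eq_mul]
    rfl
  have hyA : ∀ k, y ⬝ᵥ k = b ⬝ᵥ A k := fun k => by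
    rw [hb, sum_dotProduct]
    simp only [smul_dotProduct, smul_eq_mul]
    rfl
  have hcomp : IsCompact (stdSimplex ℝ I ∩ (LinearMap.range A : Set (I → ℝ))) :=
    (isCompact_stdSimplex ℝ I).inter_right (Submodule.closed_of_finiteDimensional _)
  have hcont : ∀ d : I → ℝ, Continuous fun z : I → ℝ => d ⬝ᵥ z := fun d => by
    unfold dotProduct
    fun_prop
  obtain ⟨c, d, hc, hcd⟩ : ∃ c d : ℝ, 0 < c ∧
      ∀ z ∈ stdSimplex ℝ I ∩ (LinearMap.range A : Set (I → ℝ)), c ≤ a ⬝ᵥ z ∧ d ≤ b ⬝ᵥ z := by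
    rcases (stdSimplex ℝ I ∩ (LinearMap.range A : Set (I → ℝ))).eq_empty_or_nonempty with h | h
    · exact ⟨1, 0, one_pos, by simp [h]⟩
    · obtain ⟨z, hz, hzmin⟩ := hcomp.exists_isMinOn h (hcont a).continuousOn
      obtain ⟨z', hz', hzmin'⟩ := hcomp.exists_isMinOn h (hcont b).continuousOn
      refine ⟨a ⬝ᵥ z, b ⬝ᵥ z', ?_, fun x hx => ⟨hzmin hx, hzmin' hx⟩⟩
      obtain ⟨hz1, k, rfl⟩ := hz
      have hkK : k ∈ polyCone α I := fun i hi => hz1.1 ⟨i, hi⟩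
      rw [← hμA]
      refine lt_of_le_of_ne (hμ k hkK) fun h0 => ?_
      have h1 : ∑ i, A k i = 0 :=
        Finset.sum_eq_zero fun i _ => hker k hkK h0.symm i i.2
      linarith [hz1.2]
  refine ⟨c / (|d| + 1), by positivity, fun k hk => ?_⟩
  have hnn : ∀ i, 0 ≤ A k i := fun i => hk i i.2
  rw [add_dotProduct, smul_dotProduct, smul_eq_mul, hμA, hyA]
  rcases (Finset.sum_nonneg fun i (_ : i ∈ Finset.univ) => hnn i).eq_or_lt with h0 | h0
  · have : A k = 0 := funext fun i =>
      (Finset.sum_eq_zero_iff_of_nonneg fun i _ => hnn i).1 h0.symm i (Finset.mem_univ i)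
    simp [this]
  · set s := ∑ i, A k i
    have hz : s⁻¹ • A k ∈ stdSimplex ℝ I ∩ (LinearMap.range A : Set (I → ℝ)) := by
      refine ⟨⟨fun i => mul_nonneg (inv_nonneg.2 h0.le) (hnn i), ?_⟩, s⁻¹ • k, by simp⟩
      simp only [Pi.smul_apply, smul_eq_mul, ← Finset.mul_sum]
      exact inv_mul_cancel₀ h0.ne'
    obtain ⟨h1, h2⟩ := hcd _ hz
    rw [dotProduct_smul, smul_eq_mul, ← div_eq_inv_mul, le_div_iff₀ h0] at h1 h2
    have h3 : 0 ≤ c + c / (|d| + 1) * d := by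
      have h4 : -(|d| + 1) ≤ d := by linarith [neg_abs_le d]
      have h5 : 0 ≤ c / (|d| + 1) := by positivity
      have h6 : c / (|d| + 1) * (|d| + 1) = c := by field_simp
      nlinarith
    have h7 : 0 ≤ c / (|d| + 1) := by positivity
    nlinarith [mul_le_mul_of_nonneg_left h2 h7, mul_nonneg h3 h0.le]

end Polyhedron

section Rigid

variable {n m : ℕ} {α : Fin m → Fin n → ℝ} {I : Finset (Fin m)}

lemma dotProduct_pos_of_mem_interior {K : Set (Fin n → ℝ)} {μ : Fin n → ℝ} (hμ0 : μ ≠ 0)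
    (hμ : ∀ x ∈ K, 0 ≤ μ ⬝ᵥ x) {x : Fin n → ℝ} (hx : x ∈ interior K) : 0 < μ ⬝ᵥ x := by
  refine lt_of_le_of_ne (hμ x (interior_subset hx)) fun h0 => hμ0 ?_
  have hc : Filter.Tendsto (fun t : ℝ => x - t • μ) (nhdsWithin 0 (Ioi 0)) (nhds x) := by
    have : Continuous fun t : ℝ => x - t • μ := by fun_prop
    simpa using (this.tendsto 0).mono_left nhdsWithin_le_nhds
  obtain ⟨t, ht, ht0⟩ :=
    ((hc.eventually_mem (mem_interior_iff_mem_nhds.1 hx)).and self_mem_nhdsWithin).exists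
  have ht0 : 0 < t := ht0
  have h1 := hμ _ ht
  rw [dotProduct_sub, ← h0, dotProduct_smul, smul_eq_mul] at h1
  have h2 : 0 ≤ μ ⬝ᵥ μ := Finset.sum_nonneg fun i _ => mul_self_nonneg (μ i)
  exact dotProduct_self_eq_zero.1 (le_antisymm (by nlinarith) h2)

/-- If all admissible functionals which are nonnegative on the cone are strictly positive off its
lineality space, then an admissible functional vanishing on the lineality space is nonnegative on
the cone or a negative multiple of a given one. -/
lemma nonneg_or_eq_neg_smul
    (hstrict : ∀ ν : Fin n → ℝ, ν ≠ 0 → (∀ x ∈ polyCone α I, 0 ≤ ν ⬝ᵥ x) →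
      SignAdmissible (polyCone α I) ν → ∀ k ∈ polyCone α I, ν ⬝ᵥ k = 0 → ∀ i ∈ I, α i ⬝ᵥ k = 0)
    {μ y : Fin n → ℝ} (hμ0 : μ ≠ 0) (hμ : ∀ x ∈ polyCone α I, 0 ≤ μ ⬝ᵥ x)
    (hμs : SignAdmissible (polyCone α I) μ) (hy : ∀ k, (∀ i ∈ I, α i ⬝ᵥ k = 0) → y ⬝ᵥ k = 0)
    (hys : SignAdmissible (polyCone α I) y) :
    (∀ x ∈ polyCone α I, 0 ≤ y ⬝ᵥ x) ∨ ∃ c : ℝ, 0 < c ∧ y = -(c • μ) := by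
  by_contra! ⟨⟨k, hk, hyk⟩, hno⟩
  set Θ : Set ℝ := {θ | 0 ≤ θ ∧ ∀ x ∈ polyCone α I, 0 ≤ (μ + θ • y) ⬝ᵥ x} with hΘ
  have hclosed : IsClosed Θ := by
    have : Θ = Ici 0 ∩ ⋂ x ∈ polyCone α I, {θ : ℝ | 0 ≤ μ ⬝ᵥ x + θ * y ⬝ᵥ x} := by
      ext θ
      simp [hΘ, add_dotProduct, smul_dotProduct]
    rw [this]
    exact isClosed_Ici.inter (isClosed_biInter fun x _ =>
      isClosed_le continuous_const (by fun_prop))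
  have hbdd : BddAbove Θ := by
    refine ⟨μ ⬝ᵥ k / -(y ⬝ᵥ k), fun θ hθ => ?_⟩
    rw [le_div_iff₀ (by linarith)]
    have := hθ.2 k hk
    rw [add_dotProduct, smul_dotProduct, smul_eq_mul] at this
    linarith
  have h0 : (0 : ℝ) ∈ Θ := ⟨le_rfl, fun x hx => by simpa using hμ x hx⟩
  have hmem : sSup Θ ∈ Θ := hclosed.csSup_mem ⟨0, h0⟩ hbdd
  set θ := sSup Θ
  have hν0 : μ + θ • y ≠ 0 := by
    intro h
    have hθ : θ ≠ 0 := by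
      intro h1
      rw [h1, zero_smul, add_zero] at h
      exact hμ0 h
    refine hno θ⁻¹ (inv_pos.2 (lt_of_le_of_ne hmem.1 hθ.symm)) ?_
    rw [eq_neg_of_add_eq_zero_left h, smul_neg, neg_neg, smul_smul, inv_mul_cancel₀ hθ, one_smul]
  obtain ⟨δ, hδ, hδK⟩ := exists_pos_add_smul_nonneg hmem.2
    (hstrict _ hν0 hmem.2 (hμs.add (hys.smul hmem.1))) hy
  have : θ + δ ∈ Θ := by
    refine ⟨add_nonneg hmem.1 hδ.le, fun x hx => ?_⟩
    rw [add_smul, ← add_assoc]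
    exact hδK x hx
  linarith [le_csSup hbdd this]

/-- The set of points pointing weakly away from all peaks of `K`. -/
def antiPeakCone (K : Set (Fin n → ℝ)) : Set (Fin n → ℝ) :=
  {z | ∀ i, (HasPeak K i 1 → z i ≤ 0) ∧ (HasPeak K i (-1) → 0 ≤ z i)}

lemma isWedge_antiPeakCone (K : Set (Fin n → ℝ)) : IsWedge (antiPeakCone K) where
  zero_mem := fun i => by simp
  add_mem := fun x hx y hy i =>
    ⟨fun h => add_nonpos ((hx i).1 h) ((hy i).1 h), fun h => add_nonneg ((hx i).2 h) ((hy i).2 h)⟩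
  smul_mem := fun a ha x hx i =>
    ⟨fun h => mul_nonpos_of_nonneg_of_nonpos ha ((hx i).1 h), fun h => mul_nonneg ha ((hx i).2 h)⟩

lemma signAdmissible_of_nonneg_antiPeakCone {K : Set (Fin n → ℝ)} {y : Fin n → ℝ}
    (hy : ∀ z ∈ antiPeakCone K, 0 ≤ y ⬝ᵥ z) : SignAdmissible K y := by
  intro i
  constructor
  · intro hi
    by_contra hP
    have := hy (Pi.single i (-1)) fun j => by
      rcases eq_or_ne j i with rfl | hj
      · simp [hP]
      · simp [hj]
    rw [dotProduct_single] at this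
    linarith
  · intro hi
    by_contra hP
    have := hy (Pi.single i 1) fun j => by
      rcases eq_or_ne j i with rfl | hj
      · simp [hP]
      · simp [hj]
    rw [dotProduct_single] at this
    linarith

/-- A proper wedge with nonempty interior admits an admissible functional that is nonpositive on it
and negative on its interior. -/
lemma exists_signAdmissible_nonpos {K : Set (Fin n → ℝ)} (hK : IsWedge K)
    (hKi : (interior K).Nonempty) (hne : K ≠ univ) :
    ∃ y : Fin n → ℝ, (∀ x ∈ interior K, y ⬝ᵥ x < 0) ∧ (∀ x ∈ K, y ⬝ᵥ x ≤ 0) ∧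
      SignAdmissible K y := by
  have hdisj : Disjoint (interior K) (antiPeakCone K) := by
    rw [Set.disjoint_left]
    intro z hz hzC
    refine hK.not_forall_hasPeak hKi (interior_subset hz) ?_ hzC
    rintro rfl
    exact hne (hK.eq_univ hz)
  obtain ⟨y, hy1, hy2⟩ := exists_dotProduct_separating hK.convex.interior isOpen_interior
    (isWedge_antiPeakCone K) hdisj
  refine ⟨y, hy1, fun x hx => ?_, signAdmissible_of_nonneg_antiPeakCone hy2⟩
  obtain ⟨w, hw⟩ := hKi
  by_contra! hpos
  have hyw := hy1 w hw
  have := hy1 _ (hK.add_smul_mem_interior hx hw (div_pos hpos (neg_pos.2 hyw)))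
  rw [dotProduct_add, dotProduct_smul, smul_eq_mul, div_neg, neg_mul, div_mul_cancel₀ _ hyw.ne]
    at this
  linarith

/-- If the cone has peaks of exactly one sign in some direction, then there is an admissible
functional vanishing on the lineality space with a nonzero coordinate in a direction without
peaks of both signs. -/
lemma exists_signAdmissible_vanishing (hKi : (interior (polyCone α I)).Nonempty)
    (hF : ∃ j, ¬(HasPeak (polyCone α I) j 1 ↔ HasPeak (polyCone α I) j (-1))) :
    ∃ y : Fin n → ℝ, (∀ k, (∀ i ∈ I, α i ⬝ᵥ k = 0) → y ⬝ᵥ k = 0) ∧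
      SignAdmissible (polyCone α I) y ∧
      ∃ j, y j ≠ 0 ∧ ¬(HasPeak (polyCone α I) j 1 ∧ HasPeak (polyCone α I) j (-1)) := by
  classical
  set K := polyCone α I with hK
  have hKw : IsWedge K := isWedge_polyCone α I
  set E : Fin n → Prop := fun j => HasPeak K j 1 ∧ HasPeak K j (-1) with hE
  let O : Set (Fin n → ℝ) := {x | ∀ j, (HasPeak K j 1 → ¬HasPeak K j (-1) → x j < 0) ∧
    (HasPeak K j (-1) → ¬HasPeak K j 1 → 0 < x j)}
  let L : Set (Fin n → ℝ) := {x | (∀ i ∈ I, α i ⬝ᵥ x = 0) ∧ ∀ j, E j → x j = 0}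
  have hLw : IsWedge L :=
    { zero_mem := ⟨fun i _ => by simp, fun j _ => rfl⟩
      add_mem := fun x hx y hy => ⟨fun i hi => by rw [dotProduct_add, hx.1 i hi, hy.1 i hi, add_zero],
        fun j hj => by rw [Pi.add_apply, hx.2 j hj, hy.2 j hj, add_zero]⟩
      smul_mem := fun a _ x hx => ⟨fun i hi => by rw [dotProduct_smul, hx.1 i hi, smul_zero],
        fun j hj => by rw [Pi.smul_apply, hx.2 j hj, smul_zero]⟩ }
  have hOc : Convex ℝ O := by
    intro x hx y hy a b ha hb hab j
    have hcomb : ∀ u v : ℝ, 0 < u → 0 < v → 0 < a * u + b * v := by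
      intro u v hu hv
      rcases ha.eq_or_lt with rfl | ha
      · rw [zero_add] at hab
        subst hab
        linarith
      · nlinarith [mul_pos ha hu, mul_nonneg hb hv.le]
    simp only [Pi.add_apply, Pi.smul_apply, smul_eq_mul]
    refine ⟨fun h1 h2 => ?_, fun h1 h2 => hcomb _ _ ((hx j).2 h1 h2) ((hy j).2 h1 h2)⟩
    linarith [hcomb (-x j) (-y j) (neg_pos.2 ((hx j).1 h1 h2)) (neg_pos.2 ((hy j).1 h1 h2))]
  have hOo : IsOpen O := by
    have : O = ⋂ j, ({x | HasPeak K j 1 → ¬HasPeak K j (-1) → x j < 0} ∩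
        {x | HasPeak K j (-1) → ¬HasPeak K j 1 → 0 < x j}) := by
      ext x
      simp [O]
    rw [this]
    refine isOpen_iInter_of_finite fun j => ?_
    by_cases h1 : HasPeak K j 1 <;> by_cases h2 : HasPeak K j (-1) <;> simp only [h1, h2] <;>
      simp only [forall_true_left, IsEmpty.forall_iff, not_true_eq_false, not_false_eq_true,
        ofPred_true, inter_univ, univ_inter, isOpen_univ]
    · exact isOpen_lt (continuous_apply j) continuous_const
    · exact isOpen_lt continuous_const (continuous_apply j)
  have hdisj : Disjoint O L := by
    rw [Set.disjoint_left]
    intro z hzO hzL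
    refine hKw.not_forall_hasPeak hKi (fun i hi => (hzL.1 i hi).ge) ?_ fun j => ⟨fun h => ?_,
      fun h => ?_⟩
    · rintro rfl
      obtain ⟨j, hj⟩ := hF
      have h1 := hzO j
      simp only [Pi.zero_apply, lt_irrefl] at h1
      tauto
    · by_cases h2 : HasPeak K j (-1)
      · exact (hzL.2 j ⟨h, h2⟩).le
      · exact ((hzO j).1 h h2).le
    · by_cases h2 : HasPeak K j 1
      · exact (hzL.2 j ⟨h2, h⟩).ge
      · exact ((hzO j).2 h h2).le
  obtain ⟨g, hgO, hgL⟩ := exists_dotProduct_separating hOc hOo hLw hdisj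
  have hgL0 : ∀ x ∈ L, g ⬝ᵥ x = 0 := by
    intro x hx
    have h1 : -x ∈ L := ⟨fun i hi => by rw [dotProduct_neg, hx.1 i hi, neg_zero],
      fun j hj => by rw [Pi.neg_apply, hx.2 j hj, neg_zero]⟩
    have h2 := hgL _ h1
    rw [dotProduct_neg] at h2
    linarith [hgL x hx]
  let o : Fin n → ℝ := fun j =>
    if HasPeak K j 1 then (if HasPeak K j (-1) then 0 else -1)
    else (if HasPeak K j (-1) then 1 else 0)
  have ho : o ∈ O := fun j => ⟨fun h1 h2 => by simp [o, h1, h2], fun h1 h2 => by simp [o, h1, h2]⟩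
  have hmove : ∀ j t, (HasPeak K j 1 → ¬HasPeak K j (-1) → t ≤ 0) →
      (HasPeak K j (-1) → ¬HasPeak K j 1 → 0 ≤ t) → g ⬝ᵥ o + g j * t < 0 := by
    intro j t h1 h2
    rw [← dotProduct_single, ← dotProduct_add]
    refine hgO _ fun i => ?_
    rcases eq_or_ne i j with rfl | hij
    · simp only [Pi.add_apply, Pi.single_eq_same]
      exact ⟨fun a b => by linarith [(ho i).1 a b, h1 a b],
        fun a b => by linarith [(ho i).2 a b, h2 a b]⟩
    · simpa [hij] using ho i
  have hgo := hgO o ho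
  have hgpos : ∀ j, 0 < g j → HasPeak K j 1 ∧ ¬HasPeak K j (-1) := by
    intro j hj
    by_contra hcon
    have := hmove j (-(g ⬝ᵥ o) / g j) (fun a b => absurd ⟨a, b⟩ hcon)
      (fun _ _ => div_nonneg (by linarith) hj.le)
    rw [mul_div_cancel₀ _ hj.ne'] at this
    linarith
  have hgneg : ∀ j, g j < 0 → HasPeak K j (-1) ∧ ¬HasPeak K j 1 := by
    intro j hj
    by_contra hcon
    have := hmove j (-(g ⬝ᵥ o) / g j) (fun _ _ => div_nonpos_of_nonneg_of_nonpos (by linarith) hj.le)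
      (fun a b => absurd ⟨a, b⟩ hcon)
    rw [mul_div_cancel₀ _ hj.ne] at this
    linarith
  obtain ⟨a, ha⟩ := exists_eq_sum_smul
    (Sum.elim (fun i : I => α i) fun e : {j // E j} => Pi.single (e : Fin n) (1 : ℝ)) (y := g)
    fun k hk => hgL0 k ⟨fun i hi => hk (Sum.inl ⟨i, hi⟩), fun j hj => by
      simpa using hk (Sum.inr ⟨j, hj⟩)⟩
  rw [Fintype.sum_sum_type] at ha
  simp only [Sum.elim_inl, Sum.elim_inr] at ha
  set y := ∑ i : I, a (Sum.inl i) • α i with hy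
  have hyg : ∀ j, ¬E j → y j = g j := by
    intro j hj
    rw [ha, Pi.add_apply, Finset.sum_apply, Finset.sum_eq_zero, add_zero]
    rintro ⟨e, he⟩ -
    have : j ≠ e := by
      rintro rfl
      exact hj he
    simp [this]
  refine ⟨-y, fun k hk => ?_, fun j => ?_, ?_⟩
  · rw [neg_dotProduct, hy, sum_dotProduct, Finset.sum_eq_zero, neg_zero]
    rintro ⟨i, hi⟩ -
    rw [smul_dotProduct, hk i hi, smul_zero]
  · by_cases hj : E j
    · exact ⟨fun _ => hj.2, fun _ => hj.1⟩
    · rw [Pi.neg_apply, hyg j hj]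
      exact ⟨fun h => (hgneg j (by linarith)).1, fun h => (hgpos j (by linarith)).1⟩
  · obtain ⟨j, hj⟩ : ∃ j, g j ≠ 0 := by
      by_contra! h
      rw [show g = 0 from funext h, zero_dotProduct] at hgo
      exact lt_irrefl _ hgo
    have hEj : ¬E j := by
      rintro ⟨h1, h2⟩
      rcases hj.lt_or_gt with h | h
      · exact (hgneg j h).2 h1
      · exact (hgpos j h).2 h2
    exact ⟨j, by rw [Pi.neg_apply, hyg j hEj]; exact neg_ne_zero.2 hj, hEj⟩

/-- Rigidity of a polyhedral cone follows from rigidity of its tangent cones at points off the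
lineality space, together with the existence of a one-sided peak direction. -/
lemma isRigid_polyCone (hKi : (interior (polyCone α I)).Nonempty)
    (hI : ∀ k ∈ polyCone α I, (∃ i ∈ I, α i ⬝ᵥ k ≠ 0) →
      IsRigid (polyCone α (I.filter fun i => α i ⬝ᵥ k = 0)))
    (hF : ∃ j, ¬(HasPeak (polyCone α I) j 1 ↔ HasPeak (polyCone α I) j (-1))) :
    IsRigid (polyCone α I) := by
  intro μ hμ hμs
  by_contra hμ0
  have hKw := isWedge_polyCone α I
  have hstrict : ∀ ν : Fin n → ℝ, ν ≠ 0 → (∀ x ∈ polyCone α I, 0 ≤ ν ⬝ᵥ x) →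
      SignAdmissible (polyCone α I) ν →
      ∀ k ∈ polyCone α I, ν ⬝ᵥ k = 0 → ∀ i ∈ I, α i ⬝ᵥ k = 0 := by
    intro ν hν0 hν hνs k hk hνk
    by_contra! hcon
    have hsub : polyCone α I ⊆ polyCone α (I.filter fun i => α i ⬝ᵥ k = 0) :=
      fun x hx i hi => hx i (Finset.mem_filter.1 hi).1
    refine hν0 (hI k hk hcon ν (fun x hx => ?_) (hνs.mono hsub))
    have hpos : ∀ i ∈ I, ∃ A : ℝ, ∀ B ≥ A, 0 ≤ α i ⬝ᵥ (x + B • k) := by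
      intro i hi
      by_cases h0 : α i ⬝ᵥ k = 0
      · refine ⟨0, fun B _ => ?_⟩
        rw [dotProduct_add, dotProduct_smul, h0, smul_zero, add_zero]
        exact hx i (Finset.mem_filter.2 ⟨hi, h0⟩)
      · have h1 : 0 < α i ⬝ᵥ k := lt_of_le_of_ne (hk i hi) (Ne.symm h0)
        refine ⟨-(α i ⬝ᵥ x) / α i ⬝ᵥ k, fun B hB => ?_⟩
        rw [ge_iff_le, div_le_iff₀ h1] at hB
        rw [dotProduct_add, dotProduct_smul, smul_eq_mul]
        linarith
    choose! A hA using hpos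
    obtain ⟨B, hB⟩ := (I.image A).exists_le
    have := hν (x + B • k) fun i hi => hA i hi B (hB _ (Finset.mem_image_of_mem _ hi))
    rwa [dotProduct_add, dotProduct_smul, hνk, smul_zero, add_zero] at this
  obtain ⟨w, hw⟩ := hKi
  have hμw := dotProduct_pos_of_mem_interior hμ0 hμ hw
  by_cases hneg : SignAdmissible (polyCone α I) (-μ)
  · obtain ⟨y, hyL, hys, j, hyj, hj⟩ := exists_signAdmissible_vanishing ⟨w, hw⟩ hF
    have hμj : μ j = 0 := by
      by_contra h
      refine hj ?_
      rcases Ne.lt_or_gt h with h | h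
      · exact ⟨(hμs j).2 h, (hneg j).1 (by simpa using h)⟩
      · exact ⟨(hneg j).2 (by simpa using h), (hμs j).1 h⟩
    have hε : 0 < μ ⬝ᵥ w / (|y ⬝ᵥ w| + 1) := by positivity
    rcases nonneg_or_eq_neg_smul hstrict hμ0 hμ hμs (y := -μ + (μ ⬝ᵥ w / (|y ⬝ᵥ w| + 1)) • y)
      (fun k hk => by
        rw [add_dotProduct, neg_dotProduct, polyCone_dotProduct_eq_zero hμ hk, smul_dotProduct,
          hyL k hk]
        simp) (hneg.add (hys.smul hε.le)) with h | ⟨c, hc, h⟩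
    · have h1 := h w (interior_subset hw)
      rw [add_dotProduct, neg_dotProduct, smul_dotProduct, smul_eq_mul] at h1
      have h2 : μ ⬝ᵥ w / (|y ⬝ᵥ w| + 1) * (|y ⬝ᵥ w| + 1) = μ ⬝ᵥ w := by
        field_simp
      nlinarith [le_abs_self (y ⬝ᵥ w)]
    · have h1 := congrFun h j
      simp only [Pi.add_apply, Pi.neg_apply, Pi.smul_apply, hμj, smul_eq_mul] at h1
      simp [hyj] at h1
      rcases h1 with h1 | h1
      · exact hμw.ne' h1
      · linarith [abs_nonneg (y ⬝ᵥ w)]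
  · have hne : polyCone α I ≠ univ := by
      intro h
      have := hμ (-w) (h ▸ mem_univ _)
      rw [dotProduct_neg] at this
      linarith
    obtain ⟨y, hy1, hy2, hys⟩ := exists_signAdmissible_nonpos hKw ⟨w, hw⟩ hne
    rcases nonneg_or_eq_neg_smul hstrict hμ0 hμ hμs (y := y) (fun k hk => by
        have := polyCone_dotProduct_eq_zero (μ := -y) (fun x hx => by
          rw [neg_dotProduct]
          linarith [hy2 x hx]) hk
        rw [neg_dotProduct] at this
        linarith) hys with h | ⟨c, hc, rfl⟩
    · exact (hy1 w hw).not_ge (h w (interior_subset hw))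
    · refine hneg ?_
      have := hys.smul (inv_nonneg.2 hc.le)
      rwa [smul_neg, smul_smul, inv_mul_cancel₀ hc.ne', one_smul] at this

/-- If every boundary point has a one-sided peak direction, all tangent cones are rigid. -/
lemma isRigid_of_forall_frontier {c : Fin m → ℝ} (hint : (interior (polyhedron α c)).Nonempty)
    (hF : ∀ p ∈ frontier (polyhedron α c), ∃ j,
      ¬(HasPeak (polyCone α (activeSet α c p)) j 1 ↔
        HasPeak (polyCone α (activeSet α c p)) j (-1)))
    {p : Fin n → ℝ} (hp : p ∈ polyhedron α c) : IsRigid (polyCone α (activeSet α c p)) := by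
  induction hN : (activeSet α c p).card using Nat.strong_induction_on generalizing p with
  | _ N ih =>
  by_cases hpf : p ∈ interior (polyhedron α c)
  · intro μ hμ _
    by_contra hμ0
    have := dotProduct_pos_of_mem_interior hμ0 hμ (sub_mem_interior_polyCone (p := p) hpf)
    simp at this
  · obtain ⟨q, hq⟩ := hint
    refine isRigid_polyCone ⟨_, sub_mem_interior_polyCone hq⟩ (fun k hk hex => ?_)
      (hF p ⟨subset_closure hp, hpf⟩)
    obtain ⟨ε, hε, hεa⟩ := (eventually_add_smul_mem hp hk).exists
    rw [← hεa]
    refine ih _ ?_ hε rfl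
    rw [hεa, ← hN]
    refine Finset.card_lt_card (Finset.filter_ssubset.2 ?_)
    simpa using hex

end Rigid

section Retraction

variable {n m : ℕ} {α : Fin m → Fin n → ℝ} {c : Fin m → ℝ}

/-- If all tangent cones are rigid, a ball system centred at finitely many interior points and
having a common point in the ambient space has a common point in the polyhedron. -/
lemma exists_mem_forall_finset_dist_le
    (hR : ∀ p ∈ polyhedron α c, IsRigid (polyCone α (activeSet α c p))) (x : Fin n → ℝ)
    {S : Finset (Fin n → ℝ)} (hS : S.Nonempty) (hSP : ∀ p ∈ S, p ∈ interior (polyhedron α c)) :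
    ∃ y ∈ polyhedron α c, ∀ p ∈ S, dist y p ≤ dist x p := by
  set φ : (Fin n → ℝ) → ℝ := fun y => S.sup' hS fun p => dist y p - dist x p with hφ
  have hle : ∀ y, ∀ p ∈ S, dist y p - dist x p ≤ φ y := fun y p hp =>
    Finset.le_sup' (fun p => dist y p - dist x p) hp
  have hφc : Continuous φ := Continuous.finset_sup'_apply hS fun p _ => by fun_prop
  obtain ⟨p₀, hp₀⟩ := hS
  have hp₀P := interior_subset (hSP p₀ hp₀)
  obtain ⟨y, ⟨hyP, -⟩, hymin⟩ := (((isCompact_closedBall p₀ (φ p₀ + dist x p₀)).inter_left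
    (isClosed_polyhedron α c))).exists_isMinOn (f := φ) ⟨p₀, hp₀P, by
      have := hle p₀ p₀ hp₀
      rw [dist_self] at this
      rw [mem_closedBall, dist_self]
      linarith⟩ hφc.continuousOn
  have hmin : ∀ z ∈ polyhedron α c, φ y ≤ φ z := by
    intro z hz
    by_cases hzb : z ∈ closedBall p₀ (φ p₀ + dist x p₀)
    · exact hymin ⟨hz, hzb⟩
    · rw [mem_closedBall, not_le] at hzb
      have h1 : φ y ≤ φ p₀ := hymin ⟨hp₀P, by
        have := hle p₀ p₀ hp₀
        rw [dist_self] at this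
        rw [mem_closedBall, dist_self]
        linarith⟩
      linarith [hle z p₀ hp₀]
  rcases le_or_gt (φ y) 0 with ht | ht
  · exact ⟨y, hyP, fun p hp => by linarith [hle y p hp]⟩
  exfalso
  set K := polyCone α (activeSet α c y) with hK
  have hKw : IsWedge K := isWedge_polyCone _ _
  let Tp : Fin n → Prop := fun i => ∃ p ∈ S, dist y p - dist x p = φ y ∧ p i - y i = dist y p
  let Tm : Fin n → Prop := fun i => ∃ p ∈ S, dist y p - dist x p = φ y ∧ y i - p i = dist y p
  have habs : ∀ p i, |p i - y i| ≤ dist y p := fun p i => by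
    have := dist_le_pi_dist p y i
    rwa [Real.dist_eq, dist_comm] at this
  have hTp : ∀ i, Tp i → HasPeak K i 1 := by
    rintro i ⟨p, hp, -, h⟩
    refine hasPeak_of_mem_interior (sub_mem_interior_polyCone (hSP p hp)) (Or.inl rfl) fun k => ?_
    rw [Pi.sub_apply, Pi.sub_apply, one_mul, h]
    exact habs p k
  have hTm : ∀ i, Tm i → HasPeak K i (-1) := by
    rintro i ⟨p, hp, -, h⟩
    refine hasPeak_of_mem_interior (sub_mem_interior_polyCone (hSP p hp)) (Or.inr rfl) fun k => ?_
    rw [Pi.sub_apply, Pi.sub_apply, neg_one_mul, neg_sub, h]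
    exact habs p k
  have hTT : ∀ i, Tp i → ¬Tm i := by
    rintro i ⟨p, -, hp1, hp2⟩ ⟨q, -, hq1, hq2⟩
    have h1 := (le_abs_self _).trans (Real.dist_eq (p i) (q i) ▸ dist_le_pi_dist p q i)
    have h2 := dist_triangle_left p q x
    linarith
  let O : Set (Fin n → ℝ) := {w | ∀ i, (Tp i → 0 < w i) ∧ (Tm i → w i < 0)}
  have hOc : Convex ℝ O := by
    intro u hu v hv a b ha hb hab j
    have hcomb : ∀ u v : ℝ, 0 < u → 0 < v → 0 < a * u + b * v := by
      intro u v hu hv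
      rcases ha.eq_or_lt with rfl | ha
      · rw [zero_add] at hab
        subst hab
        linarith
      · nlinarith [mul_pos ha hu, mul_nonneg hb hv.le]
    simp only [Pi.add_apply, Pi.smul_apply, smul_eq_mul]
    refine ⟨fun h => hcomb _ _ ((hu j).1 h) ((hv j).1 h), fun h => ?_⟩
    linarith [hcomb (-u j) (-v j) (neg_pos.2 ((hu j).2 h)) (neg_pos.2 ((hv j).2 h))]
  have hOo : IsOpen O := by
    have : O = ⋂ j, ({w | Tp j → 0 < w j} ∩ {w | Tm j → w j < 0}) := by
      ext w
      simp [O]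
    rw [this]
    refine isOpen_iInter_of_finite fun j => IsOpen.inter ?_ ?_
    · by_cases h : Tp j
      · simpa [h] using isOpen_lt continuous_const (continuous_apply j)
      · simp [h]
    · by_cases h : Tm j
      · simpa [h] using isOpen_lt (continuous_apply j) continuous_const
      · simp [h]
  classical
  have ho : (fun i => if Tp i then 1 else if Tm i then -1 else 0 : Fin n → ℝ) ∈ O := by
    intro i
    refine ⟨fun h => by simp [h], fun h => ?_⟩
    have : ¬Tp i := fun h' => hTT i h' h
    simp [h, this]
  set o : Fin n → ℝ := fun i => if Tp i then 1 else if Tm i then -1 else 0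
  have hnd : ¬Disjoint O K := by
    intro hdisj
    obtain ⟨μ, hμO, hμK⟩ := exists_dotProduct_separating hOc hOo hKw hdisj
    have hμo := hμO o ho
    have hmove : ∀ j t, (Tp j → 0 ≤ t) → (Tm j → t ≤ 0) → μ ⬝ᵥ o + μ j * t < 0 := by
      intro j t h1 h2
      rw [← dotProduct_single, ← dotProduct_add]
      refine hμO _ fun i => ?_
      rcases eq_or_ne i j with rfl | hij
      · simp only [Pi.add_apply, Pi.single_eq_same]
        exact ⟨fun a => by linarith [(ho i).1 a, h1 a], fun a => by linarith [(ho i).2 a, h2 a]⟩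
      · simpa [hij] using ho i
    have hμ0 : μ = 0 := by
      refine hR y hyP μ hμK fun i => ⟨fun hi => hTm i ?_, fun hi => hTp i ?_⟩
      · by_contra hT
        have := hmove i (-(μ ⬝ᵥ o) / μ i) (fun _ => div_nonneg (by linarith) hi.le)
          (fun h => absurd h hT)
        rw [mul_div_cancel₀ _ hi.ne'] at this
        linarith
      · by_contra hT
        have := hmove i (-(μ ⬝ᵥ o) / μ i) (fun h => absurd h hT)
          (fun _ => div_nonpos_of_nonneg_of_nonpos (by linarith) hi.le)
        rw [mul_div_cancel₀ _ hi.ne] at this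
        linarith
    rw [hμ0, zero_dotProduct] at hμo
    exact lt_irrefl _ hμo
  obtain ⟨w, hwO, hwK⟩ := Set.not_disjoint_iff.1 hnd
  have hdec : ∀ p ∈ S, ∀ᶠ ε in nhdsWithin (0 : ℝ) (Ioi 0),
      dist (y + ε • w) p - dist x p < φ y := by
    intro p hp
    rcases (hle y p hp).lt_or_eq with hlt | heq
    · have hc : Continuous fun ε : ℝ => dist (y + ε • w) p - dist x p := by fun_prop
      exact nhdsWithin_le_nhds ((hc.tendsto 0).eventually_lt_const (by simpa using hlt))
    · have hd : 0 < dist y p := by linarith [dist_nonneg (x := x) (y := p)]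
      have hcoord : ∀ k, ∀ᶠ ε in nhdsWithin (0 : ℝ) (Ioi 0), dist ((y + ε • w) k) (p k) <
          dist y p := by
        intro k
        have hc : Continuous fun ε : ℝ => (y + ε • w) k - p k := by
          simp only [Pi.add_apply, Pi.smul_apply, smul_eq_mul]
          fun_prop
        have hk := abs_le.1 (habs p k)
        have hupper : ∀ᶠ ε in nhdsWithin (0 : ℝ) (Ioi 0), (y + ε • w) k - p k < dist y p := by
          rcases hk.1.eq_or_lt with h | h
          · have hw := (hwO k).2 ⟨p, hp, heq, by linarith⟩
            filter_upwards [self_mem_nhdsWithin] with ε hε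
            have hε : 0 < ε := hε
            simp only [Pi.add_apply, Pi.smul_apply, smul_eq_mul]
            nlinarith
          · refine nhdsWithin_le_nhds ((hc.tendsto 0).eventually_lt_const ?_)
            simp only [zero_smul, add_zero]
            linarith
        have hlower : ∀ᶠ ε in nhdsWithin (0 : ℝ) (Ioi 0), -dist y p < (y + ε • w) k - p k := by
          rcases hk.2.eq_or_lt with h | h
          · have hw := (hwO k).1 ⟨p, hp, heq, h⟩
            filter_upwards [self_mem_nhdsWithin] with ε hε
            have hε : 0 < ε := hε
            simp only [Pi.add_apply, Pi.smul_apply, smul_eq_mul]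
            nlinarith
          · refine nhdsWithin_le_nhds ((hc.tendsto 0).eventually_const_lt ?_)
            simp only [zero_smul, add_zero]
            linarith
        filter_upwards [hupper, hlower] with ε h1 h2
        rw [Real.dist_eq]
        exact abs_lt.2 ⟨h2, h1⟩
      filter_upwards [Filter.eventually_all.2 hcoord] with ε hε
      rw [← heq, sub_lt_sub_iff_right]
      exact (dist_pi_lt_iff hd).2 hε
  obtain ⟨ε, hε1, hε2⟩ := (((Finset.eventually_all S).2 hdec).and
    (eventually_add_smul_mem hyP hwK)).exists
  have : φ (y + ε • w) < φ y := (Finset.sup'_lt_iff _).2 hε1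
  exact this.not_ge (hmin _ hε2.1)

/-- If all tangent cones are rigid, every point of the ambient space is dominated by a point of the
polyhedron. -/
lemma exists_mem_forall_dist_le (hint : (interior (polyhedron α c)).Nonempty)
    (hR : ∀ p ∈ polyhedron α c, IsRigid (polyCone α (activeSet α c p))) (x : Fin n → ℝ) :
    ∃ y ∈ polyhedron α c, ∀ p ∈ polyhedron α c, dist y p ≤ dist x p := by
  classical
  obtain ⟨q, hq⟩ := hint
  have hclosed : ∀ p : Fin n → ℝ, IsClosed {y : Fin n → ℝ | dist y p ≤ dist x p} := fun p =>
    isClosed_le (by fun_prop) continuous_const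
  obtain ⟨y, ⟨hyP, -⟩, hy⟩ := IsCompact.inter_iInter_nonempty
    ((isCompact_closedBall q (dist x q)).inter_left (isClosed_polyhedron α c))
    (fun p : interior (polyhedron α c) => {y : Fin n → ℝ | dist y p ≤ dist x p})
    (fun p => hclosed p) fun u => by
      obtain ⟨y, hyP, hy⟩ := exists_mem_forall_finset_dist_le hR x
        (S := insert q (u.image Subtype.val)) (Finset.insert_nonempty _ _) (by
          intro p hp
          rcases Finset.mem_insert.1 hp with rfl | hp
          · exact hq
          · obtain ⟨p, -, rfl⟩ := Finset.mem_image.1 hp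
            exact p.2)
      exact ⟨y, ⟨hyP, hy q (Finset.mem_insert_self _ _)⟩, mem_iInter₂.2 fun p hp =>
        hy p (Finset.mem_insert_of_mem (Finset.mem_image_of_mem _ hp))⟩
  refine ⟨y, hyP, fun p hp => ?_⟩
  have hsub : closure (interior (polyhedron α c)) ⊆ {p | dist y p ≤ dist x p} :=
    closure_minimal (fun p hp => mem_iInter.1 hy ⟨p, hp⟩) (isClosed_le (by fun_prop) (by fun_prop))
  rw [(convex_polyhedron α c).closure_interior_eq_closure_of_nonempty_interior ⟨q, hq⟩] at hsub
  exact hsub (subset_closure hp)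

/-- A nonempty set dominating all points of `l∞ⁿ` is a `1`-Lipschitz retract. -/
lemma exists_lipschitz_retraction {P : Set (Fin n → ℝ)} (hP : IsClosed P) (hne : P.Nonempty)
    (h : ∀ x, ∃ y ∈ P, ∀ p ∈ P, dist y p ≤ dist x p) :
    ∃ r : (Fin n → ℝ) → Fin n → ℝ, LipschitzWith 1 r ∧ (∀ x, r x ∈ P) ∧ ∀ p ∈ P, r p = p := by
  classical
  obtain ⟨p₀, hp₀⟩ := hne
  let R : Set ((Fin n → ℝ) → Fin n → ℝ) := {g | (∀ x y, dist (g x) (g y) ≤ dist x y) ∧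
    ∀ p ∈ P, g p = p}
  have hRc : IsCompact R := by
    refine (isCompact_univ_pi fun x => isCompact_closedBall p₀ (dist x p₀)).of_isClosed_subset ?_ ?_
    · have : R = (⋂ x, ⋂ y, {g | dist (g x) (g y) ≤ dist x y}) ∩ ⋂ p ∈ P, {g | g p = p} := by
        ext g
        simp [R]
      rw [this]
      refine (isClosed_iInter fun x => isClosed_iInter fun y => isClosed_le ?_ ?_).inter
        (isClosed_biInter fun p _ => isClosed_eq (continuous_apply p) continuous_const)
      · exact (continuous_apply x).dist (continuous_apply y)
      · exact continuous_const
    · intro g hg x _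
      have := hg.1 x p₀
      rwa [hg.2 p₀ hp₀] at this
  obtain ⟨r, hrR, hr⟩ := hRc.inter_iInter_nonempty (fun x => {g | g x ∈ P})
    (fun x => hP.preimage (continuous_apply x)) fun u => by
      suffices ∃ g ∈ R, ∀ x ∈ u, g x ∈ P by
        obtain ⟨g, hg, hgu⟩ := this
        exact ⟨g, hg, mem_iInter₂.2 hgu⟩
      induction u using Finset.induction_on with
      | empty => exact ⟨id, ⟨fun _ _ => le_rfl, fun _ _ => rfl⟩, by simp⟩
      | insert x u _ ih =>
        obtain ⟨k, hk, hku⟩ := ih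
        by_cases hx : k x ∈ P
        · exact ⟨k, hk, fun z hz => by
            rcases Finset.mem_insert.1 hz with rfl | hz
            exacts [hx, hku z hz]⟩
        obtain ⟨y, hyP, hy⟩ := h (k x)
        have hf : LipschitzOnWith 1 (fun z => if z ∈ P then z else y) (insert (k x) P) := by
          refine LipschitzOnWith.of_dist_le_mul fun a ha b hb => ?_
          rw [NNReal.coe_one, one_mul]
          rcases ha with rfl | ha <;> rcases hb with rfl | hb
          · simp
          · simpa [hx, hb] using hy b hb
          · simpa [hx, ha, dist_comm] using hy a ha
          · simp [ha, hb]
        obtain ⟨g, hg, hgf⟩ := hf.extend_pi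
        have hgP : ∀ p ∈ P, g p = p := fun p hp => by
          simpa [hp] using (hgf (mem_insert_of_mem _ hp)).symm
        refine ⟨g ∘ k, ⟨fun a b => ?_, fun p hp => ?_⟩, fun z hz => ?_⟩
        · have := hg.dist_le_mul (k a) (k b)
          rw [NNReal.coe_one, one_mul] at this
          exact this.trans (hk.1 a b)
        · rw [Function.comp_apply, hk.2 p hp, hgP p hp]
        · rcases Finset.mem_insert.1 hz with rfl | hz
          · have := hgf (mem_insert (k z) P)
            simp only [hx, if_false] at this
            rwa [Function.comp_apply, ← this]
          · rw [Function.comp_apply, hgP _ (hku z hz)]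
            exact hku z hz
  exact ⟨r, LipschitzWith.of_dist_le_mul fun x y => by simpa using hrR.1 x y,
    mem_iInter.1 hr, hrR.2⟩

/-- A subset of `l∞ⁿ` is injective iff it is a `1`-Lipschitz retract. -/
lemma isInjectiveSubset_iff_exists_retraction {P : Set (Fin n → ℝ)} :
    IsInjectiveSubset P ↔ ∃ r : (Fin n → ℝ) → Fin n → ℝ,
      LipschitzWith 1 r ∧ (∀ x, r x ∈ P) ∧ ∀ p ∈ P, r p = p := by
  constructor
  · intro h
    obtain ⟨g, hg, hgi⟩ := h P (Fin n → ℝ) Subtype.val id isometry_subtype_coe LipschitzWith.id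
    exact ⟨fun x => g x, hg, fun x => (g x).2, fun p hp => congrArg Subtype.val (hgi ⟨p, hp⟩)⟩
  · rintro ⟨r, hr, hrP, hri⟩ A B _ _ i f hi hf
    have hext : ∀ a, Function.extend i (fun a => (f a : Fin n → ℝ)) 0 (i a) = f a :=
      hi.injective.extend_apply _ _
    have hlip : LipschitzOnWith 1 (Function.extend i (fun a => (f a : Fin n → ℝ)) 0) (range i) := by
      refine LipschitzOnWith.of_dist_le_mul ?_
      rintro _ ⟨a, rfl⟩ _ ⟨b, rfl⟩
      rw [hext, hext, hi.dist_eq]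
      exact hf.dist_le_mul a b
    obtain ⟨g, hg, hgf⟩ := hlip.extend_pi
    refine ⟨fun b => ⟨r (g b), hrP _⟩, ?_, fun a => Subtype.ext ?_⟩
    · have : LipschitzWith 1 (r ∘ g) := by simpa using hr.comp hg
      exact fun a b => this a b
    · change r (g (i a)) = f a
      rw [← hgf (mem_range_self a), hext, hri _ (f a).2]

/-- The tangent cones of a `1`-Lipschitz retract are rigid. -/
lemma isRigid_of_retraction {r : (Fin n → ℝ) → Fin n → ℝ} (hr : LipschitzWith 1 r)
    (hrP : ∀ x, r x ∈ polyhedron α c) (hri : ∀ p ∈ polyhedron α c, r p = p)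
    {p : Fin n → ℝ} (hp : p ∈ polyhedron α c) : IsRigid (polyCone α (activeSet α c p)) := by
  intro μ hμ hμs
  by_contra hμ0
  let σ : Fin n → ℝ := fun i => if 0 < μ i then -1 else 1
  have hσ : ∀ i, σ i = 1 ∨ σ i = -1 := fun i => by
    by_cases h : 0 < μ i <;> simp [σ, h]
  have hpeak : ∀ i, μ i ≠ 0 → ∃ w ∈ polyCone α (activeSet α c p),
      w i = σ i ∧ ∀ k, k ≠ i → |w k| < 1 := by
    intro i hi
    have : HasPeak (polyCone α (activeSet α c p)) i (σ i) := by
      rcases hi.lt_or_gt with h | h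
      · simpa [σ, h.not_gt] using (hμs i).2 h
      · simpa [σ, h] using (hμs i).1 h
    obtain ⟨w, hw, hwK⟩ := ((isWedge_polyCone α _).facet_inter_nonempty (hσ i)).2 this
    exact ⟨w, hwK, (mem_intrinsicInterior_cubeFacet (hσ i)).1 hw⟩
  choose! w hwK hwi hwk using hpeak
  obtain ⟨s, hs, hs0⟩ : ∃ s : ℝ, (∀ i, μ i ≠ 0 → p + s • w i ∈ polyhedron α c) ∧ 0 < s := by
    have : ∀ i, ∀ᶠ s in nhdsWithin (0 : ℝ) (Ioi 0), μ i ≠ 0 → p + s • w i ∈ polyhedron α c := by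
      intro i
      by_cases hi : μ i = 0
      · simp [hi]
      · filter_upwards [eventually_add_smul_mem hp (hwK i hi)] with s hs _ using hs.1
    exact ((Filter.eventually_all.2 this).and self_mem_nhdsWithin).exists
  obtain ⟨δ, ⟨hδ, hδ1⟩, hδ0⟩ : ∃ δ : ℝ, ((∀ i k, μ i ≠ 0 → k ≠ i → |w i k| < 1 - 2 * δ) ∧
      δ < 1) ∧ 0 < δ := by
    have h1 : ∀ i k, ∀ᶠ δ in nhdsWithin (0 : ℝ) (Ioi 0),
        μ i ≠ 0 → k ≠ i → |w i k| < 1 - 2 * δ := by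
      intro i k
      by_cases hik : μ i ≠ 0 ∧ k ≠ i
      · have hc : Continuous fun δ : ℝ => 1 - 2 * δ := by fun_prop
        filter_upwards [nhdsWithin_le_nhds ((hc.tendsto 0).eventually_const_lt
          (by simpa using hwk i hik.1 k hik.2))] with δ hδ _ _ using hδ
      · exact Filter.Eventually.of_forall fun δ a b => absurd ⟨a, b⟩ hik
    exact (((Filter.eventually_all.2 fun i => Filter.eventually_all.2 (h1 i)).and
      (nhdsWithin_le_nhds (eventually_lt_nhds one_pos))).and self_mem_nhdsWithin).exists
  let v : Fin n → ℝ := fun i => if μ i = 0 then 0 else σ i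
  set y := r (p + (s * δ) • v)
  have hdist : ∀ i, μ i ≠ 0 → dist (p + (s * δ) • v) (p + s • w i) ≤ s * (1 - δ) := by
    intro i hi
    have hsδ := mul_pos hs0 hδ0
    refine (dist_pi_le_iff (mul_nonneg hs0.le (by linarith))).2 fun k => ?_
    rw [Real.dist_eq]
    simp only [Pi.add_apply, Pi.smul_apply, smul_eq_mul, add_sub_add_left_eq_sub]
    rcases eq_or_ne k i with rfl | hk
    · have h1 : v k = σ k := by simp [v, hi]
      rw [h1, hwi k hi, show s * δ * σ k - s * σ k = -(s * (1 - δ)) * σ k by ring, abs_mul, abs_neg,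
        abs_of_nonneg (mul_nonneg hs0.le (by linarith))]
      rcases hσ k with h | h <;> simp [h]
    · have h1 : |v k| ≤ 1 := by
        by_cases h : μ k = 0
        · simp [v, h]
        · rcases hσ k with h' | h' <;> simp [v, h, h']
      have h2 := hδ i k hi hk
      calc |s * δ * v k - s * w i k| ≤ |s * δ * v k| + |s * w i k| := abs_sub _ _
        _ = s * δ * |v k| + s * |w i k| := by
          rw [abs_mul (s * δ), abs_mul s (w i k), abs_of_pos hsδ, abs_of_pos hs0]
        _ ≤ s * δ * 1 + s * (1 - 2 * δ) := by gcongr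
        _ = s * (1 - δ) := by ring
  have hneg : ∀ i, μ i ≠ 0 → μ i * (y - p) i < 0 := by
    intro i hi
    have h1 := hr.dist_le_mul (p + (s * δ) • v) (p + s • w i)
    rw [NNReal.coe_one, one_mul, hri _ (hs i hi)] at h1
    have h2 := (dist_le_pi_dist _ _ i).trans (h1.trans (hdist i hi))
    rw [Real.dist_eq, abs_le] at h2
    simp only [Pi.add_apply, Pi.smul_apply, smul_eq_mul, hwi i hi] at h2
    have hsδ : 0 < s * δ := mul_pos hs0 hδ0
    rcases hi.lt_or_gt with h | h
    · rw [show σ i = 1 by simp [σ, h.not_gt]] at h2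
      exact mul_neg_of_neg_of_pos h (by rw [Pi.sub_apply]; linarith)
    · rw [show σ i = -1 by simp [σ, h]] at h2
      exact mul_neg_of_pos_of_neg h (by rw [Pi.sub_apply]; linarith)
  have h1 := hμ _ (sub_mem_polyCone (p := p) (hrP (p + (s * δ) • v)))
  obtain ⟨i, hi⟩ := Function.ne_iff.1 hμ0
  refine h1.not_gt (Finset.sum_neg' (fun j _ => ?_) ⟨i, Finset.mem_univ i, hneg i hi⟩)
  by_cases hj : μ j = 0
  · simp [hj]
  · exact (hneg j hj).le

lemma polyCone_ne_univ {p : Fin n → ℝ} (hp : p ∈ polyhedron α c)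
    (hpi : p ∉ interior (polyhedron α c)) : polyCone α (activeSet α c p) ≠ univ := by
  intro h
  refine hpi (mem_interior_iff_mem_nhds.2 (Filter.eventually_all.2 fun i => ?_))
  by_cases hi : α i ⬝ᵥ p = c i
  · refine Filter.Eventually.of_forall fun x => ?_
    have h1 : x - p ∈ polyCone α (activeSet α c p) := h ▸ mem_univ _
    have h2 := h1 i (mem_activeSet.2 hi)
    rw [dotProduct_sub, hi] at h2
    linarith
  · exact (((continuous_dotProduct_right (α i)).tendsto p).eventually_const_lt
      (lt_of_le_of_ne (hp i) (Ne.symm hi))).mono fun x hx => le_of_lt hx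

/-- A rigid tangent cone at a boundary point has a one-sided peak direction. -/
lemma exists_one_sided_of_isRigid (hint : (interior (polyhedron α c)).Nonempty) {p : Fin n → ℝ}
    (hp : p ∈ polyhedron α c) (hpi : p ∉ interior (polyhedron α c))
    (hR : IsRigid (polyCone α (activeSet α c p))) :
    ∃ j, ¬(HasPeak (polyCone α (activeSet α c p)) j 1 ↔
      HasPeak (polyCone α (activeSet α c p)) j (-1)) := by
  by_contra! hsym
  obtain ⟨q, hq⟩ := hint
  have hw := sub_mem_interior_polyCone (p := p) hq
  obtain ⟨y, hy1, hy2, hys⟩ := exists_signAdmissible_nonpos (isWedge_polyCone α _) ⟨_, hw⟩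
    (polyCone_ne_univ hp hpi)
  have hy0 : -y = 0 := hR (-y) (fun x hx => by
      rw [neg_dotProduct]
      linarith [hy2 x hx]) fun i => by
    rw [Pi.neg_apply]
    exact ⟨fun h => (hsym i).1 ((hys i).2 (by linarith)),
      fun h => (hsym i).2 ((hys i).1 (by linarith))⟩
  have := hy1 _ hw
  rw [neg_eq_zero.1 hy0, zero_dotProduct] at this
  exact lt_irrefl _ this

end Retraction

/-- A convex polyhedron `P ⊊ l∞ⁿ` with nonempty interior is injective iff for every
boundary point `p`, the cone `K := T_p P - p` admits a facet `F` of `[-1,1]ⁿ` with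
`relint(F) ∩ K ≠ ∅` and `relint(-F) ∩ K = ∅`. -/
theorem convexPolyhedron_injective_iff_facets {n : ℕ} (P : Set (Fin n → ℝ))
    (hP : IsConvexPolyhedron P) (hne : P ≠ univ) (hint : (interior P).Nonempty) :
    IsInjectiveSubset P ↔
      ∀ p ∈ frontier P, ∃ (j : Fin n) (τ : ℝ), (τ = 1 ∨ τ = -1) ∧
        (intrinsicInterior ℝ (cubeFacet j τ) ∩ ((fun x => x - p) '' tangentCone P p)).Nonempty ∧
        intrinsicInterior ℝ (cubeFacet j (-τ)) ∩ ((fun x => x - p) '' tangentCone P p) = ∅ := by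
  obtain ⟨m, α, c, -, hPeq⟩ := hP
  obtain rfl : P = polyhedron α c := by
    rw [hPeq]
    ext x
    simp [polyhedron, dotProduct]
  have hclosed := isClosed_polyhedron α c
  have hfacet : ∀ p ∈ polyhedron α c, (∃ (j : Fin n) (τ : ℝ), (τ = 1 ∨ τ = -1) ∧
      (intrinsicInterior ℝ (cubeFacet j τ) ∩
        ((fun x => x - p) '' tangentCone (polyhedron α c) p)).Nonempty ∧
      intrinsicInterior ℝ (cubeFacet j (-τ)) ∩
        ((fun x => x - p) '' tangentCone (polyhedron α c) p) = ∅) ↔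
      ∃ j, ¬(HasPeak (polyCone α (activeSet α c p)) j 1 ↔
        HasPeak (polyCone α (activeSet α c p)) j (-1)) := by
    intro p hp
    have hW := isWedge_polyCone α (activeSet α c p)
    rw [image_sub_tangentCone hp]
    refine exists_congr fun j => ?_
    simp only [← not_nonempty_iff_eq_empty]
    constructor
    · rintro ⟨τ, hτ, h1, h2⟩
      have hτ' : -τ = 1 ∨ -τ = -1 := by rcases hτ with rfl | rfl <;> simp
      rw [hW.facet_inter_nonempty hτ] at h1
      rw [hW.facet_inter_nonempty hτ'] at h2
      rcases hτ with rfl | rfl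
      · tauto
      · rw [neg_neg] at h2
        tauto
    · intro h
      by_cases h1 : HasPeak (polyCone α (activeSet α c p)) j 1
      · refine ⟨1, Or.inl rfl, (hW.facet_inter_nonempty (Or.inl rfl)).2 h1, ?_⟩
        rw [hW.facet_inter_nonempty (Or.inr rfl)]
        tauto
      · refine ⟨-1, Or.inr rfl, (hW.facet_inter_nonempty (Or.inr rfl)).2 (by tauto), ?_⟩
        rwa [neg_neg, hW.facet_inter_nonempty (Or.inl rfl)]
  rw [isInjectiveSubset_iff_exists_retraction]
  constructor
  · rintro ⟨r, hr, hrP, hri⟩ p hp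
    have hpP := hclosed.frontier_subset hp
    exact (hfacet p hpP).2
      (exists_one_sided_of_isRigid hint hpP hp.2 (isRigid_of_retraction hr hrP hri hpP))
  · intro h
    have hR : ∀ p ∈ polyhedron α c, IsRigid (polyCone α (activeSet α c p)) := fun p hp =>
      isRigid_of_forall_frontier hint
        (fun p hp => (hfacet p (hclosed.frontier_subset hp)).1 (h p hp)) hp
    exact exists_lipschitz_retraction hclosed (hint.mono interior_subset)
      (exists_mem_forall_dist_le hint hR)
end

section
/- Let C ⊂ l∞^n be a convex polyhedral cone with nonempty interior and 0 ≤ k := dim(apex(C)) < n. Define Δ(a,γ) for a ∈ apex(C) and γ ∈ (0,∞) as the minimum over all P ∈ 𝓘_k and all nonempty faces F of P with F ∩ apex(C) = ∅ of d(γF + a, apex(C)) (with the inner minimum equal to ∞ when P has no such face). Then Δ(0,1) is finite and strictly positive, and for every p ∈ K_C with η := d(p, apex(C)) > 0 there exist ā ∈ apex(C), γ̄ ∈ [η,∞), P ∈ 𝓘_k and a nonempty face F of P with F ∩ apex(C) = ∅ such that, setting F_p := γ̄F + ā: (i) p ∈ F_p; (ii) d(F_p, apex(C)) ≥ Δ(ā,γ̄)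 = γ̄·Δ(0,1) ≥ η·Δ(0,1) > 0; and (iii) for every set X with C ⊂ X ⊂ l∞^n and every 1-Lipschitz retraction r : l∞^n → X (i.e. r is 1-Lipschitz with r|_X = id_X), one has r(F_p) ⊂ F_p. -/
open Set Metric Pointwise

/-- The cone `C_j = {x : x_j = ‖x‖∞}`. -/
def coneCj {n : ℕ} (j : Fin n) : Set (Fin n → ℝ) :=
  {x | x j = ‖x‖}

/-- The family `𝒞 = {C_j : j} ∪ {-C_j : j}`. -/
def lInfConesFam (n : ℕ) : Set (Set (Fin n → ℝ)) :=
  {S | ∃ j : Fin n, S = coneCj j ∨ S = -coneCj j}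

/-- The family `𝒮_C = {C' ∈ 𝒞 : int(C') ∩ C = ∅}`. -/
def avoidedCones {n : ℕ} (C : Set (Fin n → ℝ)) : Set (Set (Fin n → ℝ)) :=
  {S | S ∈ lInfConesFam n ∧ interior S ∩ C = ∅}

/-- The cone `K_C = ⋂_{a ∈ apex(C)} ⋃_{C' ∈ 𝒞 ∖ 𝒮_C} (a + C')`. -/
def KCone {n : ℕ} (C : Set (Fin n → ℝ)) : Set (Fin n → ℝ) :=
  ⋂ a ∈ apexSet C, ⋃ S ∈ lInfConesFam n \ avoidedCones C, (fun y => a + y) '' S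

/-- The cube `[-1,1]ⁿ`. -/
def cubeSet (n : ℕ) : Set (Fin n → ℝ) :=
  {x | ∀ i, -1 ≤ x i ∧ x i ≤ 1}

/-- The family `𝓘_k` of polytopes `[-1,1]ⁿ ∩ ⋂_{j=1}^k (T_{pʲ}F_j - pʲ)` where each `F_j`
is a facet of the cube and `pʲ ∈ F_j` (for `k = 0` this is just the cube itself). -/
def familyI (n k : ℕ) : Set (Set (Fin n → ℝ)) :=
  {P | ∃ (j : Fin k → Fin n) (τ : Fin k → ℝ) (p : Fin k → (Fin n → ℝ)),
    (∀ l, τ l = 1 ∨ τ l = -1) ∧ (∀ l, p l ∈ cubeFacet (j l) (τ l)) ∧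
    P = cubeSet n ∩ ⋂ l, (fun x => x - p l) '' tangentCone (cubeFacet (j l) (τ l)) (p l)}

/-- The distance `d(A,B) = inf {‖a - b‖∞ : a ∈ A, b ∈ B}` between two sets, with value
`∞` for the infimum of the empty family. -/
noncomputable def setEDist {n : ℕ} (A B : Set (Fin n → ℝ)) : ENNReal :=
  ⨅ a ∈ A, ⨅ b ∈ B, edist a b

/-- `Δ(a,γ)`: the minimum over all `P ∈ 𝓘_k` and all nonempty faces `F` of `P` disjoint
from `apex(C)` of `d(γF + a, apex(C))` (equal to `∞` when there is no such `P` and `F`). -/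
noncomputable def deltaFun {n : ℕ} (C : Set (Fin n → ℝ)) (k : ℕ)
    (a : Fin n → ℝ) (γ : ℝ) : ENNReal :=
  ⨅ P ∈ familyI n k, ⨅ F : Set (Fin n → ℝ), ⨅ _ : IsExposed ℝ P F,
    ⨅ _ : F.Nonempty, ⨅ _ : F ∩ apexSet C = ∅,
      setEDist ((fun x => a + γ • x) '' F) (apexSet C)

lemma eventually_add_mul_abs_lt {n : ℕ} {v : Fin n → ℝ} (hv : ∀ i, |v i| ≤ 1) (R : ℝ) :
    ∀ᶠ t : ℝ in Filter.atTop, ∀ i, |v i| ≠ 1 → R + t * |v i| < t := by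
  rw [Filter.eventually_all]
  intro i
  by_cases h : |v i| = 1
  · simp [h]
  · have h1 : 0 < 1 - |v i| := sub_pos.2 (lt_of_le_of_ne (hv i) h)
    filter_upwards [(Filter.tendsto_id.atTop_mul_const h1).eventually_gt_atTop R] with t ht _
    simp only [id] at ht
    linarith

lemma exists_norm_eq_one_forall_abs_eq {n : ℕ} (W : Submodule ℝ (Fin n → ℝ)) (hW : W ≠ ⊥) :
    ∃ v ∈ W, ‖v‖ = 1 ∧ ∀ i j, |v i| = |v j| → ∀ x ∈ W, v i * x i = v j * x j := by
  classical
  let f : Fin n × Fin n × Bool → (W →ₗ[ℝ] ℝ) := fun q =>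
    (LinearMap.proj q.1 - (bif q.2.2 then (1 : ℝ) else -1) • LinearMap.proj q.2.1) ∘ₗ W.subtype
  let s : Finset (Subspace ℝ W) :=
    insert ⊥ ((Finset.univ.image fun q => LinearMap.ker (f q)).filter (· ≠ ⊤))
  have hs : (⊤ : Subspace ℝ W) ∉ s := by
    have : (⊥ : Submodule ℝ W) ≠ ⊤ := by
      intro h
      apply hW
      have h2 := congrArg (Submodule.map W.subtype) h
      simpa using h2.symm
    simp [s, this.symm]
  have hne := Subspace.biUnion_ne_univ_of_top_notMem hs
  obtain ⟨w, hw⟩ := (Set.ne_univ_iff_exists_notMem _).1 hne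
  simp only [Set.mem_iUnion, not_exists] at hw
  have hw0 : (w : Fin n → ℝ) ≠ 0 := by
    intro h
    exact hw ⊥ (by simp [s]) (by simpa using h)
  have hgen : ∀ q, f q w = 0 → ∀ x, f q x = 0 := by
    intro q hq x
    by_contra hx
    refine hw (LinearMap.ker (f q)) ?_ (by simpa using hq)
    simp only [s, Finset.mem_insert, Finset.mem_filter, Finset.mem_image, Finset.mem_univ, true_and]
    refine Or.inr ⟨⟨q, rfl⟩, fun h => hx ?_⟩
    have : x ∈ LinearMap.ker (f q) := by rw [h]; trivial
    simpa using this
  have hn : ‖(w : Fin n → ℝ)‖ ≠ 0 := norm_ne_zero_iff.2 hw0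
  refine ⟨‖(w : Fin n → ℝ)‖⁻¹ • (w : Fin n → ℝ), W.smul_mem _ w.2, ?_, ?_⟩
  · rw [norm_smul, norm_inv, norm_norm, inv_mul_cancel₀ hn]
  · intro i j hij x hx
    simp only [Pi.smul_apply, smul_eq_mul, abs_mul] at hij ⊢
    have hij' : |(w : Fin n → ℝ) i| = |(w : Fin n → ℝ) j| :=
      mul_left_cancel₀ (abs_ne_zero.2 (inv_ne_zero hn)) hij
    rw [mul_assoc, mul_assoc]
    congr 1
    rcases abs_eq_abs.1 hij' with h | h
    · have := hgen (i, j, true) (by simp [f, h]) ⟨x, hx⟩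
      have : x i = x j := by simpa [f, sub_eq_zero] using this
      rw [h, this]
    · have := hgen (i, j, false) (by simp [f, h]) ⟨x, hx⟩
      have : x i + x j = 0 := by simpa [f] using this
      rw [h, eq_neg_of_add_eq_zero_left this]
      ring

lemma exists_abs_eq_norm {n : ℕ} (x : Fin n → ℝ) (hn : 0 < n) : ∃ i, |x i| = ‖x‖ := by
  have : Nonempty (Fin n) := ⟨⟨0, hn⟩⟩
  obtain ⟨i, hi⟩ := Finite.exists_max fun i => |x i|
  refine ⟨i, le_antisymm (norm_le_pi_norm x i) ?_⟩
  exact (pi_norm_le_iff_of_nonneg (abs_nonneg _)).2 hi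

/-- If every translate of `p` by a vector of `W` attains its norm at a signed coordinate in `N`,
then for every unit vector `v ∈ W` some signed coordinate in `N` at which `v` attains its norm
maximises `i ↦ v i * p i` among all such coordinates. -/
lemma exists_mem_max_on_norming_coords {n : ℕ} {W : Submodule ℝ (Fin n → ℝ)}
    {N : Set (ℝ × Fin n)} (hN : ∀ q ∈ N, q.1 = 1 ∨ q.1 = -1) {p : Fin n → ℝ}
    (hp : ∀ a ∈ W, ∃ q ∈ N, q.1 * (p - a) q.2 = ‖p - a‖) {v : Fin n → ℝ} (hv : v ∈ W)
    (hv1 : ‖v‖ = 1) :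
    ∃ j, (v j, j) ∈ N ∧ |v j| = 1 ∧ ∀ i, |v i| = 1 → v i * p i ≤ v j * p j := by
  have hvle : ∀ i, |v i| ≤ 1 := fun i => hv1 ▸ norm_le_pi_norm v i
  obtain ⟨t, ht, ht0⟩ := ((eventually_add_mul_abs_lt hvle (2 * ‖p‖)).and
    (Filter.eventually_gt_atTop ‖p‖)).exists
  have hpos : 0 ≤ ‖p‖ := norm_nonneg p
  obtain ⟨⟨σ, j⟩, hq, hqe⟩ := hp (-(t • v)) (W.neg_mem (W.smul_mem t hv))
  rw [sub_neg_eq_add] at hqe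
  simp only [Pi.add_apply, Pi.smul_apply, smul_eq_mul] at hqe
  have hlow : t - ‖p‖ ≤ ‖p + t • v‖ := by
    have h1 : ‖t • v‖ = t := by rw [norm_smul, hv1, Real.norm_of_nonneg (by linarith), mul_one]
    have h2 := norm_sub_le (p + t • v) p
    rw [add_sub_cancel_left, h1] at h2
    linarith
  have hpj := abs_le.1 (norm_le_pi_norm p j : |p j| ≤ ‖p‖)
  have hσ : σ = 1 ∨ σ = -1 := hN _ hq
  have hj1 : |v j| = 1 := by
    by_contra hne
    have h3 := ht j hne
    have h4 : σ * (t * v j) ≤ t * |v j| := by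
      have := mul_le_mul_of_nonneg_left (le_abs_self (v j)) (by linarith : 0 ≤ t)
      have := mul_le_mul_of_nonneg_left (neg_abs_le (v j)) (by linarith : 0 ≤ t)
      rcases hσ with rfl | rfl <;> linarith
    rcases hσ with rfl | rfl <;> linarith
  have hσv : σ = v j := by
    rcases hσ with rfl | rfl <;> rcases eq_or_eq_neg_of_abs_eq hj1 with h | h <;> rw [h] at hqe ⊢
    all_goals first | rfl | (exfalso; linarith)
  subst hσv
  refine ⟨j, hq, hj1, fun i hi => ?_⟩
  have hsq : ∀ i, |v i| = 1 → v i * v i = 1 := fun i hi => by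
    rw [← abs_mul_abs_self, hi, one_mul]
  have h4 : |(p + t • v) i| ≤ ‖p + t • v‖ := norm_le_pi_norm (p + t • v) i
  have h5 : v i * (p + t • v) i ≤ ‖p + t • v‖ := by
    refine (le_abs_self _).trans ?_
    rwa [abs_mul, hi, one_mul]
  simp only [Pi.add_apply, Pi.smul_apply, smul_eq_mul] at h5
  rw [← hqe] at h5
  have e1 : v i * (p i + t * v i) = v i * p i + t := by linear_combination t * hsq i hi
  have e2 : v j * (p j + t * v j) = v j * p j + t := by linear_combination t * hsq j hj1
  linarith

/-- The data of a polytope of `𝓘_m`, `m = dim W`, whose base points lie in `W` and whose zero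
coordinates determine the points of `W`, centred at a suitable point `a ∈ W`. -/
lemma exists_centre_and_facets {n : ℕ} {N : Set (ℝ × Fin n)}
    (hN : ∀ q ∈ N, q.1 = 1 ∨ q.1 = -1) (m : ℕ) :
    ∀ (W : Submodule ℝ (Fin n → ℝ)) (p : Fin n → ℝ), Module.finrank ℝ W = m →
      (∀ a ∈ W, ∃ q ∈ N, q.1 * (p - a) q.2 = ‖p - a‖) →
      ∃ a ∈ W, ∃ (j : Fin m → Fin n) (v : Fin m → (Fin n → ℝ)),
        (∀ l, (v l (j l), j l) ∈ N ∧ v l ∈ W ∧ ‖v l‖ = 1 ∧ (p - a) (j l) = 0 ∧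
          ∀ i, |v l i| = 1 → v l i * (p - a) i ≤ 0) ∧
        ∀ x ∈ W, (∀ l, x (j l) = 0) → x = 0 := by
  induction m with
  | zero =>
    intro W p hW _
    have hbot : W = ⊥ := Submodule.finrank_eq_zero.1 hW
    exact ⟨0, W.zero_mem, Fin.elim0, Fin.elim0, fun l => l.elim0,
      fun x hx _ => by simpa [hbot] using hx⟩
  | succ m ih =>
    intro W p hW hp
    have hbot : W ≠ ⊥ := by
      rintro rfl
      simp at hW
    obtain ⟨v, hv, hv1, hvt⟩ := exists_norm_eq_one_forall_abs_eq W hbot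
    obtain ⟨j, hjN, hj1, hmax⟩ := exists_mem_max_on_norming_coords hN hp hv hv1
    have hsq : ∀ i, |v i| = 1 → v i * v i = 1 := fun i hi => by
      rw [← abs_mul_abs_self, hi, one_mul]
    let f : Module.Dual ℝ W := LinearMap.proj j ∘ₗ W.subtype
    have hf : f ≠ 0 := by
      intro h
      have : v j = 0 := by simpa [f] using LinearMap.congr_fun h ⟨v, hv⟩
      rw [this, abs_zero] at hj1
      exact zero_ne_one hj1
    let W' := (LinearMap.ker f).map W.subtype
    have hmem : ∀ x, x ∈ W' ↔ x ∈ W ∧ x j = 0 := by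
      intro x
      simp [W', f, and_comm]
    have hW' : Module.finrank ℝ W' = m := by
      have h1 := Module.Dual.finrank_ker_add_one_of_ne_zero hf
      have h2 : Module.finrank ℝ W' = Module.finrank ℝ (LinearMap.ker f) :=
        Submodule.finrank_map_subtype_eq W _
      omega
    have hs : (v j * p j) • v ∈ W := W.smul_mem _ hv
    obtain ⟨a, ha, js, vs, hjv, hdet⟩ := ih W' (p - (v j * p j) • v) hW' (fun a ha => by
      rw [sub_sub]
      exact hp _ (W.add_mem hs ((hmem a).1 ha).1))
    obtain ⟨haW, haj⟩ := (hmem a).1 ha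
    refine ⟨(v j * p j) • v + a, W.add_mem hs haW, Fin.cons j js, Fin.cons v vs, ?_, ?_⟩
    · rw [← sub_sub]
      refine Fin.cases ?_ fun l => ?_
      · refine ⟨hjN, hv, hv1, ?_, fun i hi => ?_⟩
        · simp only [Fin.cons_zero, Pi.sub_apply, Pi.smul_apply, smul_eq_mul, haj]
          linear_combination -(p j) * hsq j hj1
        · have h1 := hvt i j (hi.trans hj1.symm) a haW
          rw [haj, mul_zero] at h1
          have h2 := hmax i hi
          simp only [Fin.cons_zero, Pi.sub_apply, Pi.smul_apply, smul_eq_mul] at hi ⊢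
          have h3 : v i * (p i - v j * p j * v i - a i) = v i * p i - v j * p j := by
            linear_combination -(v j * p j) * hsq i hi - h1
          linarith
      · obtain ⟨h1, h2, h3⟩ := hjv l
        exact ⟨h1, ((hmem _).1 h2).1, h3⟩
    · intro x hx h
      exact hdet x ((hmem x).2 ⟨hx, by simpa using h 0⟩) fun l => by simpa using h l.succ

lemma mem_image_sub_tangentCone_cubeFacet {n : ℕ} {j : Fin n} {τ : ℝ} {p : Fin n → ℝ}
    (hp : p ∈ cubeFacet j τ) (x : Fin n → ℝ) :
    x ∈ (fun y => y - p) '' tangentCone (cubeFacet j τ) p ↔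
      x j = 0 ∧ ∀ i, |p i| = 1 → p i * x i ≤ 0 := by
  obtain ⟨hpj, hp1⟩ := hp
  have hple : ∀ i, |p i| ≤ 1 := fun i => abs_le.2 (hp1 i)
  constructor
  · rintro ⟨_, hz, rfl⟩
    obtain ⟨m, y, ⟨hyj, hy1⟩, rfl⟩ := Set.mem_iUnion.1 hz
    have hm : (0 : ℝ) ≤ m := m.cast_nonneg
    simp only [Pi.add_apply, add_sub_cancel_left, Pi.smul_apply, Pi.sub_apply, smul_eq_mul]
    refine ⟨by rw [hyj, hpj, sub_self, mul_zero], fun i hi => ?_⟩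
    rw [mul_left_comm]
    refine mul_nonpos_of_nonneg_of_nonpos hm ?_
    have := hy1 i
    rcases eq_or_eq_neg_of_abs_eq hi with h | h <;> rw [h] <;> linarith
  · rintro ⟨hxj, hx⟩
    obtain ⟨m, hm, hm0⟩ := ((tendsto_natCast_atTop_atTop.eventually
      ((eventually_add_mul_abs_lt hple ‖x‖).and
        (Filter.eventually_gt_atTop ‖x‖))).and (Filter.eventually_gt_atTop 0)).exists
    have hm0' : (0 : ℝ) < m := Nat.cast_pos.2 hm0
    refine ⟨p + x, Set.mem_iUnion.2 ⟨m, p + (m : ℝ)⁻¹ • x, ⟨?_, fun i => ?_⟩, ?_⟩, by simp⟩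
    · simp [hpj, hxj]
    · have hxi : |x i| ≤ ‖x‖ := norm_le_pi_norm x i
      have key : |m * p i + x i| ≤ m := by
        by_cases h : |p i| = 1
        · have h1 := hx i h
          have h2 := abs_le.1 hxi
          rw [abs_le]
          rcases eq_or_eq_neg_of_abs_eq h with h | h <;> rw [h] at h1 ⊢ <;>
            constructor <;> linarith [hm.2]
        · have h1 := hm.1 i h
          refine (abs_add_le _ _).trans ?_
          rw [abs_mul, abs_of_pos hm0']
          linarith
      have e : (p + (m : ℝ)⁻¹ • x) i = (m * p i + x i) / m := by
        simp only [Pi.add_apply, Pi.smul_apply, smul_eq_mul]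
        field_simp
      rw [e, ← abs_le, abs_div, abs_of_pos hm0']
      exact div_le_one_of_le₀ key hm0'.le
    · simp [smul_smul, hm0'.ne']

lemma mem_familyI_iff {n k : ℕ} {P : Set (Fin n → ℝ)} :
    P ∈ familyI n k ↔ ∃ (j : Fin k → Fin n) (τ : Fin k → ℝ) (p : Fin k → (Fin n → ℝ)),
      (∀ l, τ l = 1 ∨ τ l = -1) ∧ (∀ l, p l ∈ cubeFacet (j l) (τ l)) ∧
      P = {x | x ∈ cubeSet n ∧
        ∀ l, x (j l) = 0 ∧ ∀ i, |p l i| = 1 → p l i * x i ≤ 0} := by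
  unfold familyI
  simp only [Set.mem_ofPred_eq]
  refine exists_congr fun j => exists_congr fun τ => exists_congr fun p =>
    and_congr_right fun _ => and_congr_right fun hp => ?_
  have : cubeSet n ∩ ⋂ l, (fun x => x - p l) '' tangentCone (cubeFacet (j l) (τ l)) (p l) =
      {x | x ∈ cubeSet n ∧ ∀ l, x (j l) = 0 ∧ ∀ i, |p l i| = 1 → p l i * x i ≤ 0} := by
    ext x
    simp only [Set.mem_inter_iff, Set.mem_iInter, Set.mem_ofPred_eq,
      mem_image_sub_tangentCone_cubeFacet (hp _)]
  rw [this]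

lemma isExposed_sep_eq_one {n : ℕ} {P : Set (Fin n → ℝ)} (hP : P ⊆ cubeSet n) {σ : ℝ}
    (hσ : σ = 1 ∨ σ = -1) (i : Fin n) : IsExposed ℝ P {x ∈ P | σ * x i = 1} := by
  rintro ⟨z, hz, hz1⟩
  refine ⟨σ • ContinuousLinearMap.proj i, ?_⟩
  ext x
  simp only [Set.mem_ofPred_eq, smul_apply, ContinuousLinearMap.proj_apply,
    smul_eq_mul]
  have hle : ∀ y ∈ P, σ * y i ≤ 1 := fun y hy => by
    have := hP hy i
    rcases hσ with rfl | rfl <;> linarith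
  refine and_congr_right fun hx => ⟨fun h y hy => h ▸ hle y hy, fun h => ?_⟩
  exact le_antisymm (hle x hx) (hz1 ▸ h z hz)

/-- Every polytope of `𝓘_k` is an order interval with endpoints in `{-1, 0, 1}ⁿ`. -/
lemma exists_eq_Icc_of_mem_familyI {n k : ℕ} {P : Set (Fin n → ℝ)} (hP : P ∈ familyI n k) :
    ∃ a b : Fin n → SignType, P = Set.Icc (fun i => (a i : ℝ)) (fun i => (b i : ℝ)) := by
  classical
  obtain ⟨j, τ, p, -, -, rfl⟩ := mem_familyI_iff.1 hP
  refine ⟨fun i => if ∃ l, j l = i ∨ p l i = -1 then 0 else -1,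
    fun i => if ∃ l, j l = i ∨ p l i = 1 then 0 else 1, ?_⟩
  ext x
  simp only [Set.mem_ofPred_eq, Set.mem_Icc, Pi.le_def, cubeSet]
  constructor
  · rintro ⟨h1, h2⟩
    constructor <;> intro i <;> split_ifs with h
    · obtain ⟨l, rfl | h⟩ := h
      · simp [(h2 l).1]
      · have := (h2 l).2 i (by simp [h])
        rw [h] at this
        simpa using this
    · simpa using (h1 i).1
    · obtain ⟨l, rfl | h⟩ := h
      · simp [(h2 l).1]
      · have := (h2 l).2 i (by simp [h])
        rw [h] at this
        simpa using this
    · simpa using (h1 i).2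
  · rintro ⟨h1, h2⟩
    have lo : ∀ i l, (j l = i ∨ p l i = -1) → 0 ≤ x i := fun i l h => by
      simpa [if_pos (⟨l, h⟩ : ∃ l, j l = i ∨ p l i = -1)] using h1 i
    have hi : ∀ i l, (j l = i ∨ p l i = 1) → x i ≤ 0 := fun i l h => by
      simpa [if_pos (⟨l, h⟩ : ∃ l, j l = i ∨ p l i = 1)] using h2 i
    refine ⟨fun i => ⟨?_, ?_⟩, fun l => ⟨?_, fun i h => ?_⟩⟩
    · have := h1 i
      split_ifs at this <;> simp at this <;> linarith
    · have := h2 i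
      split_ifs at this <;> simp at this <;> linarith
    · exact le_antisymm (hi _ l (Or.inl rfl)) (lo _ l (Or.inl rfl))
    · rcases eq_or_eq_neg_of_abs_eq h with h | h <;> rw [h]
      · linarith [hi i l (Or.inr h)]
      · linarith [lo i l (Or.inr h)]

lemma IsExposed.exists_eq_Icc {n : ℕ} {a b : Fin n → SignType} {F : Set (Fin n → ℝ)}
    (hF : IsExposed ℝ (Set.Icc (fun i => (a i : ℝ)) (fun i => (b i : ℝ))) F)
    (hne : F.Nonempty) :
    ∃ c d : Fin n → SignType, F = Set.Icc (fun i => (c i : ℝ)) (fun i => (d i : ℝ)) := by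
  classical
  obtain ⟨l, hl⟩ := hF hne
  have hab : ∀ i, (a i : ℝ) ≤ b i := by
    obtain ⟨z, hz⟩ := hne
    rw [hl] at hz
    exact fun i => (hz.1.1 i).trans (hz.1.2 i)
  have hsum : ∀ x, l x = ∑ i, x i * l (Pi.single i 1) := fun x => by
    conv_lhs => rw [pi_eq_sum_univ' x]
    simp [map_sum]
  refine ⟨fun i => if 0 < l (Pi.single i 1) then b i else a i,
    fun i => if l (Pi.single i 1) < 0 then a i else b i, ?_⟩
  rw [hl]
  ext x
  simp only [Set.mem_ofPred_eq, Set.mem_Icc, Pi.le_def]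
  constructor
  · rintro ⟨⟨h1, h2⟩, h⟩
    have hupd : ∀ i (c : ℝ), (a i : ℝ) ≤ c → c ≤ b i → (c - x i) * l (Pi.single i 1) ≤ 0 := by
      intro i c hac hcb
      have h3 := h (x + (c - x i) • Pi.single i 1) (by
        constructor <;> intro i' <;> by_cases hi : i' = i
        · subst hi; simpa using hac
        · simpa [hi] using h1 i'
        · subst hi; simpa using hcb
        · simpa [hi] using h2 i')
      rw [map_add, map_smul, smul_eq_mul] at h3
      linarith
    constructor <;> intro i <;> split_ifs with hi
    · have := hupd i (b i) (hab i) le_rfl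
      nlinarith
    · exact h1 i
    · have := hupd i (a i) le_rfl (hab i)
      nlinarith
    · exact h2 i
  · rintro ⟨h1, h2⟩
    refine ⟨⟨fun i => le_trans ?_ (h1 i), fun i => (h2 i).trans ?_⟩, ?_⟩
    · split_ifs
      · exact hab i
      · exact le_rfl
    · split_ifs
      · exact hab i
      · exact le_rfl
    · rintro y ⟨hy1, hy2⟩
      rw [hsum, hsum x]
      refine Finset.sum_le_sum fun i _ => ?_
      have h1 := h1 i
      have h2 := h2 i
      rcases lt_trichotomy (l (Pi.single i 1)) 0 with hi | hi | hi
      · rw [if_pos hi] at h2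
        exact mul_le_mul_of_nonpos_right (h2.trans (hy1 i)) hi.le
      · simp [hi]
      · rw [if_pos hi] at h1
        exact mul_le_mul_of_nonneg_right ((hy2 i).trans h1) hi.le

lemma setEDist_pos_of_disjoint {n : ℕ} {A B : Set (Fin n → ℝ)} (hA : IsCompact A)
    (hB : IsClosed B) (h : A ∩ B = ∅) : 0 < setEDist A B := by
  obtain ⟨r, hr, hlt⟩ :=
    Metric.exists_pos_forall_lt_edist hA hB (Set.disjoint_iff_inter_eq_empty.2 h)
  refine (ENNReal.coe_pos.2 hr).trans_le ?_
  exact le_iInf₂ fun x hx => le_iInf₂ fun y hy => (hlt x hx y hy).le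

lemma deltaFun_zero_one_pos {n : ℕ} {C : Set (Fin n → ℝ)} (k : ℕ)
    (hC : IsClosed (apexSet C)) : 0 < deltaFun C k 0 1 := by
  have hbox : ∀ q : (Fin n → SignType) × (Fin n → SignType), ∃ ε : ENNReal, 0 < ε ∧
      (Set.Icc (fun i => (q.1 i : ℝ)) (fun i => (q.2 i : ℝ)) ∩ apexSet C = ∅ →
        ε ≤ setEDist (Set.Icc (fun i => (q.1 i : ℝ)) (fun i => (q.2 i : ℝ))) (apexSet C)) := by
    intro q
    by_cases h : Set.Icc (fun i => (q.1 i : ℝ)) (fun i => (q.2 i : ℝ)) ∩ apexSet C = ∅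
    · exact ⟨_, setEDist_pos_of_disjoint isCompact_Icc hC h, fun _ => le_rfl⟩
    · exact ⟨1, one_pos, fun h' => absurd h' h⟩
  choose ε hε hle using hbox
  obtain ⟨q₀, hq₀⟩ := Finite.exists_min ε
  refine (hε q₀).trans_le ?_
  refine le_iInf₂ fun P hP => le_iInf fun F => le_iInf fun hF => le_iInf₂ fun hne hdisj => ?_
  obtain ⟨a, b, rfl⟩ := exists_eq_Icc_of_mem_familyI hP
  obtain ⟨c, d, rfl⟩ := hF.exists_eq_Icc hne
  refine (hq₀ (c, d)).trans ?_
  simpa using hle (c, d) hdisj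

lemma setEDist_image_add_smul {n : ℕ} (V : Submodule ℝ (Fin n → ℝ)) {a : Fin n → ℝ}
    (ha : a ∈ V) {γ : ℝ} (hγ : 0 < γ) (F : Set (Fin n → ℝ)) :
    setEDist ((fun x => a + γ • x) '' F) V = ENNReal.ofReal γ * setEDist F V := by
  have h0 : ENNReal.ofReal γ ≠ 0 := (ENNReal.ofReal_pos.2 hγ).ne'
  have hdist : ∀ x y : Fin n → ℝ,
      edist (a + γ • x) (a + γ • y) = ENNReal.ofReal γ * edist x y := fun x y => by
    rw [edist_add_left, edist_smul₀, ENNReal.smul_def, smul_eq_mul, ← enorm_eq_nnnorm, ← ofReal_norm,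
      Real.norm_of_nonneg hγ.le]
  unfold setEDist
  simp only [ENNReal.mul_iInf_of_ne h0 ENNReal.ofReal_ne_top]
  rw [iInf_image]
  refine iInf_congr fun x => iInf_congr fun _ => ?_
  simp only [← hdist]
  refine le_antisymm (le_iInf₂ fun y hy => ?_) (le_iInf₂ fun y hy => ?_)
  · exact iInf₂_le _ (V.add_mem ha (V.smul_mem γ hy))
  · refine (iInf₂_le (γ⁻¹ • (y - a)) (V.smul_mem _ (V.sub_mem hy ha))).trans_eq ?_
    rw [smul_inv_smul₀ hγ.ne', add_sub_cancel]

lemma deltaFun_eq_mul {n : ℕ} {C : Set (Fin n → ℝ)} (k : ℕ) (V : Submodule ℝ (Fin n → ℝ))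
    (hV : (V : Set (Fin n → ℝ)) = apexSet C) {a : Fin n → ℝ} (ha : a ∈ V) {γ : ℝ} (hγ : 0 < γ) :
    deltaFun C k a γ = ENNReal.ofReal γ * deltaFun C k 0 1 := by
  have h0 : ENNReal.ofReal γ ≠ 0 := (ENNReal.ofReal_pos.2 hγ).ne'
  unfold deltaFun
  simp only [ENNReal.mul_iInf_of_ne h0 ENNReal.ofReal_ne_top, ← hV, setEDist_image_add_smul V ha hγ,
    setEDist_image_add_smul V V.zero_mem one_pos, ENNReal.ofReal_one, one_mul]

/-- `r` does not increase the Busemann functions `x ↦ max_{|v i| = 1} v i * x i`, `v ∈ V`. -/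
lemma mul_nonpos_of_nonexpansive {n : ℕ} {V : Submodule ℝ (Fin n → ℝ)}
    {r : (Fin n → ℝ) → (Fin n → ℝ)} (hr : ∀ x, ∀ c ∈ V, ‖r x - c‖ ≤ ‖x - c‖)
    {a v : Fin n → ℝ} (ha : a ∈ V) (hv : v ∈ V) (hv1 : ‖v‖ = 1) {x : Fin n → ℝ}
    (hx : ∀ i, |v i| = 1 → v i * (x - a) i ≤ 0) {i : Fin n} (hi : |v i| = 1) :
    v i * (r x - a) i ≤ 0 := by
  have hvle : ∀ i, |v i| ≤ 1 := fun i => hv1 ▸ norm_le_pi_norm v i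
  obtain ⟨t, ht, ht0⟩ := ((eventually_add_mul_abs_lt hvle ‖x - a‖).and
    (Filter.eventually_gt_atTop ‖x - a‖)).exists
  have ht0' : 0 ≤ t := (norm_nonneg _).trans ht0.le
  have h1 : ‖x - (a - t • v)‖ ≤ t := by
    rw [sub_sub_eq_add_sub, add_sub_right_comm, pi_norm_le_iff_of_nonneg ht0']
    intro l
    have h2 : |(x - a) l| ≤ ‖x - a‖ := norm_le_pi_norm (x - a) l
    rw [Pi.add_apply, Pi.smul_apply, smul_eq_mul, Real.norm_eq_abs]
    by_cases hl : |v l| = 1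
    · have h3 := hx l hl
      have h4 := abs_le.1 h2
      rw [abs_le]
      rcases eq_or_eq_neg_of_abs_eq hl with h | h <;> rw [h] at h3 ⊢ <;> constructor <;> linarith
    · refine (abs_add_le _ _).trans ?_
      rw [abs_mul, abs_of_nonneg ht0']
      linarith [ht l hl]
  have h2 := (norm_le_pi_norm _ i).trans ((hr x _ (V.sub_mem ha (V.smul_mem t hv))).trans h1)
  rw [sub_sub_eq_add_sub, add_sub_right_comm, Pi.add_apply, Pi.smul_apply, smul_eq_mul,
    Real.norm_eq_abs] at h2
  have h4 := abs_le.1 h2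
  rcases eq_or_eq_neg_of_abs_eq hi with h | h <;> rw [h] at h4 ⊢ <;> linarith

/-- Existence of a face through `p`, disjoint from `V`, which is stable under all maps that are
nonexpansive towards the points of `V` and do not decrease the signed coordinates in `N`. -/
lemma exists_stable_face {n : ℕ} (V : Submodule ℝ (Fin n → ℝ)) {N : Set (ℝ × Fin n)}
    (hN : ∀ q ∈ N, q.1 = 1 ∨ q.1 = -1) {p : Fin n → ℝ} (hpV : p ∉ V)
    (hp : ∀ a ∈ V, ∃ q ∈ N, q.1 * (p - a) q.2 = ‖p - a‖) :
    ∃ a ∈ V, ∃ P ∈ familyI n (Module.finrank ℝ V), ∃ F : Set (Fin n → ℝ),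
      IsExposed ℝ P F ∧ F.Nonempty ∧ F ∩ V = ∅ ∧ p ∈ (fun x => a + ‖p - a‖ • x) '' F ∧
      ∀ r : (Fin n → ℝ) → (Fin n → ℝ), (∀ x, ∀ c ∈ V, ‖r x - c‖ ≤ ‖x - c‖) →
        (∀ q ∈ N, ∀ x, q.1 * x q.2 ≤ q.1 * r x q.2) →
        r '' ((fun x => a + ‖p - a‖ • x) '' F) ⊆ (fun x => a + ‖p - a‖ • x) '' F := by
  obtain ⟨a, ha, j, v, hjv, hdet⟩ := exists_centre_and_facets hN _ V p rfl hp
  obtain ⟨⟨σ, i⟩, hqN, hq⟩ := hp a ha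
  have hσ := hN _ hqN
  simp only at hσ hq
  have hγ : 0 < ‖p - a‖ := norm_pos_iff.2 fun h => hpV (by rwa [sub_eq_zero.1 h])
  set γ := ‖p - a‖ with hγdef
  let P : Set (Fin n → ℝ) :=
    {x | x ∈ cubeSet n ∧ ∀ l, x (j l) = 0 ∧ ∀ i, |v l i| = 1 → v l i * x i ≤ 0}
  have hvle : ∀ l i, |v l i| ≤ 1 := fun l i => (hjv l).2.2.1 ▸ norm_le_pi_norm (v l) i
  have hP : P ∈ familyI n (Module.finrank ℝ V) :=
    mem_familyI_iff.2 ⟨j, fun l => v l (j l), v, fun l => hN _ (hjv l).1,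
      fun l => ⟨rfl, fun i => abs_le.1 (hvle l i)⟩, rfl⟩
  have hcube : P ⊆ cubeSet n := fun x hx => hx.1
  have hmem : ∀ y, y ∈ (fun x => a + γ • x) '' {x ∈ P | σ * x i = 1} ↔
      ‖y - a‖ ≤ γ ∧ (∀ l, (y - a) (j l) = 0 ∧ ∀ i, |v l i| = 1 → v l i * (y - a) i ≤ 0) ∧
        σ * (y - a) i = γ := by
    intro y
    constructor
    · rintro ⟨x, ⟨⟨hx1, hx2⟩, hx3⟩, rfl⟩
      simp only [add_sub_cancel_left, Pi.smul_apply, smul_eq_mul]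
      refine ⟨?_, fun l => ⟨by rw [(hx2 l).1, mul_zero], fun i' hi' => ?_⟩, ?_⟩
      · rw [norm_smul, Real.norm_of_nonneg hγ.le]
        refine mul_le_of_le_one_right hγ.le ((pi_norm_le_iff_of_nonneg zero_le_one).2 fun i => ?_)
        exact abs_le.2 (hx1 i)
      · rw [mul_left_comm]
        exact mul_nonpos_of_nonneg_of_nonpos hγ.le ((hx2 l).2 i' hi')
      · rw [mul_left_comm, hx3, mul_one]
    · rintro ⟨hy1, hy2, hy3⟩
      refine ⟨γ⁻¹ • (y - a), ⟨⟨fun l => abs_le.1 ?_, fun l => ⟨?_, fun i' hi' => ?_⟩⟩, ?_⟩, ?_⟩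
      · refine (norm_le_pi_norm (γ⁻¹ • (y - a)) l).trans ?_
        rw [norm_smul, norm_inv, Real.norm_of_nonneg hγ.le]
        exact inv_mul_le_one_of_le₀ hy1 hγ.le
      · rw [Pi.smul_apply, (hy2 l).1, smul_zero]
      · rw [Pi.smul_apply, smul_eq_mul, mul_left_comm]
        exact mul_nonpos_of_nonneg_of_nonpos (inv_nonneg.2 hγ.le) ((hy2 l).2 i' hi')
      · rw [Pi.smul_apply, smul_eq_mul, mul_left_comm, hy3, inv_mul_cancel₀ hγ.ne']
      · simp [smul_inv_smul₀ hγ.ne']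
  have hpF : p ∈ (fun x => a + γ • x) '' {x ∈ P | σ * x i = 1} :=
    (hmem p).2 ⟨le_rfl, fun l => (hjv l).2.2.2, hq⟩
  refine ⟨a, ha, P, hP, {x ∈ P | σ * x i = 1}, isExposed_sep_eq_one hcube hσ i,
    Set.image_nonempty.1 ⟨p, hpF⟩, ?_, hpF, ?_⟩
  · refine Set.eq_empty_of_forall_notMem ?_
    rintro x ⟨⟨⟨-, hx⟩, hx1⟩, hxV⟩
    rw [hdet x hxV fun l => (hx l).1, Pi.zero_apply, mul_zero] at hx1
    exact zero_ne_one hx1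
  · rintro r hrV hrN _ ⟨y, hy, rfl⟩
    obtain ⟨hy1, hy2, hy3⟩ := (hmem y).1 hy
    have hle : ‖r y - a‖ ≤ γ := (hrV y a ha).trans hy1
    refine (hmem _).2 ⟨hle, fun l => ?_, ?_⟩
    · obtain ⟨h1, h2, h3, -⟩ := hjv l
      have hr : ∀ i, |v l i| = 1 → v l i * (r y - a) i ≤ 0 := fun i hi =>
        mul_nonpos_of_nonexpansive hrV ha h2 h3 (hy2 l).2 hi
      refine ⟨?_, hr⟩
      have h4 := hrN _ h1 y
      have h5 := hN _ h1
      have h6 := (hy2 l).1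
      simp only [Pi.sub_apply] at h4 h5 h6 hr ⊢
      have h7 := hr (j l) (by rcases h5 with h | h <;> simp [h])
      rcases h5 with h | h <;> rw [h] at h4 h7 <;> linarith
    · have h1 := abs_le.1 ((norm_le_pi_norm (r y - a) i).trans hle)
      have h2 := hrN _ hqN y
      simp only [Pi.sub_apply] at h1 h2 hy3 ⊢
      rcases hσ with rfl | rfl <;> linarith

lemma IsConvexPolyhedron.convex {n : ℕ} {C : Set (Fin n → ℝ)} (hC : IsConvexPolyhedron C) :
    Convex ℝ C := by
  obtain ⟨m, ν, c, -, rfl⟩ := hC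
  refine convex_iInter fun i => convex_halfSpace_ge ⟨fun x y => ?_, fun t x => ?_⟩ (c i)
  · simp [mul_add, Finset.sum_add_distrib]
  · simp [Finset.mul_sum, mul_left_comm]

/-- The apex of a convex cone as a subspace. -/
def apexSubmodule {n : ℕ} (C : Set (Fin n → ℝ)) (hconv : Convex ℝ C) (hcone : IsCone C)
    (hne : C.Nonempty) : Submodule ℝ (Fin n → ℝ) where
  carrier := apexSet C
  zero_mem' := by
    obtain ⟨x, hx⟩ := hne
    have : (0 : Fin n → ℝ) ∈ C := by simpa using hcone x hx 0 le_rfl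
    exact ⟨this, by simpa using this⟩
  add_mem' := by
    have hadd : ∀ x ∈ C, ∀ y ∈ C, x + y ∈ C := fun x hx y hy => by
      have := hcone _ (hconv hx hy (a := 1 / 2) (b := 1 / 2) (by norm_num) (by norm_num)
        (by norm_num)) 2 (by norm_num)
      simpa [smul_smul] using this
    rintro x y ⟨hx, hx'⟩ ⟨hy, hy'⟩
    exact ⟨hadd x hx y hy, by rw [neg_add]; exact hadd _ hx' _ hy'⟩
  smul_mem' := by
    rintro t x ⟨hx, hx'⟩
    rcases le_total 0 t with ht | ht
    · exact ⟨hcone x hx t ht, by rw [← smul_neg]; exact hcone _ hx' t ht⟩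
    · refine ⟨?_, by rw [← neg_smul]; exact hcone x hx (-t) (neg_nonneg.2 ht)⟩
      rw [← neg_smul_neg]
      exact hcone _ hx' (-t) (neg_nonneg.2 ht)

/-- The signed coordinates `(σ, j)`, `σ = ±1`, for which `C` contains a point `c` such that
`σ * c j` strictly dominates all other `|c i|`. -/
def dominatedCoords {n : ℕ} (C : Set (Fin n → ℝ)) : Set (ℝ × Fin n) :=
  {q | (q.1 = 1 ∨ q.1 = -1) ∧ ∃ c ∈ C, ∃ ε > 0, ε ≤ q.1 * c q.2 ∧
    ∀ i ≠ q.2, |c i| ≤ q.1 * c q.2 - ε}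

lemma mem_dominatedCoords {n : ℕ} {C : Set (Fin n → ℝ)} {σ : ℝ} (hσ : σ = 1 ∨ σ = -1)
    {j : Fin n} (h : (interior {x : Fin n → ℝ | σ * x j = ‖x‖} ∩ C).Nonempty) :
    (σ, j) ∈ dominatedCoords C := by
  obtain ⟨c, hc, hcC⟩ := h
  obtain ⟨ε, hε, hball⟩ := Metric.isOpen_iff.1 isOpen_interior c hc
  have hσσ : σ * σ = 1 := by rcases hσ with rfl | rfl <;> norm_num
  have hσ1 : |σ| = 1 := by rcases hσ with rfl | rfl <;> norm_num
  have hmem : c - Pi.single j (ε / 2 * σ) ∈ {x : Fin n → ℝ | σ * x j = ‖x‖} := by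
    refine interior_subset (hball ?_)
    rw [mem_ball_iff_norm, sub_sub_cancel_left, norm_neg, Pi.norm_single, norm_mul,
      Real.norm_eq_abs σ, hσ1, Real.norm_of_nonneg (by positivity)]
    linarith
  simp only [Set.mem_ofPred_eq, Pi.sub_apply, Pi.single_eq_same, mul_sub] at hmem
  have e : σ * (ε / 2 * σ) = ε / 2 := by linear_combination ε / 2 * hσσ
  rw [e] at hmem
  refine ⟨hσ, c, hcC, ε / 2, by positivity, ?_, fun i hi => ?_⟩
  · exact sub_nonneg.1 (hmem ▸ norm_nonneg _)
  · have := norm_le_pi_norm (c - Pi.single j (ε / 2 * σ)) i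
    rw [← hmem, Pi.sub_apply, Pi.single_eq_of_ne hi, sub_zero] at this
    exact this

lemma exists_dominatedCoords_of_mem_KCone {n : ℕ} {C : Set (Fin n → ℝ)} {p a : Fin n → ℝ}
    (hp : p ∈ KCone C) (ha : a ∈ apexSet C) :
    ∃ q ∈ dominatedCoords C, q.1 * (p - a) q.2 = ‖p - a‖ := by
  simp only [KCone, Set.mem_iInter, Set.mem_iUnion] at hp
  obtain ⟨S, ⟨⟨j, hS⟩, hav⟩, y, hy, rfl⟩ := hp a ha
  have hne : (interior S ∩ C).Nonempty :=
    Set.nonempty_iff_ne_empty.2 fun h => hav ⟨⟨j, hS⟩, h⟩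
  simp only [add_sub_cancel_left]
  rcases hS with rfl | rfl
  · exact ⟨(1, j), mem_dominatedCoords (Or.inl rfl) (by simpa [coneCj] using hne),
      by simpa [coneCj] using hy⟩
  · have e : -coneCj j = {x : Fin n → ℝ | (-1) * x j = ‖x‖} := by
      ext x
      simp [coneCj]
    rw [e] at hne hy
    exact ⟨(-1, j), mem_dominatedCoords (Or.inr rfl) hne, hy⟩

/-- `r` does not increase the Busemann function `x ↦ -(σ * x j)`. -/
lemma mul_le_mul_of_mem_dominatedCoords {n : ℕ} {C : Set (Fin n → ℝ)} (hcone : IsCone C)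
    {r : (Fin n → ℝ) → (Fin n → ℝ)} (hr : ∀ x, ∀ c ∈ C, ‖r x - c‖ ≤ ‖x - c‖)
    {q : ℝ × Fin n} (hq : q ∈ dominatedCoords C) (x : Fin n → ℝ) :
    q.1 * x q.2 ≤ q.1 * r x q.2 := by
  obtain ⟨σ, j⟩ := q
  obtain ⟨hσ, c, hc, ε, hε, hεj, hother⟩ := hq
  simp only at hσ hεj hother ⊢
  have hxj := abs_le.1 (norm_le_pi_norm x j)
  have hx0 := norm_nonneg x
  set t := 2 * ‖x‖ / ε with ht
  have ht0 : 0 ≤ t := by positivity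
  have htε : t * ε = 2 * ‖x‖ := div_mul_cancel₀ _ hε.ne'
  have hmain := mul_le_mul_of_nonneg_left hεj ht0
  have h1 : ‖x - t • c‖ ≤ t * (σ * c j) - σ * x j := by
    have hb : -‖x‖ ≤ -(σ * x j) := by rcases hσ with rfl | rfl <;> linarith
    refine (pi_norm_le_iff_of_nonneg (by linarith)).2 fun i => ?_
    rw [Pi.sub_apply, Pi.smul_apply, smul_eq_mul, Real.norm_eq_abs]
    by_cases hi : i = j
    · subst hi
      rw [abs_le]
      rcases hσ with rfl | rfl <;> constructor <;> linarith
    · have h2 := mul_le_mul_of_nonneg_left (hother i hi) ht0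
      have h3 : |x i| ≤ ‖x‖ := norm_le_pi_norm x i
      refine (abs_sub _ _).trans ?_
      rw [abs_mul, abs_of_nonneg ht0]
      linarith
  have h2 := abs_le.1 ((norm_le_pi_norm _ j).trans ((hr x _ (hcone c hc t ht0)).trans h1))
  rw [Pi.sub_apply, Pi.smul_apply, smul_eq_mul] at h2
  rcases hσ with rfl | rfl <;> linarith

/-- Lemma on the stable faces `F_p = γ̄ F + ā`: `Δ(0,1)` is finite and positive, and every
`p ∈ K_C` at positive distance `η` from `apex(C)` lies in a set `F_p = γ̄ F + ā` (`F` a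
nonempty face of some `P ∈ 𝓘_k` disjoint from the apex, `ā ∈ apex(C)`, `γ̄ ≥ η`) with
`d(F_p, apex(C)) ≥ Δ(ā,γ̄) = γ̄ Δ(0,1) ≥ η Δ(0,1) > 0`, and `F_p` is stable under every
`1`-Lipschitz retraction of `l∞ⁿ` onto a set containing `C`. -/
theorem stable_face_lemma {n : ℕ} (C : Set (Fin n → ℝ)) (hC : IsConvexPolyhedron C)
    (hcone : IsCone C) (hint : (interior C).Nonempty) (k : ℕ)
    (hk : k = Module.finrank ℝ (Submodule.span ℝ (apexSet C))) (hkn : k < n) :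
    deltaFun C k 0 1 ≠ ⊤ ∧ 0 < deltaFun C k 0 1 ∧
      ∀ p ∈ KCone C, 0 < EMetric.infEdist p (apexSet C) →
        ∃ (abar : Fin n → ℝ) (γ : ℝ) (P F : Set (Fin n → ℝ)),
          abar ∈ apexSet C ∧
          EMetric.infEdist p (apexSet C) ≤ ENNReal.ofReal γ ∧
          P ∈ familyI n k ∧ IsExposed ℝ P F ∧ F.Nonempty ∧ F ∩ apexSet C = ∅ ∧
          p ∈ (fun x => abar + γ • x) '' F ∧
          deltaFun C k abar γ ≤ setEDist ((fun x => abar + γ • x) '' F) (apexSet C) ∧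
          deltaFun C k abar γ = ENNReal.ofReal γ * deltaFun C k 0 1 ∧
          EMetric.infEdist p (apexSet C) * deltaFun C k 0 1 ≤
            ENNReal.ofReal γ * deltaFun C k 0 1 ∧
          0 < EMetric.infEdist p (apexSet C) * deltaFun C k 0 1 ∧
          ∀ X : Set (Fin n → ℝ), C ⊆ X →
            ∀ r : (Fin n → ℝ) → (Fin n → ℝ), LipschitzWith 1 r →
              (∀ x, r x ∈ X) → (∀ x ∈ X, r x = x) →
              r '' ((fun x => abar + γ • x) '' F) ⊆ (fun x => abar + γ • x) '' F := by

  have hne : C.Nonempty := hint.mono interior_subset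
  set V := apexSubmodule C hC.convex hcone hne with hVdef
  have hV : (V : Set (Fin n → ℝ)) = apexSet C := rfl
  have hVC : ∀ x ∈ V, x ∈ C := fun x hx => hx.1
  rw [← hV, Submodule.span_eq] at hk
  subst hk
  have hpos : 0 < deltaFun C (Module.finrank ℝ V) 0 1 :=
    deltaFun_zero_one_pos _ (hV ▸ V.closed_of_finiteDimensional)
  have hfin : deltaFun C (Module.finrank ℝ V) 0 1 ≠ ⊤ := by
    have hVtop : V ≠ ⊤ := by
      intro h
      rw [h, finrank_top, Module.finrank_fin_fun] at hkn
      exact lt_irrefl n hkn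
    obtain ⟨p, -, hp⟩ := SetLike.exists_of_lt (lt_top_iff_ne_top.2 hVtop)
    obtain ⟨-, -, P, hP, F, hF, ⟨x, hx⟩, hdisj, -⟩ :=
      exists_stable_face V (N := {q | q.1 = 1 ∨ q.1 = -1}) (fun q hq => hq) hp fun a _ => by
        obtain ⟨i, hi⟩ := exists_abs_eq_norm (p - a) ((Nat.zero_le _).trans_lt hkn)
        rcases abs_choice ((p - a) i) with h | h <;> rw [h] at hi
        · exact ⟨(1, i), Or.inl rfl, by rw [one_mul, hi]⟩
        · exact ⟨(-1, i), Or.inr rfl, by rw [neg_one_mul, hi]⟩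
    refine ne_top_of_le_ne_top (edist_ne_top ((0 : Fin n → ℝ) + (1 : ℝ) • x) 0) ?_
    refine (iInf₂_le P hP).trans ((iInf_le _ F).trans ((iInf_le _ hF).trans
      ((iInf₂_le ⟨x, hx⟩ hdisj).trans ?_)))
    exact (iInf₂_le _ (Set.mem_image_of_mem _ hx)).trans (iInf₂_le 0 V.zero_mem)
  refine ⟨hfin, hpos, fun p hp hη => ?_⟩
  have hpV : p ∉ V := fun h => hη.ne' (Metric.infEDist_zero_of_mem h)
  obtain ⟨a, ha, P, hP, F, hF, hFne, hdisj, hpF, hstab⟩ :=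
    exists_stable_face V (N := dominatedCoords C) (fun q hq => hq.1) hpV
      fun a ha => exists_dominatedCoords_of_mem_KCone hp ha
  have hγ : 0 < ‖p - a‖ := norm_pos_iff.2 fun h => hpV (by rwa [sub_eq_zero.1 h])
  have hηγ : EMetric.infEdist p (apexSet C) ≤ ENNReal.ofReal ‖p - a‖ := by
    rw [← dist_eq_norm, ← edist_dist]
    exact Metric.infEDist_le_edist_of_mem ha
  refine ⟨a, ‖p - a‖, P, F, ha, hηγ, hP, hF, hFne, hdisj, hpF, ?_, deltaFun_eq_mul _ V hV ha hγ,
    mul_le_mul_left hηγ _, ENNReal.mul_pos hη.ne' hpos.ne', fun X hX r hr hrX hfix => ?_⟩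
  · exact (iInf₂_le P hP).trans ((iInf_le _ F).trans ((iInf_le _ hF).trans
      (iInf₂_le hFne hdisj)))
  · have hrC : ∀ x, ∀ c ∈ C, ‖r x - c‖ ≤ ‖x - c‖ := fun x c hc => by
      have := hr.dist_le_mul x c
      rwa [hfix c (hX hc), NNReal.coe_one, one_mul, dist_eq_norm, dist_eq_norm] at this
    exact hstab r (fun x c hc => hrC x c (hVC c hc)) fun q hq x =>
      mul_le_mul_of_mem_dominatedCoords hcone hrC hq x
end
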